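/- arXiv:1812.01092 — 2 statements merged into one kernel-verified Lean document; each statement's English description precedes it below -/
import Mathlib

section
/- Let X be a random vector supported in [−1,+1]^n satisfying a 𝔡-LSI(σ²), and let f_d(x) = Σ_{k=1}^d Σ_{1 ≤ i_1 ≠ … ≠ i_k ≤ n} a^k_{i_1…i_k} x_{i_1}⋯x_{i_k} be a multilinear polynomial of degree d, where each a^k is a symmetric k-tensor vanishing on the generalized diagonal. Then there exists a constant C > 0 depending only on d such that for all t ≥ 0, ℙ( |f_d(X) − 𝔼 f_d(X)| ≥ t ) ≤ 2 exp( −(1/C) · min_{k=1,…,d} min_{𝓘 ∈ P_k} ( t / ( σ^k ‖𝔼 ∇^{(k)} f_d(X)‖_𝓘 ) )^{2/|𝓘|} ). -/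
open MeasureTheory Finset Real Filter

noncomputable section

/-- Operator norm of a `k`-tensor indexed by tuples in `[n]^k`. -/
def tOp {n k : ℕ} (A : (Fin k → Fin n) → ℝ) : ℝ :=
  ⨆ v : {v : Fin k → Fin n → ℝ // ∀ j, ∑ i, (v j i) ^ 2 ≤ 1},
    ∑ idx : Fin k → Fin n, (∏ j, v.1 j (idx j)) * A idx

/-- `k`-th order difference `𝔥_{i_1 … i_k} f` (L^∞ taken as sup over the involved coordinates). -/
def hOrd {n : ℕ} {𝒳 : Fin n → Type*} (f : (∀ i, 𝒳 i) → ℝ) (k : ℕ)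
    (idx : Fin k → Fin n) (x : ∀ i, 𝒳 i) : ℝ :=
  ⨆ y : (∀ i, 𝒳 i) × (∀ i, 𝒳 i),
    |∑ S ∈ (Finset.univ : Finset (Fin k)).powerset, (-1 : ℝ) ^ S.card *
      f (fun i => if i ∈ Finset.image idx S then y.2 i
                  else if i ∈ Finset.image idx Finset.univ then y.1 i else x i)|

/-- The `k`-tensor `𝔥^{(k)} f`. -/
def hT {n : ℕ} {𝒳 : Fin n → Type*} (f : (∀ i, 𝒳 i) → ℝ) (k : ℕ)
    (idx : Fin k → Fin n) (x : ∀ i, 𝒳 i) : ℝ :=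
  if Function.Injective idx then hOrd f k idx x else 0

/-- First order difference `𝔥_i f` (sup over both replaced coordinates). -/
def hI {n : ℕ} {𝒳 : Fin n → Type*} (f : (∀ i, 𝒳 i) → ℝ) (i : Fin n) (x : ∀ j, 𝒳 j) : ℝ :=
  ⨆ y : 𝒳 i × 𝒳 i, |f (Function.update x i y.1) - f (Function.update x i y.2)|

/-- `𝔥⁺_i f`. -/
def hPlusI {n : ℕ} {𝒳 : Fin n → Type*} (f : (∀ i, 𝒳 i) → ℝ) (i : Fin n) (x : ∀ j, 𝒳 j) : ℝ :=
  ⨆ y : 𝒳 i, max (f x - f (Function.update x i y)) 0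

/-- `𝔥⁻_i f`. -/
def hMinusI {n : ℕ} {𝒳 : Fin n → Type*} (f : (∀ i, 𝒳 i) → ℝ) (i : Fin n) (x : ∀ j, 𝒳 j) : ℝ :=
  ⨆ y : 𝒳 i, max (f (Function.update x i y) - f x) 0

/-- `L^p(μ)` norm. -/
def lpN {α : Type*} [MeasurableSpace α] (μ : Measure α) (p : ℝ) (g : α → ℝ) : ℝ :=
  (∫ x, |g x| ^ p ∂μ) ^ (1 / p)

/-- Entropy functional `Ent_μ(g)`. -/
def ent {α : Type*} [MeasurableSpace α] (μ : Measure α) (g : α → ℝ) : ℝ :=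
  ∫ x, g x * Real.log (g x) ∂μ - (∫ x, g x ∂μ) * Real.log (∫ x, g x ∂μ)

/-- Variance with respect to a measure. -/
def cVar {β : Type*} [MeasurableSpace β] (ν : Measure β) (g : β → ℝ) : ℝ :=
  ∫ y, (g y - ∫ y', g y' ∂ν) ^ 2 ∂ν

/-- `ν i x` is the conditional distribution of the `i`-th coordinate given the others. -/
def IsCondKernel {n : ℕ} {𝒳 : Fin n → Type*} [∀ i, MeasurableSpace (𝒳 i)]
    (μ : Measure (∀ i, 𝒳 i)) (ν : ∀ i, (∀ j, 𝒳 j) → Measure (𝒳 i)) : Prop :=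
  (∀ i x, IsProbabilityMeasure (ν i x)) ∧
  (∀ i x x', (∀ j, j ≠ i → x j = x' j) → ν i x = ν i x') ∧
  (∀ i (g : (∀ j, 𝒳 j) → ℝ), Measurable g → (∃ M, ∀ x, |g x| ≤ M) →
    ∫ x, ∫ y, g (Function.update x i y) ∂(ν i x) ∂μ = ∫ x, g x ∂μ)

/-- `|𝔡 f|²`. -/
def dSq {n : ℕ} {𝒳 : Fin n → Type*} [∀ i, MeasurableSpace (𝒳 i)]
    (ν : ∀ i, (∀ j, 𝒳 j) → Measure (𝒳 i)) (f : (∀ i, 𝒳 i) → ℝ) (x : ∀ i, 𝒳 i) : ℝ :=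
  ∑ i, cVar (ν i x) (fun y => f (Function.update x i y))

/-- The `𝔡`-logarithmic Sobolev inequality with constant `σ2`. -/
def DLSI {n : ℕ} {𝒳 : Fin n → Type*} [∀ i, MeasurableSpace (𝒳 i)]
    (μ : Measure (∀ i, 𝒳 i)) (ν : ∀ i, (∀ j, 𝒳 j) → Measure (𝒳 i)) (σ2 : ℝ) : Prop :=
  IsCondKernel μ ν ∧
  ∀ f : (∀ i, 𝒳 i) → ℝ, Measurable f → (∃ M, ∀ x, |f x| ≤ M) →
    ent μ (fun x => f x ^ 2) ≤ 2 * σ2 * ∫ x, dSq ν f x ∂μ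

end

noncomputable section

/-- `P` is a partition of `{1,…,k}`. -/
def IsPartition {k : ℕ} (P : Finset (Finset (Fin k))) : Prop :=
  (∀ I ∈ P, I.Nonempty) ∧ (∀ I ∈ P, ∀ J ∈ P, I ≠ J → Disjoint I J) ∧
    ∀ s : Fin k, ∃ I ∈ P, s ∈ I

/-- The norm `‖A‖_𝓘` associated to a partition `P` of `{1,…,k}`. -/
def partNorm {n k : ℕ} (P : Finset (Finset (Fin k))) (A : (Fin k → Fin n) → ℝ) : ℝ :=
  ⨆ x : {x : ∀ I : Finset (Fin k), (↥I → Fin n) → ℝ //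
      ∀ I ∈ P, ∑ u : ↥I → Fin n, x I u ^ 2 ≤ 1},
    ∑ idx : Fin k → Fin n, A idx * ∏ I ∈ P, x.1 I (fun s => idx s.1)

/-- Entry `(i_1,…,i_k)` of the tensor `∇^{(k)} f (x)` of `k`-th order partial derivatives. -/
def gradT {n : ℕ} (k : ℕ) (f : (Fin n → ℝ) → ℝ) (x : Fin n → ℝ)
    (idx : Fin k → Fin n) : ℝ :=
  iteratedFDeriv ℝ k f x (fun s => Pi.single (idx s) (1 : ℝ))

/-- The multilinear (tetrahedral) polynomial `f_d`. -/
def fd {n : ℕ} (d : ℕ) (a : (k : ℕ) → (Fin k → Fin n) → ℝ) (x : Fin n → ℝ) : ℝ :=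
  ∑ k ∈ Finset.Icc 1 d, ∑ idx : Fin k → Fin n, a k idx * ∏ s, x (idx s)

theorem integrable_of_bdd {α : Type*} [MeasurableSpace α] {μ : Measure α} [IsFiniteMeasure μ]
    {g : α → ℝ} (hg : Measurable g) (hb : ∃ M, ∀ x, |g x| ≤ M) : Integrable g μ := by
  obtain ⟨M, hM⟩ := hb
  exact Integrable.of_bound hg.aestronglyMeasurable M (ae_of_all _ (by simpa using hM))

theorem integral_add_const_of_integrable {α : Type*} [MeasurableSpace α] {μ : Measure α}
    [IsProbabilityMeasure μ] {g : α → ℝ} (hg : Integrable g μ) (c : ℝ) :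
    ∫ x, (g x + c) ∂μ = (∫ x, g x ∂μ) + c := by
  rw [integral_add hg (by simp)]; simp

theorem integral_pos_of_sq_pos {α : Type*} [MeasurableSpace α] {μ : Measure α}
    [IsProbabilityMeasure μ] {u : α → ℝ} (hu : Measurable u) (h0 : ∀ x, 0 ≤ u x)
    (hb : ∃ M, ∀ x, |u x| ≤ M) (ha : 0 < ∫ x, u x ^ 2 ∂μ) : 0 < ∫ x, u x ∂μ := by
  by_contra hneg
  have hbz : ∫ x, u x ∂μ = 0 := le_antisymm (not_lt.mp hneg) (integral_nonneg h0)
  have := (integral_eq_zero_iff_of_nonneg h0 (integrable_of_bdd hu hb)).1 hbz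
  have h2 : ∫ x, u x ^ 2 ∂μ = 0 := by
    rw [integral_congr_ae (g := fun _ => (0 : ℝ))]
    · simp
    · filter_upwards [this] with x hx
      simp at hx
      simp [hx]
  linarith

theorem le_ent_sq {α : Type*} [MeasurableSpace α] (μ : Measure α) [IsProbabilityMeasure μ]
    (u : α → ℝ) (hu : Measurable u) (h0 : ∀ x, 0 ≤ u x) (hb : ∃ M, ∀ x, |u x| ≤ M)
    (ha : 0 < ∫ x, u x ^ 2 ∂μ) :
    (∫ x, u x ^ 2 ∂μ) * Real.log ((∫ x, u x ^ 2 ∂μ) / (∫ x, u x ∂μ) ^ 2) ≤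
      ent μ (fun x => u x ^ 2) := by
  obtain ⟨M, hM⟩ := hb
  have iu : Integrable u μ := integrable_of_bdd hu ⟨M, hM⟩
  have hsq : ∀ x, u x ^ 2 ≤ M ^ 2 := fun x => by
    rw [← sq_abs]; exact pow_le_pow_left₀ (abs_nonneg _) (hM x) 2
  have iu2 : Integrable (fun x => u x ^ 2) μ :=
    integrable_of_bdd (hu.pow_const 2) ⟨M ^ 2, fun x => by
      rw [abs_of_nonneg (sq_nonneg _)]; exact hsq x⟩
  set a := ∫ x, u x ^ 2 ∂μ with haa
  set b := ∫ x, u x ∂μ with hbb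
  have hb0 : 0 < b := integral_pos_of_sq_pos hu h0 ⟨M, hM⟩ ha
  have il : Integrable (fun x => u x ^ 2 * Real.log (u x ^ 2)) μ := by
    have hc : Continuous (fun t : ℝ => t * Real.log t) := Real.continuous_mul_log
    obtain ⟨K, hK⟩ := (isCompact_Icc (a := (0 : ℝ)) (b := M ^ 2)).exists_bound_of_continuousOn
      hc.continuousOn
    exact integrable_of_bdd (hc.measurable.comp (hu.pow_const 2))
      ⟨K, fun x => by simpa using hK (u x ^ 2) ⟨sq_nonneg _, hsq x⟩⟩
  have hc0 : 0 < a / b := div_pos ha hb0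
  have hpt : ∀ x, 2 * Real.log (a / b) * u x ^ 2 + 2 * u x ^ 2 - 2 * (a / b) * u x ≤
      u x ^ 2 * Real.log (u x ^ 2) := by
    intro x
    rcases (h0 x).eq_or_lt with h | h
    · simp [← h]
    · have h1 := Real.one_sub_inv_le_log_of_pos (div_pos h hc0)
      rw [Real.log_div h.ne' hc0.ne'] at h1
      rw [Real.log_pow]
      have h3 : u x ^ 2 * (1 - (u x / (a / b))⁻¹) = u x ^ 2 - (a / b) * u x := by
        field_simp
      have h4 := mul_le_mul_of_nonneg_left h1 (sq_nonneg (u x))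
      rw [h3] at h4
      push_cast
      nlinarith
  have hInt := integral_mono (by fun_prop) il hpt
  rw [integral_sub (by fun_prop) (by fun_prop), integral_add (by fun_prop) (by fun_prop),
    integral_const_mul, integral_const_mul, integral_const_mul, ← haa, ← hbb] at hInt
  have e1 : 2 * (a / b) * b = 2 * a := by field_simp
  rw [e1] at hInt
  unfold ent
  rw [← haa]
  rw [Real.log_div ha.ne' (by positivity), Real.log_pow]
  rw [Real.log_div ha.ne' hb0.ne'] at hInt
  push_cast
  nlinarith

/-- An entropy lower bound in terms of the variance. -/
theorem sub_le_ent_sq {α : Type*} [MeasurableSpace α] (μ : Measure α) [IsProbabilityMeasure μ]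
    (u : α → ℝ) (hu : Measurable u) (h0 : ∀ x, 0 ≤ u x) (hb : ∃ M, ∀ x, |u x| ≤ M)
    (ha : 0 < ∫ x, u x ^ 2 ∂μ) (hb0 : 0 < ∫ x, u x ∂μ) :
    (∫ x, u x ^ 2 ∂μ) - (∫ x, u x ∂μ) ^ 2 ≤ ent μ (fun x => u x ^ 2) := by
  refine le_trans ?_ (le_ent_sq μ u hu h0 hb ha)
  have h := Real.one_sub_inv_le_log_of_pos (div_pos ha (pow_pos hb0 2))
  have h2 := mul_le_mul_of_nonneg_left h ha.le
  refine le_trans (le_of_eq ?_) h2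
  field_simp

theorem abs_integral_le_of_bdd {α : Type*} [MeasurableSpace α] (μ : Measure α)
    [IsProbabilityMeasure μ] {g : α → ℝ} {M : ℝ} (hM : ∀ x, |g x| ≤ M) :
    |∫ x, g x ∂μ| ≤ M := by
  have := norm_integral_le_of_norm_le_const (μ := μ) (f := g) (C := M)
    (ae_of_all _ (by simpa using hM))
  simpa using this

section Kernel

variable {n : ℕ} {𝒳 : Fin n → Type*} [∀ i, MeasurableSpace (𝒳 i)]
  {μ : Measure (∀ i, 𝒳 i)} {ν : ∀ i, (∀ j, 𝒳 j) → Measure (𝒳 i)}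

theorem IsCondKernel.aestronglyMeasurable [IsProbabilityMeasure μ] (h : IsCondKernel μ ν) (i : Fin n)
    (g : (∀ j, 𝒳 j) → ℝ) (hg : Measurable g) (hb : ∃ M, ∀ x, |g x| ≤ M) :
    AEStronglyMeasurable (fun x => ∫ y, g (Function.update x i y) ∂(ν i x)) μ := by
  obtain ⟨h1, -, h3⟩ := h
  by_contra hn
  have key : ∀ c : ℝ, ∫ x, (g x + c) ∂μ = 0 := by
    intro c
    rw [← h3 i (fun x => g x + c) (hg.add_const c)
      (hb.imp' (fun M => M + |c|) fun M hM x => (abs_add_le _ _).trans (by gcongr; exact hM x))]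
    apply integral_undef
    intro hi
    apply hn
    have : (fun x => ∫ y, g (Function.update x i y) ∂(ν i x)) =
        fun x => (∫ y, (g (Function.update x i y) + c) ∂(ν i x)) - c := by
      funext x
      have := h1 i x
      rw [integral_add_const_of_integrable (g := fun y => g (Function.update x i y))
        (integrable_of_bdd (hg.comp (measurable_update x)) (hb.imp fun M hM y => hM _))]
      ring
    rw [this]
    exact (hi.aestronglyMeasurable).sub aestronglyMeasurable_const
  have ig := integrable_of_bdd (μ := μ) hg hb
  have e0 := key 0
  have e1 := key 1
  rw [integral_add ig (by simp)] at e0 e1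
  simp at e0 e1
  linarith

theorem IsCondKernel.integrable [IsProbabilityMeasure μ] (h : IsCondKernel μ ν) (i : Fin n)
    (g : (∀ j, 𝒳 j) → ℝ) (hg : Measurable g) (hb : ∃ M, ∀ x, |g x| ≤ M) :
    Integrable (fun x => ∫ y, g (Function.update x i y) ∂(ν i x)) μ := by
  have hm := h.aestronglyMeasurable i g hg hb
  obtain ⟨M, hM⟩ := hb
  refine Integrable.of_bound hm M (ae_of_all _ fun x => ?_)
  have := h.1 i x
  exact abs_integral_le_of_bdd _ fun y => hM _

theorem cVar_nonneg {β : Type*} [MeasurableSpace β] (ρ : Measure β) (g : β → ℝ) :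
    0 ≤ cVar ρ g := integral_nonneg fun _ => sq_nonneg _

theorem dSq_nonneg (f : (∀ i, 𝒳 i) → ℝ) (x : ∀ i, 𝒳 i) : 0 ≤ dSq ν f x :=
  Finset.sum_nonneg fun _ _ => cVar_nonneg _ _

theorem dSq_add_const (h : IsCondKernel μ ν) (f : (∀ i, 𝒳 i) → ℝ) (hf : Measurable f)
    (hb : ∃ M, ∀ x, |f x| ≤ M) (c : ℝ) (x : ∀ i, 𝒳 i) :
    dSq ν (fun y => f y + c) x = dSq ν f x := by
  unfold dSq cVar
  refine Finset.sum_congr rfl fun i _ => ?_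
  have := h.1 i x
  rw [integral_add_const_of_integrable (g := fun y => f (Function.update x i y))
    (integrable_of_bdd (hf.comp (measurable_update x)) (hb.imp fun M hM y => hM _))]
  simp

/-- A logarithmic Sobolev inequality implies a Poincaré inequality. -/
theorem DLSI.variance_le [IsProbabilityMeasure μ] {σ2 : ℝ} (h : DLSI μ ν σ2)
    (f : (∀ i, 𝒳 i) → ℝ) (hf : Measurable f) (hb : ∃ M, ∀ x, |f x| ≤ M) :
    ∫ x, (f x - ∫ y, f y ∂μ) ^ 2 ∂μ ≤ 2 * σ2 * ∫ x, dSq ν f x ∂μ := by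
  obtain ⟨M, hM⟩ := hb
  have ifi := integrable_of_bdd (μ := μ) hf ⟨M, hM⟩
  have if2 : Integrable (fun x => f x ^ 2) μ := integrable_of_bdd (hf.pow_const 2) ⟨M ^ 2, fun x => by
    rw [abs_pow]; exact pow_le_pow_left₀ (abs_nonneg _) (hM x) 2⟩
  set c := M + 1
  have hpos : ∀ x, 1 ≤ f x + c := fun x => by
    have := (abs_le.1 (hM x)).1
    simp only [c]; linarith
  have hbd : ∀ x, |f x + c| ≤ M + |c| := fun x => (abs_add_le _ _).trans (by gcongr; exact hM x)
  have hm : Measurable (fun x => f x + c) := hf.add_const c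
  have e1 : ∫ x, (f x + c) ∂μ = (∫ x, f x ∂μ) + c := by
    rw [integral_add ifi (by simp)]; simp
  have e2 : ∫ x, (f x + c) ^ 2 ∂μ = (∫ x, f x ^ 2 ∂μ) + 2 * c * (∫ x, f x ∂μ) + c ^ 2 := by
    have : ∀ x, (f x + c) ^ 2 = f x ^ 2 + 2 * c * f x + c ^ 2 := fun x => by ring
    simp_rw [this]
    rw [integral_add (by fun_prop) (by simp), integral_add (by fun_prop) (by fun_prop),
      integral_const_mul]
    simp
  have e3 : ∫ x, (f x - ∫ y, f y ∂μ) ^ 2 ∂μ = (∫ x, f x ^ 2 ∂μ) - (∫ x, f x ∂μ) ^ 2 := by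
    set b := ∫ y, f y ∂μ
    have : ∀ x, (f x - b) ^ 2 = f x ^ 2 - 2 * b * f x + b ^ 2 := fun x => by ring
    simp_rw [this]
    rw [integral_add (by fun_prop) (by simp), integral_sub (by fun_prop) (by fun_prop),
      integral_const_mul]
    simp [b]; ring
  have ip : 1 ≤ ∫ x, (f x + c) ∂μ := by
    have := integral_mono (μ := μ) (f := fun _ => (1 : ℝ)) (by simp) (ifi.add (by simp)) hpos
    simpa using this
  have ip2 : 1 ≤ ∫ x, (f x + c) ^ 2 ∂μ := by
    have := integral_mono (μ := μ) (f := fun _ => (1 : ℝ)) (g := fun x => (f x + c) ^ 2) (by simp)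
      (integrable_of_bdd (hm.pow_const 2) ⟨(M + |c|) ^ 2, fun x => by
        rw [abs_pow]; exact pow_le_pow_left₀ (abs_nonneg _) (hbd x) 2⟩)
      (fun x => by nlinarith [hpos x])
    simpa using this
  have h1 := sub_le_ent_sq μ (fun x => f x + c) hm (fun x => zero_le_one.trans (hpos x))
    ⟨_, hbd⟩ (by linarith) (by linarith)
  have h2 := h.2 (fun x => f x + c) hm ⟨_, hbd⟩
  simp_rw [dSq_add_const h.1 f hf ⟨M, hM⟩ c] at h2
  refine le_trans (le_of_eq ?_) (h1.trans h2)
  rw [e1, e2, e3]; ring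

end Kernel

/-- The space of tetrahedral polynomials of degree less than `r`. -/
def tetra (n r : ℕ) : Submodule ℝ ((Fin n → ℝ) → ℝ) :=
  Submodule.span ℝ ((fun S : Finset (Fin n) => fun x : Fin n → ℝ => ∏ i ∈ S, x i) ''
    {S | S.card < r})

section Tetra

variable {n r : ℕ} {f : (Fin n → ℝ) → ℝ}

theorem prod_mem_tetra (S : Finset (Fin n)) (h : S.card < r) :
    (fun x : Fin n → ℝ => ∏ i ∈ S, x i) ∈ tetra n r :=
  Submodule.subset_span ⟨S, h, rfl⟩

theorem tetra_zero (hf : f ∈ tetra n 0) : f = 0 := by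
  simpa [tetra] using hf

theorem tetra_contDiff (hf : f ∈ tetra n r) : ContDiff ℝ ⊤ f := by
  induction hf using Submodule.span_induction with
  | mem x h => obtain ⟨S, -, rfl⟩ := h; fun_prop
  | zero => exact contDiff_const
  | add x y _ _ hx hy => exact hx.add hy
  | smul c x _ hx => exact hx.const_smul c

theorem tetra_continuous (hf : f ∈ tetra n r) : Continuous f := (tetra_contDiff hf).continuous

theorem tetra_differentiable (hf : f ∈ tetra n r) : Differentiable ℝ f :=
  (tetra_contDiff hf).differentiable (by simp)

theorem tetra_update (hf : f ∈ tetra n r) (x : Fin n → ℝ) (i : Fin n) (y : ℝ) :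
    f (Function.update x i y) = f (Function.update x i 0) +
      y * (f (Function.update x i 1) - f (Function.update x i 0)) := by
  induction hf using Submodule.span_induction with
  | mem g h =>
    obtain ⟨S, -, rfl⟩ := h
    by_cases hi : i ∈ S
    · simp [Finset.prod_update_of_mem hi]
    · simp [Finset.prod_update_of_notMem hi]
  | zero => simp
  | add g h _ _ hx hy => simp only [Pi.add_apply]; rw [hx, hy]; ring
  | smul c g _ hx => simp only [Pi.smul_apply, smul_eq_mul]; rw [hx]; ring

theorem tetra_fderiv_single (hf : f ∈ tetra n r) (x : Fin n → ℝ) (i : Fin n) :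
    fderiv ℝ f x (Pi.single i 1) = f (Function.update x i 1) - f (Function.update x i 0) := by
  have h1 : HasDerivAt (fun y => f (Function.update x i y))
      (fderiv ℝ f (Function.update x i (x i)) (Pi.single i 1)) (x i) :=
    ((tetra_differentiable hf) _).hasFDerivAt.comp_hasDerivAt (x i) (hasDerivAt_update x i (x i))
  have h2 : HasDerivAt (fun y => f (Function.update x i y))
      (f (Function.update x i 1) - f (Function.update x i 0)) (x i) := by
    have : (fun y => f (Function.update x i y)) = fun y => f (Function.update x i 0) +
      y * (f (Function.update x i 1) - f (Function.update x i 0)) :=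
      funext fun y => tetra_update hf x i y
    rw [this]
    simpa using ((hasDerivAt_id (x i)).mul_const
      (f (Function.update x i 1) - f (Function.update x i 0))).const_add (f (Function.update x i 0))
  rw [Function.update_eq_self] at h1
  exact h1.unique h2

theorem tetra_fderiv (hf : f ∈ tetra n (r + 1)) (v : Fin n → ℝ) :
    (fun x => fderiv ℝ f x v) ∈ tetra n r := by
  induction hf using Submodule.span_induction with
  | mem g h =>
    obtain ⟨S, hS, rfl⟩ := h
    have : (fun x => fderiv ℝ (fun x : Fin n → ℝ => ∏ i ∈ S, x i) x v) =
        ∑ i ∈ S, v i • fun x : Fin n → ℝ => ∏ j ∈ S.erase i, x j := by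
      funext x
      have h := HasFDerivAt.finsetProd (𝕜 := ℝ) (u := S) (g := fun i (x : Fin n → ℝ) => x i)
        (g' := fun i => ContinuousLinearMap.proj (R := ℝ) (φ := fun _ : Fin n => ℝ) i) (x := x) (fun i _ => hasFDerivAt_apply i x)
      rw [h.fderiv]
      simp [mul_comm]
    rw [this]
    refine Submodule.sum_mem _ fun i hi => Submodule.smul_mem _ _ (prod_mem_tetra _ ?_)
    rw [Finset.card_erase_of_mem hi]
    have := Finset.card_pos.2 ⟨i, hi⟩
    have : S.card < r + 1 := hS
    omega
  | zero =>
    have : (fun x => fderiv ℝ (0 : (Fin n → ℝ) → ℝ) x v) = 0 := by funext x; simp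
    rw [this]; exact Submodule.zero_mem _
  | add g h hg hh hx hy =>
    have : (fun x => fderiv ℝ (g + h) x v) = (fun x => fderiv ℝ g x v) + fun x => fderiv ℝ h x v := by
      funext x
      rw [fderiv_add (tetra_differentiable hg x) (tetra_differentiable hh x)]; simp
    rw [this]; exact Submodule.add_mem _ hx hy
  | smul c g hg hx =>
    have : (fun x => fderiv ℝ (c • g) x v) = c • fun x => fderiv ℝ g x v := by
      funext x
      rw [fderiv_const_smul (tetra_differentiable hg x)]; simp
    rw [this]; exact Submodule.smul_mem _ _ hx

theorem iteratedFDeriv_cons {k : ℕ} (hf : f ∈ tetra n r) (x : Fin n → ℝ)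
    (g : Fin n → ℝ) (G : Fin k → Fin n → ℝ) :
    iteratedFDeriv ℝ (k + 1) f x (Fin.cons g G) =
      fderiv ℝ (fun z => iteratedFDeriv ℝ k f z G) x g := by
  rw [iteratedFDeriv_succ_apply_left]
  have hd : DifferentiableAt ℝ (iteratedFDeriv ℝ k f) x :=
    ((tetra_contDiff hf).differentiable_iteratedFDeriv (m := k) (by
      exact_mod_cast WithTop.coe_lt_top _)) x
  have e := fderiv_continuousMultilinear_apply_const_apply hd G g
  simpa using e.symm

theorem tetra_iteratedFDeriv {k : ℕ} (hf : f ∈ tetra n (r + k)) (G : Fin k → Fin n → ℝ) :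
    (fun x => iteratedFDeriv ℝ k f x G) ∈ tetra n r := by
  induction k generalizing r with
  | zero => simpa using hf
  | succ k ih =>
    have e : ∀ x, iteratedFDeriv ℝ (k + 1) f x G =
        fderiv ℝ (fun z => iteratedFDeriv ℝ k f z (Fin.tail G)) x (G 0) := fun x => by
      rw [← iteratedFDeriv_cons hf, Fin.cons_self_tail]
    simp_rw [e]
    exact tetra_fderiv (ih (r := r + 1) (by rwa [add_assoc, add_comm 1 k]) _) _

theorem sum_gradT {k : ℕ} (x : Fin n → ℝ) (G : Fin k → Fin n → ℝ) :
    iteratedFDeriv ℝ k f x G = ∑ idx : Fin k → Fin n, gradT k f x idx * ∏ s, G s (idx s) := by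
  have : G = fun s => ∑ i, G s i • (Pi.single i (1 : ℝ) : Fin n → ℝ) := by
    funext s j
    simp [Finset.sum_apply, Pi.single_apply]
  conv_lhs => rw [this]
  rw [ContinuousMultilinearMap.map_sum]
  refine Finset.sum_congr rfl fun idx _ => ?_
  rw [ContinuousMultilinearMap.map_smul_univ, smul_eq_mul, mul_comm]
  rfl

theorem fd_mem_tetra (d : ℕ) (a : (k : ℕ) → (Fin k → Fin n) → ℝ)
    (ha : ∀ k (idx : Fin k → Fin n), ¬Function.Injective idx → a k idx = 0) :
    fd d a ∈ tetra n (d + 1) := by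
  have : fd d a = ∑ k ∈ Finset.Icc 1 d, ∑ idx : Fin k → Fin n,
      a k idx • fun x : Fin n → ℝ => ∏ s, x (idx s) := by
    funext x; simp [fd]
  rw [this]
  refine Submodule.sum_mem _ fun k hk => Submodule.sum_mem _ fun idx _ => ?_
  by_cases hi : Function.Injective idx
  · refine Submodule.smul_mem _ _ ?_
    have e : (fun x : Fin n → ℝ => ∏ s, x (idx s)) =
        fun x => ∏ i ∈ Finset.univ.image idx, x i := by
      funext x; rw [Finset.prod_image fun _ _ _ _ h => hi h]
    rw [e]
    refine prod_mem_tetra _ ?_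
    have h1 := Finset.card_image_le (s := Finset.univ) (f := idx)
    simp at h1 hk
    omega
  · simp [ha k idx hi]

/-- Coordinatewise projection onto the cube `[-1,1]^n`. -/
def clip (x : Fin n → ℝ) (i : Fin n) : ℝ := max (-1) (min 1 (x i))

theorem abs_clip_le (x : Fin n → ℝ) (i : Fin n) : |clip x i| ≤ 1 := by
  unfold clip
  rw [abs_le]
  exact ⟨le_max_left _ _, max_le (by norm_num) (min_le_left _ _)⟩

theorem clip_of_mem {x : Fin n → ℝ} (h : ∀ i, x i ∈ Set.Icc (-1 : ℝ) 1) : clip x = x := by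
  funext i
  unfold clip
  rw [min_eq_right (h i).2, max_eq_right (h i).1]

theorem clip_update (x : Fin n → ℝ) (i : Fin n) (y : ℝ) :
    clip (Function.update x i y) = Function.update (clip x) i (max (-1) (min 1 y)) := by
  funext j
  rcases eq_or_ne j i with rfl | h
  · simp [clip]
  · simp [clip, h]

theorem measurable_clip : Measurable (clip : (Fin n → ℝ) → Fin n → ℝ) := by
  unfold clip; fun_prop

theorem exists_bound_clip {g : (Fin n → ℝ) → ℝ} (hg : Continuous g) :
    ∃ M, ∀ x, |g (clip x)| ≤ M := by
  obtain ⟨K, hK⟩ := (isCompact_univ_pi fun _ : Fin n => isCompact_Icc (a := (-1 : ℝ))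
    (b := 1)).exists_bound_of_continuousOn hg.continuousOn
  exact ⟨K, fun x => by simpa using hK (clip x) fun i _ => abs_le.1 (abs_clip_le x i)⟩

theorem integral_clip {μ : Measure (Fin n → ℝ)} (h : ∀ᵐ x ∂μ, ∀ i, x i ∈ Set.Icc (-1 : ℝ) 1)
    (g : (Fin n → ℝ) → ℝ) : ∫ x, g (clip x) ∂μ = ∫ x, g x ∂μ :=
  integral_congr_ae (h.mono fun x hx => by simp only []; rw [clip_of_mem hx])

theorem integrable_of_cube {μ : Measure (Fin n → ℝ)} [IsProbabilityMeasure μ]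
    (h : ∀ᵐ x ∂μ, ∀ i, x i ∈ Set.Icc (-1 : ℝ) 1)
    {g : (Fin n → ℝ) → ℝ} (hg : Continuous g) : Integrable g μ := by
  refine (integrable_of_bdd (hg.measurable.comp measurable_clip)
    (exists_bound_clip hg)).congr (h.mono fun x hx => ?_)
  simp [clip_of_mem hx]

end Tetra

theorem sq_integral_le {α : Type*} [MeasurableSpace α] {μ : Measure α} [IsProbabilityMeasure μ]
    {g : α → ℝ} (hg : Integrable g μ) (hg2 : Integrable (fun x => g x ^ 2) μ) :
    (∫ x, g x ∂μ) ^ 2 ≤ ∫ x, g x ^ 2 ∂μ := by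
  set b := ∫ x, g x ∂μ with hb
  have h0 : 0 ≤ ∫ x, (g x - b) ^ 2 ∂μ := integral_nonneg fun _ => sq_nonneg _
  have : ∀ x, (g x - b) ^ 2 = (g x ^ 2 - 2 * b * g x) + b ^ 2 := fun x => by ring
  simp_rw [this] at h0
  rw [integral_add_const_of_integrable (by fun_prop), integral_sub (by fun_prop) (by fun_prop),
    integral_const_mul, ← hb] at h0
  linarith

theorem young_pow (q : ℕ) {s t : ℝ} (hs : 0 ≤ s) (ht : 0 ≤ t) :
    (q + 1) * (s ^ q * t) ≤ q * s ^ (q + 1) + t ^ (q + 1) := by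
  rcases hs.eq_or_lt with rfl | hs
  · rcases q.eq_zero_or_pos with rfl | hq
    · simp
    · simp [hq.ne']; positivity
  · have h := one_add_mul_le_pow (a := t / s - 1) (by have := div_nonneg ht hs.le; linarith) (q + 1)
    have h2 := mul_le_mul_of_nonneg_left h (pow_pos hs (q + 1)).le
    rw [← mul_pow, show s * (1 + (t / s - 1)) = t by field_simp; ring] at h2
    have e : s ^ (q + 1) * (1 + ((q + 1 : ℕ) : ℝ) * (t / s - 1)) =
      (q + 1) * (s ^ q * t) - q * s ^ (q + 1) := by
      push_cast; field_simp; ring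
    rw [e] at h2
    linarith

theorem cVar_pow_le (ρ : Measure ℝ) [IsProbabilityMeasure ρ] (c : ℝ → ℝ) (hc : Measurable c)
    (hc1 : ∀ y, |c y| ≤ 1) (α β : ℝ) (m : ℕ) :
    cVar ρ (fun y => (α + c y * β) ^ (m + 1)) ≤
      8 * (m + 1 : ℝ) ^ 2 * ∫ y, β ^ 2 * (α + c y * β) ^ (2 * m) ∂ρ := by
  set M := |α| + |β|
  have hM : ∀ y, |α + c y * β| ≤ M := fun y => (abs_add_le _ _).trans (by
    rw [abs_mul]
    have := mul_le_mul_of_nonneg_right (hc1 y) (abs_nonneg β)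
    simp only [M]; linarith)
  have hInt : ∀ k : ℕ, Integrable (fun y => (α + c y * β) ^ k) ρ := fun k =>
    integrable_of_bdd (by fun_prop) ⟨M ^ k, fun y => by
      rw [abs_pow]; exact pow_le_pow_left₀ (abs_nonneg _) (hM y) k⟩
  set u := fun y => (α + c y * β) ^ (m + 1) with hu
  have iu : Integrable u ρ := hInt _
  have hu2 : (fun y => u y ^ 2) = fun y => (α + c y * β) ^ ((m + 1) * 2) := by
    funext y; simp only [hu]; rw [pow_mul]
  have iu2 : Integrable (fun y => u y ^ 2) ρ := by rw [hu2]; exact hInt _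
  set I := ∫ y, (α + c y * β) ^ (2 * m) ∂ρ with hI
  have hpt : ∀ y y', (u y - u y') ^ 2 ≤
      4 * (m + 1 : ℝ) ^ 2 * β ^ 2 * ((α + c y * β) ^ (2 * m) + (α + c y' * β) ^ (2 * m)) := by
    intro y y'
    have h := abs_pow_sub_pow_le (α + c y * β) (α + c y' * β) (m + 1)
    simp only [Nat.add_sub_cancel] at h
    have h1 : |α + c y * β - (α + c y' * β)| ≤ 2 * |β| := by
      rw [show α + c y * β - (α + c y' * β) = (c y - c y') * β by ring, abs_mul]
      gcongr
      have := abs_sub (c y) (c y')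
      linarith [hc1 y, hc1 y']
    set a := |α + c y * β|
    set b := |α + c y' * β|
    have ha : (α + c y * β) ^ (2 * m) = (a ^ m) ^ 2 := by
      rw [← pow_mul, mul_comm m 2, pow_mul, pow_mul, sq_abs]
    have hb : (α + c y' * β) ^ (2 * m) = (b ^ m) ^ 2 := by
      rw [← pow_mul, mul_comm m 2, pow_mul, pow_mul, sq_abs]
    have hmax : (max a b ^ m) ^ 2 ≤ (a ^ m) ^ 2 + (b ^ m) ^ 2 := by
      rcases max_cases a b with ⟨h, -⟩ | ⟨h, -⟩ <;> rw [h] <;> nlinarith [sq_nonneg (a ^ m), sq_nonneg (b ^ m)]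
    rw [ha, hb, ← sq_abs]
    calc |u y - u y'| ^ 2 ≤ (2 * |β| * ((m + 1 : ℕ) : ℝ) * max a b ^ m) ^ 2 := by
          refine pow_le_pow_left₀ (abs_nonneg _) (h.trans ?_) 2
          have : 0 ≤ max a b := le_max_of_le_left (abs_nonneg _)
          gcongr
      _ = 4 * (m + 1 : ℝ) ^ 2 * β ^ 2 * (max a b ^ m) ^ 2 := by
          push_cast; rw [← sq_abs β]; ring
      _ ≤ _ := by gcongr
  have h1 : ∀ y, (u y - ∫ y', u y' ∂ρ) ^ 2 ≤
      4 * (m + 1 : ℝ) ^ 2 * β ^ 2 * ((α + c y * β) ^ (2 * m) + I) := by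
    intro y
    have e : u y - ∫ y', u y' ∂ρ = ∫ y', (u y - u y') ∂ρ := by
      rw [integral_sub (by simp) iu]; simp
    have i1 : Integrable (fun y' => u y - u y') ρ := (integrable_const _).sub iu
    have i2 : Integrable (fun y' => (u y - u y') ^ 2) ρ := by
      have : ∀ y', (u y - u y') ^ 2 = u y ^ 2 - 2 * u y * u y' + u y' ^ 2 := fun _ => by ring
      simp_rw [this]
      exact ((integrable_const _).sub (iu.const_mul _)).add iu2
    rw [e]
    refine (sq_integral_le i1 i2).trans ?_
    refine (integral_mono i2 (((integrable_const _).add (hInt _)).const_mul _) (hpt y)).trans ?_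
    rw [integral_const_mul]
    simp only [Pi.add_apply]
    rw [integral_add (integrable_const _) (hInt _)]
    simp [hI]
  unfold cVar
  refine (integral_mono_of_nonneg (ae_of_all _ fun _ => sq_nonneg _)
    (((hInt _).add (integrable_const _)).const_mul _) (ae_of_all _ h1)).trans ?_
  rw [integral_const_mul, integral_const_mul]
  simp only [Pi.add_apply]
  rw [integral_add_const_of_integrable (hInt _), ← hI]
  apply le_of_eq; ring

/-- Squared Euclidean norm of the gradient. -/
def grSq {n : ℕ} (f : (Fin n → ℝ) → ℝ) (x : Fin n → ℝ) : ℝ :=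
  ∑ i, fderiv ℝ f x (Pi.single i 1) ^ 2

theorem grSq_nonneg {n : ℕ} (f : (Fin n → ℝ) → ℝ) (x : Fin n → ℝ) : 0 ≤ grSq f x :=
  Finset.sum_nonneg fun _ _ => sq_nonneg _

theorem continuous_fderiv_apply {n r : ℕ} {f : (Fin n → ℝ) → ℝ} (hf : f ∈ tetra n r)
    (v : Fin n → ℝ) : Continuous fun x => fderiv ℝ f x v :=
  ((tetra_contDiff hf).continuous_fderiv (by simp)).clm_apply continuous_const

theorem continuous_grSq {n r : ℕ} {f : (Fin n → ℝ) → ℝ} (hf : f ∈ tetra n r) :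
    Continuous (grSq f) :=
  continuous_finsetSum _ fun _ _ => (continuous_fderiv_apply hf _).pow 2

section Moment

variable {n r : ℕ} {μ : Measure (Fin n → ℝ)} [IsProbabilityMeasure μ]
  {ν : ∀ _ : Fin n, (Fin n → ℝ) → Measure ℝ} {σ2 : ℝ} {f : (Fin n → ℝ) → ℝ}

theorem integral_dSq_pow_le (hcube : ∀ᵐ x ∂μ, ∀ i, x i ∈ Set.Icc (-1 : ℝ) 1)
    (hk : IsCondKernel μ ν) (hf : f ∈ tetra n r) (m : ℕ) :
    ∫ x, dSq ν (fun x => f (clip x) ^ (m + 1)) x ∂μ ≤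
      8 * (m + 1 : ℝ) ^ 2 * ∫ x, f x ^ (2 * m) * grSq f x ∂μ := by
  have hfc := tetra_continuous hf
  set G : Fin n → (Fin n → ℝ) → ℝ :=
    fun i z => fderiv ℝ f z (Pi.single i 1) ^ 2 * f z ^ (2 * m) with hG
  have hGc : ∀ i, Continuous (G i) := fun i =>
    ((continuous_fderiv_apply hf _).pow 2).mul (hfc.pow _)
  have hGm : ∀ i, Measurable fun z => G i (clip z) := fun i =>
    (hGc i).measurable.comp measurable_clip
  have hGb := fun i => exists_bound_clip (hGc i)
  have hpt : ∀ x, dSq ν (fun x => f (clip x) ^ (m + 1)) x ≤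
      ∑ i, 8 * (m + 1 : ℝ) ^ 2 * ∫ y, G i (clip (Function.update x i y)) ∂(ν i x) := by
    intro x
    refine Finset.sum_le_sum fun i _ => ?_
    have := hk.1 i x
    set α := f (Function.update (clip x) i 0)
    set β := f (Function.update (clip x) i 1) - f (Function.update (clip x) i 0) with hβ
    have e : ∀ y, f (clip (Function.update x i y)) = α + max (-1) (min 1 y) * β := fun y => by
      rw [clip_update, tetra_update hf]
    have e2 : ∀ y, G i (clip (Function.update x i y)) =
        β ^ 2 * (α + max (-1) (min 1 y) * β) ^ (2 * m) := fun y => by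
      simp only [hG, e]
      rw [tetra_fderiv_single hf, clip_update, Function.update_idem, Function.update_idem]
    simp_rw [e2, e]
    exact cVar_pow_le (ν i x) (fun y => max (-1) (min 1 y)) (by fun_prop)
      (fun y => abs_le.2 ⟨le_max_left _ _, max_le (by norm_num) (min_le_left _ _)⟩) α β m
  refine (integral_mono_of_nonneg (ae_of_all _ fun _ => dSq_nonneg _ _)
    (integrable_finsetSum _ fun i _ => (hk.integrable i _ (hGm i) (hGb i)).const_mul _)
    (ae_of_all _ hpt)).trans (le_of_eq ?_)
  rw [integral_finsetSum _ fun i _ => (hk.integrable i _ (hGm i) (hGb i)).const_mul _]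
  simp_rw [integral_const_mul]
  rw [← Finset.mul_sum]
  congr 1
  simp_rw [hk.2.2 _ _ (hGm _) (hGb _), integral_clip hcube (G _)]
  rw [← integral_finsetSum _ fun i _ => integrable_of_cube hcube (hGc i)]
  refine integral_congr_ae (ae_of_all _ fun x => ?_)
  simp only [hG, grSq, Finset.mul_sum]
  exact Finset.sum_congr rfl fun i _ => mul_comm _ _

theorem moment_le_of_grSq_le (hcube : ∀ᵐ x ∂μ, ∀ i, x i ∈ Set.Icc (-1 : ℝ) 1)
    (h : DLSI μ ν σ2) (hσ : 0 < σ2) (hf : f ∈ tetra n r) (hf0 : ∫ x, f x ∂μ = 0) {B : ℝ}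
    (hB : 0 < B) (j : ℕ) (hj : ∀ i ≤ j, ∫ x, grSq f x ^ 2 ^ i ∂μ ≤ B ^ 2 ^ i) :
    ∫ x, f x ^ 2 ^ (j + 1) ∂μ ≤ (2 ^ (j + 1) * (16 * σ2 * B)) ^ 2 ^ j := by
  have hfc := tetra_continuous hf
  have hgc := continuous_grSq hf
  have hpm : ∀ k : ℕ, Measurable fun x => f (clip x) ^ k := fun k =>
    (hfc.pow k).measurable.comp measurable_clip
  have hpb : ∀ k : ℕ, ∃ M, ∀ x, |f (clip x) ^ k| ≤ M := fun k => exists_bound_clip (hfc.pow k)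
  set K := 16 * σ2 * B with hK
  have hK0 : 0 < K := by positivity
  induction j with
  | zero =>
    have h1 := h.variance_le (fun x => f (clip x)) (hfc.measurable.comp measurable_clip)
      (exists_bound_clip hfc)
    rw [integral_clip hcube f, hf0] at h1
    have h2 := integral_dSq_pow_le hcube h.1 hf 0
    have h3 := hj 0 le_rfl
    simp only [sub_zero, zero_add, pow_one, mul_zero, pow_zero, one_mul, Nat.cast_zero, one_pow,
      mul_one] at h1 h2 h3 ⊢
    rw [integral_clip hcube fun x => f x ^ 2] at h1
    calc ∫ x, f x ^ 2 ∂μ ≤ 2 * σ2 * (8 * ∫ x, grSq f x ∂μ) := h1.trans (by gcongr)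
      _ ≤ 2 * σ2 * (8 * B) := by gcongr
      _ ≤ 2 * K := by rw [hK]; nlinarith [mul_pos hσ hB]
  | succ j ih =>
    have ihj := ih fun i hi => hj i (hi.trans (Nat.le_succ j))
    obtain ⟨m, hm⟩ : ∃ m, 2 ^ (j + 1) = m + 1 := ⟨2 ^ (j + 1) - 1, by
      have : 0 < 2 ^ (j + 1) := by positivity
      omega⟩
    have hmR : (2 : ℝ) ^ (j + 1) = m + 1 := by exact_mod_cast hm
    have hev : Even (m + 1) := by rw [← hm, pow_succ]; simp
    have hgq := hj (j + 1) le_rfl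
    rw [show (2 : ℕ) ^ (j + 1 + 1) = 2 * (m + 1) by rw [pow_succ, hm, mul_comm],
      show (2 : ℝ) ^ (j + 1 + 1) = 2 * (m + 1) by rw [pow_succ, hmR, mul_comm], hm]
    rw [hm] at hgq
    rw [hm, hmR] at ihj
    set a := ∫ x, f x ^ (2 * (m + 1)) ∂μ with ha
    have ha0 : 0 ≤ a := integral_nonneg fun x => (even_two_mul _).pow_nonneg _
    rcases ha0.eq_or_lt with ha1 | ha1
    · rw [← ha1]; positivity
    have hb0 : 0 ≤ ∫ x, f x ^ (m + 1) ∂μ := integral_nonneg fun x => hev.pow_nonneg _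
    set b := ∫ x, f x ^ (m + 1) ∂μ with hb
    have hb2 : b ^ 2 ≤ ((m + 1) * K) ^ (m + 1) := by
      calc b ^ 2 ≤ (((m + 1) * K) ^ 2 ^ j) ^ 2 := by gcongr
        _ = _ := by rw [← pow_mul, ← pow_succ, hm]
    have hu2 : ∀ x, (f (clip x) ^ (m + 1)) ^ 2 = f (clip x) ^ (2 * (m + 1)) := fun x => by
      rw [← pow_mul, mul_comm]
    have e2 : ∫ x, (f (clip x) ^ (m + 1)) ^ 2 ∂μ = a := by
      simp_rw [hu2]; exact integral_clip hcube fun x => f x ^ (2 * (m + 1))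
    have e1 : ∫ x, f (clip x) ^ (m + 1) ∂μ = b := integral_clip hcube fun x => f x ^ (m + 1)
    have hbpos : 0 < b := by
      rw [← e1]
      exact integral_pos_of_sq_pos (hpm _) (fun x => hev.pow_nonneg _) (hpb _) (by rw [e2]; exact ha1)
    have hent := (le_ent_sq μ (fun x => f (clip x) ^ (m + 1)) (hpm _) (fun x => hev.pow_nonneg _)
      (hpb _) (by rw [e2]; exact ha1)).trans (h.2 _ (hpm _) (hpb _))
    rw [e1, e2] at hent
    have hd := integral_dSq_pow_le hcube h.1 hf m
    set φ := a ^ (((m + 1 : ℕ) : ℝ)⁻¹) with hφ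
    have hφ0 : 0 < φ := Real.rpow_pos_of_pos ha1 _
    have hφa : φ ^ (m + 1) = a := Real.rpow_inv_natCast_pow ha0 (by simp)
    have hyoung : ∫ x, f x ^ (2 * m) * grSq f x ∂μ ≤ φ ^ m * B := by
      have hpt : ∀ x, f x ^ (2 * m) * grSq f x ≤ φ ^ m * B * (((m : ℝ) / φ ^ (m + 1)) *
          f x ^ (2 * (m + 1)) + (1 / B ^ (m + 1)) * grSq f x ^ (m + 1)) / (m + 1) := by
        intro x
        have hy := young_pow m (s := f x ^ 2 / φ) (t := grSq f x / B) (by positivity)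
          (div_nonneg (grSq_nonneg _ _) hB.le)
        rw [le_div_iff₀ (by positivity)]
        have hy2 := mul_le_mul_of_nonneg_left hy (show 0 ≤ φ ^ m * B by positivity)
        refine le_trans (le_of_eq ?_) (hy2.trans (le_of_eq ?_))
        · rw [pow_mul, div_pow]; field_simp
        · rw [pow_mul, div_pow, div_pow]; ring
      have i1 : Integrable (fun x => f x ^ (2 * (m + 1))) μ :=
        integrable_of_cube hcube (hfc.pow _)
      have i2 : Integrable (fun x => grSq f x ^ (m + 1)) μ :=
        integrable_of_cube hcube (hgc.pow _)
      refine (integral_mono (integrable_of_cube hcube ((hfc.pow _).mul hgc))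
        ((((i1.const_mul _).add (i2.const_mul _)).const_mul _).div_const _) hpt).trans ?_
      rw [integral_div, integral_const_mul]
      simp only [Pi.add_apply]
      rw [integral_add (i1.const_mul _) (i2.const_mul _), integral_const_mul, integral_const_mul,
        ← ha, hφa, div_mul_cancel₀ _ ha1.ne', div_le_iff₀ (by positivity)]
      have : 1 / B ^ (m + 1) * ∫ x, grSq f x ^ (m + 1) ∂μ ≤ 1 := by
        rw [one_div, inv_mul_le_iff₀ (by positivity), mul_one]; exact hgq
      gcongr
    have hlog : a * ((m + 1) * (1 - (m + 1) * K / φ)) ≤ a * Real.log (a / b ^ 2) := by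
      refine mul_le_mul_of_nonneg_left ?_ ha0
      have h1 := Real.one_sub_inv_le_log_of_pos (x := φ / ((m + 1) * K)) (by positivity)
      rw [inv_div] at h1
      calc (m + 1) * (1 - (m + 1) * K / φ) ≤ (m + 1) * Real.log (φ / ((m + 1) * K)) := by gcongr
        _ = Real.log ((φ / ((m + 1) * K)) ^ (m + 1)) := by rw [Real.log_pow]; push_cast; ring
        _ ≤ Real.log (a / b ^ 2) := by
          refine Real.log_le_log (by positivity) ?_
          rw [div_pow, hφa]
          gcongr
    have hfin : a * ((m + 1) * (1 - (m + 1) * K / φ)) ≤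
        2 * σ2 * (8 * (m + 1 : ℝ) ^ 2 * (φ ^ m * B)) := by
      refine hlog.trans (hent.trans ?_)
      gcongr
      exact hd.trans (by gcongr)
    rw [← hφa]
    refine pow_le_pow_left₀ hφ0.le ?_ _
    have e3 : a * ((m + 1) * (1 - (m + 1) * K / φ)) = (φ ^ m * (m + 1)) * (φ - (m + 1) * K) := by
      rw [← hφa]; field_simp; ring
    have e4 : 2 * σ2 * (8 * (m + 1 : ℝ) ^ 2 * (φ ^ m * B)) = (φ ^ m * (m + 1)) * ((m + 1) * K) := by
      rw [hK]; ring
    rw [e3, e4] at hfin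
    have := le_of_mul_le_mul_left hfin (by positivity)
    linarith

theorem centered_moment_le (hcube : ∀ᵐ x ∂μ, ∀ i, x i ∈ Set.Icc (-1 : ℝ) 1)
    (h : DLSI μ ν σ2) (hσ : 0 < σ2) (hf : f ∈ tetra n r) (hf0 : ∫ x, f x ∂μ = 0) (j : ℕ) :
    ∫ x, f x ^ 2 ^ (j + 1) ∂μ ≤ (2 ^ (j + 1) * (32 * σ2)) ^ 2 ^ j * ∫ x, grSq f x ^ 2 ^ j ∂μ := by
  have hgc := continuous_grSq hf
  set c := (2 ^ (j + 1) * (32 * σ2)) ^ 2 ^ j with hc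
  have hc0 : 0 < c := by positivity
  set I := ∫ x, grSq f x ^ 2 ^ j ∂μ with hI
  have hI0 : 0 ≤ I := integral_nonneg fun x => pow_nonneg (grSq_nonneg _ _) _
  refine le_of_forall_pos_le_add fun δ hδ => ?_
  have hpos : 0 < I + δ / c := by positivity
  set T := (I + δ / c) ^ (((2 ^ j : ℕ) : ℝ)⁻¹) with hT
  have hT0 : 0 < T := Real.rpow_pos_of_pos hpos _
  have hTp : T ^ 2 ^ j = I + δ / c := Real.rpow_inv_natCast_pow hpos.le (by positivity)
  have key := moment_le_of_grSq_le hcube h hσ hf hf0 (B := 2 * T) (by positivity) j ?_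
  · refine key.trans (le_of_eq ?_)
    rw [show 2 ^ (j + 1) * (16 * σ2 * (2 * T)) = 2 ^ (j + 1) * (32 * σ2) * T by ring, mul_pow, hTp,
      ← hc]
    field_simp
  · intro i hi
    have hle : (2 : ℕ) ^ i ≤ 2 ^ j := Nat.pow_le_pow_right (by norm_num) hi
    have hpt : ∀ x, grSq f x ^ 2 ^ i ≤ T ^ 2 ^ i * (1 / T ^ 2 ^ j * grSq f x ^ 2 ^ j + 1) := by
      intro x
      have hg0 := grSq_nonneg f x
      have e : grSq f x ^ 2 ^ i = T ^ 2 ^ i * (grSq f x / T) ^ 2 ^ i := by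
        rw [div_pow]; field_simp
      rw [e, one_div_mul_eq_div, ← div_pow]
      refine mul_le_mul_of_nonneg_left ?_ (by positivity)
      have hs : 0 ≤ grSq f x / T := by positivity
      rcases le_total (grSq f x / T) 1 with h1 | h1
      · exact (pow_le_one₀ hs h1).trans (by linarith [pow_nonneg hs (2 ^ j)])
      · exact (pow_le_pow_right₀ h1 hle).trans (by linarith)
    have i2 : Integrable (fun x => grSq f x ^ 2 ^ j) μ := integrable_of_cube hcube (hgc.pow _)
    refine (integral_mono (integrable_of_cube hcube (hgc.pow _))
      (((i2.const_mul _).add (integrable_const _)).const_mul _) hpt).trans ?_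
    rw [integral_const_mul]
    simp only [Pi.add_apply]
    rw [integral_add_const_of_integrable (i2.const_mul _), integral_const_mul, ← hI, hTp,
      mul_pow, mul_comm (2 ^ 2 ^ i)]
    gcongr
    have h1 : 1 / (I + δ / c) * I ≤ 1 := by
      rw [one_div, inv_mul_le_iff₀ hpos, mul_one]
      have : 0 ≤ δ / c := by positivity
      linarith
    have h2 : (2 : ℝ) ≤ 2 ^ 2 ^ i := le_self_pow₀ (by norm_num) (by positivity)
    linarith

theorem moment_le (hcube : ∀ᵐ x ∂μ, ∀ i, x i ∈ Set.Icc (-1 : ℝ) 1)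
    (h : DLSI μ ν σ2) (hσ : 0 < σ2) (hf : f ∈ tetra n (r + 1)) (j : ℕ) :
    ∫ x, (f x - ∫ y, f y ∂μ) ^ 2 ^ (j + 1) ∂μ ≤
      (2 ^ (j + 1) * (32 * σ2)) ^ 2 ^ j * ∫ x, grSq f x ^ 2 ^ j ∂μ := by
  set b := ∫ y, f y ∂μ with hb
  have hmem : (fun x => f x - b) ∈ tetra n (r + 1) := by
    have : (fun x => f x - b) = f - b • fun x : Fin n → ℝ => ∏ i ∈ (∅ : Finset (Fin n)), x i := by
      funext x; simp
    rw [this]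
    exact Submodule.sub_mem _ hf (Submodule.smul_mem _ _ (prod_mem_tetra _ (by simp)))
  have h0 : ∫ x, (f x - b) ∂μ = 0 := by
    rw [integral_sub (integrable_of_cube hcube (tetra_continuous hf)) (integrable_const _)]
    simp [hb]
  have := centered_moment_le hcube h hσ hmem h0 j
  have e : grSq (fun x => f x - b) = grSq f := by
    funext x
    simp [grSq, fderiv_sub_const]
  rwa [e] at this

end Moment

open ProbabilityTheory in
/-- The standard Gaussian measure on `ι → ℝ`. -/
abbrev gam (ι : Type*) [Fintype ι] : Measure (ι → ℝ) := Measure.pi fun _ => gaussianReal 0 1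

open scoped Nat in
open ProbabilityTheory in
theorem integral_pow_gaussianReal (m : ℕ) :
    ∫ x, x ^ (2 * m) ∂(gaussianReal 0 1) = ((2 * m - 1 : ℕ)‼ : ℝ) := by
  rw [integral_gaussianReal_eq_integral_smul one_ne_zero]
  have h1 : ∀ x : ℝ, gaussianPDFReal 0 1 x • x ^ (2 * m) =
      (√(2 * π))⁻¹ * (|x| ^ ((2 * m : ℕ) : ℝ) * Real.exp (-(1 / 2) * |x| ^ (2 : ℝ))) := by
    intro x
    rw [gaussianPDFReal_def, Real.rpow_natCast, Real.rpow_two, sq_abs, pow_mul, pow_mul, sq_abs]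
    simp only [NNReal.coe_one, mul_one, sub_zero, smul_eq_mul]
    rw [show -x ^ 2 / 2 = -(1 / 2) * x ^ 2 by ring]
    ring
  simp_rw [h1]
  rw [integral_const_mul, integral_comp_abs (f := fun x : ℝ =>
    x ^ ((2 * m : ℕ) : ℝ) * Real.exp (-(1 / 2) * x ^ (2 : ℝ))),
    integral_rpow_mul_exp_neg_mul_rpow two_pos (by
      have : (0 : ℝ) ≤ ((2 * m : ℕ) : ℝ) := Nat.cast_nonneg _
      linarith) (by norm_num)]
  have h2 : (((2 * m : ℕ) : ℝ) + 1) / 2 = m + 1 / 2 := by push_cast; ring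
  have h3 : -(((2 * m : ℕ) : ℝ) + 1) / 2 = -((m : ℝ) + 1 / 2) := by push_cast; ring
  rw [h2, h3, Real.Gamma_nat_add_half, Real.rpow_neg (by norm_num), ← Real.inv_rpow (by norm_num),
    Real.rpow_add (by norm_num), Real.rpow_natCast, ← Real.sqrt_eq_rpow]
  norm_num
  have : √π ≠ 0 := by positivity
  have : √(2 : ℝ) ≠ 0 := by positivity
  field_simp

theorem measurable_inner {ι : Type*} [Fintype ι] (v : ι → ℝ) :
    Measurable fun g : ι → ℝ => ∑ i, v i * g i :=
  Finset.measurable_sum _ fun i _ => Measurable.const_mul (f := fun g : ι → ℝ => g i) (measurable_pi_apply i) (v i)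

open ProbabilityTheory in
theorem map_gam {ι : Type*} [Fintype ι] (v : ι → ℝ) :
    (gam ι).map (fun g => ∑ i, v i * g i) =
      (gaussianReal 0 1).map (fun x => √(∑ i, v i ^ 2) * x) := by
  apply Measure.ext_of_charFun
  ext t
  rw [charFun_apply_real, charFun_apply_real,
    integral_map (measurable_inner v).aemeasurable (by fun_prop), integral_map (by fun_prop) (by fun_prop)]
  have h1 : ∀ g : ι → ℝ, Complex.exp (t * ((∑ i, v i * g i : ℝ) : ℂ) * Complex.I) =
      ∏ i, Complex.exp ((t * v i : ℝ) * (g i : ℂ) * Complex.I) := by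
    intro g
    rw [← Complex.exp_sum]
    congr 1
    push_cast
    rw [Finset.mul_sum, Finset.sum_mul]
    exact Finset.sum_congr rfl fun i _ => by ring
  have h2 : ∀ x : ℝ, Complex.exp (t * ((√(∑ i, v i ^ 2) * x : ℝ) : ℂ) * Complex.I) =
      Complex.exp ((t * √(∑ i, v i ^ 2) : ℝ) * (x : ℂ) * Complex.I) := by
    intro x
    congr 1
    push_cast
    ring
  simp_rw [h1, h2]
  rw [integral_fintype_prod_eq_prod (fun i (x : ℝ) =>
    Complex.exp ((t * v i : ℝ) * (x : ℂ) * Complex.I))]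
  simp_rw [← charFun_apply_real, charFun_gaussianReal]
  rw [← Complex.exp_sum]
  congr 1
  simp only [Complex.ofReal_zero, mul_zero, zero_mul, zero_sub, NNReal.coe_one, Complex.ofReal_one,
    one_mul]
  rw [Finset.sum_neg_distrib, ← Finset.sum_div]
  norm_cast
  rw [mul_pow, Real.sq_sqrt (Finset.sum_nonneg fun i _ => sq_nonneg _), Finset.mul_sum]
  simp_rw [mul_pow]

open scoped Nat in
theorem integral_inner_pow {ι : Type*} [Fintype ι] (v : ι → ℝ) (m : ℕ) :
    ∫ g, (∑ i, v i * g i) ^ (2 * m) ∂gam ι = (∑ i, v i ^ 2) ^ m * ((2 * m - 1 : ℕ)‼ : ℝ) := by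
  have h : ∫ x, x ^ (2 * m) ∂((gam ι).map fun g => ∑ i, v i * g i) = _ :=
    integral_map (measurable_inner v).aemeasurable (by fun_prop)
  rw [← h, map_gam, integral_map (by fun_prop) (by fun_prop)]
  simp_rw [mul_pow]
  rw [integral_const_mul, integral_pow_gaussianReal, pow_mul (√_),
    Real.sq_sqrt (Finset.sum_nonneg fun i _ => sq_nonneg _)]

open ProbabilityTheory in
theorem integrable_inner_pow {ι : Type*} [Fintype ι] (v : ι → ℝ) (m : ℕ) :
    Integrable (fun g => (∑ i, v i * g i) ^ m) (gam ι) := by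
  have h : Integrable (fun x : ℝ => x ^ m) ((gam ι).map (fun g => ∑ i, v i * g i)) := by
    rw [map_gam, integrable_map_measure (by fun_prop) (by fun_prop)]
    have h1 := (memLp_id_gaussianReal (μ := 0) (v := 1) m).integrable_norm_pow'
    have h2 : Integrable (fun x : ℝ => x ^ m) (gaussianReal 0 1) := by
      refine h1.mono (by fun_prop) (ae_of_all _ fun x => ?_)
      simp
    refine (h2.const_mul (√(∑ i, v i ^ 2) ^ m)).congr (ae_of_all _ fun x => ?_)
    simp [mul_pow]
  exact (integrable_map_measure (by fun_prop : Continuous fun x : ℝ => x ^ m).aestronglyMeasurable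
    (measurable_inner v).aemeasurable).1 h

open scoped Nat in
theorem doubleFactorial_le (m : ℕ) : (2 * m - 1)‼ ≤ (2 * m) ^ m := by
  induction m with
  | zero => simp
  | succ k ih =>
    rw [show 2 * (k + 1) - 1 = 2 * k + 1 by omega, Nat.doubleFactorial_add_one, pow_succ, mul_comm]
    exact Nat.mul_le_mul (ih.trans (Nat.pow_le_pow_left (by omega) _)) (by omega)

open scoped Nat in
theorem factorial_le_doubleFactorial (m : ℕ) : m ! ≤ (2 * m - 1)‼ := by
  induction m with
  | zero => simp
  | succ k ih =>
    rw [show 2 * (k + 1) - 1 = 2 * k + 1 by omega, Nat.doubleFactorial_add_one, Nat.factorial_succ]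
    exact Nat.mul_le_mul (by omega) ih

theorem integral_inner_pow_le {ι : Type*} [Fintype ι] (v : ι → ℝ) (m : ℕ) :
    ∫ g, (∑ i, v i * g i) ^ (2 * m) ∂gam ι ≤ (2 * m : ℝ) ^ m * (∑ i, v i ^ 2) ^ m := by
  rw [integral_inner_pow, mul_comm]
  gcongr
  exact_mod_cast doubleFactorial_le m

theorem le_integral_inner_pow {ι : Type*} [Fintype ι] (v : ι → ℝ) (m : ℕ) :
    (2 * m : ℝ) ^ m * (∑ i, v i ^ 2) ^ m ≤
      (2 * Real.exp 1) ^ m * ∫ g, (∑ i, v i * g i) ^ (2 * m) ∂gam ι := by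
  rw [integral_inner_pow]
  have h0 : 0 ≤ (∑ i, v i ^ 2) ^ m := pow_nonneg (Finset.sum_nonneg fun i _ => sq_nonneg _) _
  have h1 : (m : ℝ) ^ m ≤ Real.exp 1 ^ m * (Nat.factorial m : ℝ) := by
    have := Real.pow_div_factorial_le_exp (m : ℝ) (Nat.cast_nonneg _) m
    rw [div_le_iff₀ (by positivity)] at this
    rwa [← Real.exp_nat_mul, mul_one]
  have h2 : (Nat.factorial m : ℝ) ≤ (Nat.doubleFactorial (2 * m - 1) : ℝ) := by
    exact_mod_cast factorial_le_doubleFactorial m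
  calc (2 * m : ℝ) ^ m * (∑ i, v i ^ 2) ^ m
      = 2 ^ m * (∑ i, v i ^ 2) ^ m * (m : ℝ) ^ m := by rw [mul_pow]; ring
    _ ≤ 2 ^ m * (∑ i, v i ^ 2) ^ m *
          (Real.exp 1 ^ m * (Nat.doubleFactorial (2 * m - 1) : ℝ)) := by
        gcongr
        exact h1.trans (by gcongr)
    _ = _ := by rw [mul_pow]; ring

theorem lintegral_mul_sq_le {α : Type*} [MeasurableSpace α] {μ : Measure α} {f g : α → ENNReal}
    (hf : AEMeasurable f μ) (hg : AEMeasurable g μ) :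
    (∫⁻ a, f a * g a ∂μ) ^ 2 ≤ (∫⁻ a, f a ^ 2 ∂μ) * ∫⁻ a, g a ^ 2 ∂μ := by
  have h := ENNReal.lintegral_mul_norm_pow_le (μ := μ) (hf.pow_const 2) (hg.pow_const 2)
    (p := 1 / 2) (q := 1 / 2) (by norm_num) (by norm_num) (by norm_num)
  have e : ∀ y : ENNReal, (y ^ 2) ^ (1 / 2 : ℝ) = y := fun y => by
    rw [← ENNReal.rpow_natCast, ← ENNReal.rpow_mul]; norm_num
  have e' : ∀ y : ENNReal, (y ^ (1 / 2 : ℝ)) ^ 2 = y := fun y => by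
    rw [← ENNReal.rpow_natCast, ← ENNReal.rpow_mul]; norm_num
  simp only [e] at h
  calc _ ≤ _ := pow_le_pow_left' h 2
    _ = _ := by rw [mul_pow, e', e']

theorem lintegral_pow_le {α : Type*} [MeasurableSpace α] {μ : Measure α} [IsProbabilityMeasure μ]
    {f : α → ENNReal} (hf : AEMeasurable f μ) (m : ℕ) :
    (∫⁻ a, f a ∂μ) ^ m ≤ ∫⁻ a, f a ^ m ∂μ := by
  rcases Nat.eq_zero_or_pos m with rfl | hm
  · simp
  have hm' : (1 : ℝ) ≤ m := by exact_mod_cast hm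
  have h := ENNReal.lintegral_mul_norm_pow_le (μ := μ) (hf.pow_const m)
    (aemeasurable_const (b := (1 : ENNReal)))
    (p := 1 / m) (q := 1 - 1 / m) (by positivity)
    (by rw [sub_nonneg, div_le_one (by linarith)]; exact hm') (by ring)
  have e : ∀ y : ENNReal, (y ^ m) ^ (1 / m : ℝ) = y := fun y => by
    rw [← ENNReal.rpow_natCast, ← ENNReal.rpow_mul, mul_one_div_cancel (by linarith)]; simp
  have e' : ∀ y : ENNReal, (y ^ (1 / m : ℝ)) ^ m = y := fun y => by
    rw [← ENNReal.rpow_natCast, ← ENNReal.rpow_mul, one_div_mul_cancel (by linarith)]; simp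
  simp only [e, ENNReal.one_rpow, mul_one, lintegral_const, measure_univ] at h
  calc _ ≤ _ := pow_le_pow_left' h m
    _ = _ := e' _

open ProbabilityTheory in
theorem lintegral_pi_prod {ι : Type*} [Fintype ι] {X : ι → Type*} [∀ i, MeasurableSpace (X i)]
    (μ : ∀ i, Measure (X i)) [∀ i, IsProbabilityMeasure (μ i)] {f : ∀ i, X i → ENNReal}
    (hf : ∀ i, Measurable (f i)) :
    ∫⁻ x, ∏ i, f i (x i) ∂Measure.pi μ = ∏ i, ∫⁻ x, f i x ∂μ i := by
  rw [lintegral_prod_eq_prod_lintegral_of_indepFun _ (fun i (x : ∀ i, X i) => f i (x i))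
    (iIndepFun_pi fun i => (hf i).aemeasurable) fun i => (hf i).comp (measurable_pi_apply i)]
  exact Finset.prod_congr rfl fun i _ => by
    rw [(measurePreserving_eval μ i).lintegral_comp (hf i)]

/-- Translating `μ` by `a` gives a measure whose density has second moment `c`. -/
def HasShift {X : Type*} [MeasurableSpace X] [Add X] (μ : Measure X) (a : X) (c : ENNReal) : Prop :=
  ∃ f : X → ENNReal, Measurable f ∧ μ.map (· + a) = μ.withDensity f ∧ ∫⁻ x, f x ^ 2 ∂μ = c

theorem HasShift.pi {ι : Type*} [Fintype ι] {X : ι → Type*} [∀ i, MeasurableSpace (X i)]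
    [∀ i, Add (X i)] [∀ i, MeasurableAdd₂ (X i)]
    {μ : ∀ i, Measure (X i)} [∀ i, IsProbabilityMeasure (μ i)] {a : ∀ i, X i} {c : ι → ENNReal}
    (h : ∀ i, HasShift (μ i) (a i) (c i)) : HasShift (Measure.pi μ) a (∏ i, c i) := by
  classical
  choose f hf hs hc using h
  have hpr : ∀ i, IsProbabilityMeasure ((μ i).map (· + a i)) := fun i =>
    Measure.isProbabilityMeasure_map (by fun_prop)
  refine ⟨fun x => ∏ i, f i (x i), Finset.measurable_fun_prod _ fun i _ =>
    (hf i).comp (measurable_pi_apply i), ?_, ?_⟩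
  · have e1 : (Measure.pi μ).map (· + a) = Measure.pi fun i => (μ i).map (· + a i) :=
      Measure.pi_map_pi (f := fun i x => x + a i) fun i => by fun_prop
    rw [e1]
    refine Measure.pi_eq fun s hsm => ?_
    rw [withDensity_apply _ (MeasurableSet.univ_pi hsm),
      ← lintegral_indicator (MeasurableSet.univ_pi hsm)]
    have e2 : ∀ x : ∀ i, X i, (Set.univ.pi s).indicator (fun x => ∏ i, f i (x i)) x =
        ∏ i, (s i).indicator (f i) (x i) := by
      intro x
      by_cases hx : x ∈ Set.univ.pi s
      · rw [Set.indicator_of_mem hx]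
        exact Finset.prod_congr rfl fun i _ =>
          (Set.indicator_of_mem (hx i (Set.mem_univ i)) _).symm
      · rw [Set.indicator_of_notMem hx]
        simp only [Set.mem_pi, Set.mem_univ, true_implies, not_forall] at hx
        obtain ⟨i, hi⟩ := hx
        exact (Finset.prod_eq_zero (Finset.mem_univ i) (Set.indicator_of_notMem hi _)).symm
    simp_rw [e2]
    rw [lintegral_pi_prod μ fun i => (hf i).indicator (hsm i)]
    refine Finset.prod_congr rfl fun i _ => ?_
    rw [lintegral_indicator (hsm i), hs i, withDensity_apply _ (hsm i)]
  · simp_rw [← Finset.prod_pow]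
    rw [lintegral_pi_prod μ fun i => (hf i).pow_const 2]
    exact Finset.prod_congr rfl fun i _ => hc i

theorem HasShift.lintegral_sq_le {X : Type*} [MeasurableSpace X] [Add X] [MeasurableAdd₂ X]
    {μ : Measure X} {a : X} {c : ENNReal} (h : HasShift μ a c) {F : X → ENNReal}
    (hF : Measurable F) : (∫⁻ x, F (x + a) ∂μ) ^ 2 ≤ c * ∫⁻ x, F x ^ 2 ∂μ := by
  obtain ⟨f, hf, hs, hc⟩ := h
  rw [← lintegral_map hF (by fun_prop), hs, lintegral_withDensity_eq_lintegral_mul _ hf hF, ← hc]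
  exact lintegral_mul_sq_le hf.aemeasurable hF.aemeasurable

open ProbabilityTheory in
theorem hasShift_gaussianReal (a : ℝ) :
    HasShift (gaussianReal 0 1) a (ENNReal.ofReal (Real.exp (a ^ 2))) := by
  have hm : Measurable fun x : ℝ => ENNReal.ofReal (Real.exp (a * x - a ^ 2 / 2)) := by fun_prop
  refine ⟨fun x => ENNReal.ofReal (Real.exp (a * x - a ^ 2 / 2)), hm, ?_, ?_⟩
  · rw [gaussianReal_map_add_const, gaussianReal_of_var_ne_zero _ one_ne_zero,
      gaussianReal_of_var_ne_zero _ one_ne_zero,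
      ← withDensity_mul _ (measurable_gaussianPDF _ _) hm]
    congr 1
    funext x
    simp only [Pi.mul_apply, gaussianPDF, gaussianPDFReal]
    rw [← ENNReal.ofReal_mul (by positivity), mul_assoc (√_)⁻¹, ← Real.exp_add]
    congr 3
    simp
    ring
  · have e : ∀ x : ℝ, ENNReal.ofReal (Real.exp (a * x - a ^ 2 / 2)) ^ 2 =
        ENNReal.ofReal (Real.exp (-a ^ 2) * Real.exp (2 * a * x)) := by
      intro x
      rw [← ENNReal.ofReal_pow (by positivity), ← Real.exp_nat_mul, ← Real.exp_add]
      congr 2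
      push_cast
      ring
    simp_rw [e]
    rw [← ofReal_integral_eq_lintegral_ofReal
      ((integrable_exp_mul_gaussianReal _).const_mul _) (ae_of_all _ fun x => by positivity),
      integral_const_mul]
    have := congrFun (mgf_fun_id_gaussianReal (μ := 0) (v := 1)) (2 * a)
    rw [mgf] at this
    rw [this, ← Real.exp_add]
    congr 2
    simp
    ring

/-- The space of families of block vectors. -/
abbrev Blk (k n : ℕ) : Type := ∀ I : Finset (Fin k), (↥I → Fin n) → ℝ

/-- The standard Gaussian measure on block vectors. -/
abbrev gB (k n : ℕ) : Measure (Blk k n) := Measure.pi fun I => gam (↥I → Fin n)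

theorem hasShift_gB {k n : ℕ} (a : Blk k n) :
    HasShift (gB k n) a (ENNReal.ofReal (Real.exp (∑ I, ∑ u, a I u ^ 2))) := by
  have h : HasShift (gB k n) a (∏ I, ∏ u, ENNReal.ofReal (Real.exp (a I u ^ 2))) :=
    HasShift.pi fun I => HasShift.pi fun u => hasShift_gaussianReal (a I u)
  convert h using 1
  rw [Real.exp_sum, ENNReal.ofReal_prod_of_nonneg fun _ _ => by positivity]
  refine Finset.prod_congr rfl fun I _ => ?_
  rw [Real.exp_sum, ENNReal.ofReal_prod_of_nonneg fun _ _ => by positivity]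

open ProbabilityTheory in
theorem memLp_eval_gam {ι : Type*} [Fintype ι] (u : ι) : MemLp (fun z => z u) 2 (gam ι) :=
  (memLp_id_gaussianReal' (μ := 0) (v := 1) 2 (by simp)).comp_measurePreserving
    (measurePreserving_eval (fun _ : ι => gaussianReal 0 1) u)

open ProbabilityTheory in
theorem integral_eval_gam {ι : Type*} [Fintype ι] (u : ι) : ∫ z, z u ∂gam ι = 0 := by
  have h := integral_comp_eval (μ := fun _ : ι => gaussianReal 0 1) (i := u) (f := fun x : ℝ => x)
    (by fun_prop)
  rw [h, integral_id_gaussianReal]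

open ProbabilityTheory in
theorem integral_eval_mul_gam {ι : Type*} [Fintype ι] [DecidableEq ι] (u v : ι) :
    ∫ z, z u * z v ∂gam ι = if u = v then 1 else 0 := by
  split_ifs with h
  · subst h
    have h := integral_comp_eval (μ := fun _ : ι => gaussianReal 0 1) (i := u)
      (f := fun x : ℝ => x ^ 2) (by fun_prop)
    simp_rw [← sq]
    rw [h]
    simpa using integral_pow_gaussianReal 1
  · have hi : iIndepFun (fun i (z : ι → ℝ) => z i) (gam ι) :=
      iIndepFun_pi (X := fun _ (x : ℝ) => x) fun i => by fun_prop
    rw [(hi.indepFun h).integral_fun_mul_eq_mul_integral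
      (memLp_eval_gam u).aestronglyMeasurable (memLp_eval_gam v).aestronglyMeasurable,
      integral_eval_gam]
    simp

theorem integrable_affine_gam {ι : Type*} [Fintype ι] (a s : ℝ) (u : ι) :
    Integrable (fun z => a + s * z u) (gam ι) :=
  (integrable_const a).add (((memLp_eval_gam u).integrable (by norm_num)).const_mul s)

theorem integral_affine_gam {ι : Type*} [Fintype ι] (a s : ℝ) (u : ι) :
    ∫ z, (a + s * z u) ∂gam ι = a := by
  rw [integral_add (integrable_const a)
    (((memLp_eval_gam u).integrable (by norm_num)).const_mul s), integral_const_mul,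
    integral_eval_gam]
  simp

theorem integrable_affine_mul_gam {ι : Type*} [Fintype ι] (a b s : ℝ) (u v : ι) :
    Integrable (fun z => (a + s * z u) * (b + s * z v)) (gam ι) :=
  MemLp.integrable_mul (p := 2) (q := 2)
    ((memLp_const a).add ((memLp_eval_gam u).const_mul s))
    ((memLp_const b).add ((memLp_eval_gam v).const_mul s))

theorem integral_affine_mul_gam {ι : Type*} [Fintype ι] [DecidableEq ι] (a b s : ℝ) (u v : ι) :
    ∫ z, (a + s * z u) * (b + s * z v) ∂gam ι = a * b + if u = v then s ^ 2 else 0 := by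
  have e : ∀ z : ι → ℝ, (a + s * z u) * (b + s * z v) =
      a * (b + s * z v) + (s * b * z u + s ^ 2 * (z u * z v)) := fun z => by ring
  have i1 : Integrable (fun z : ι → ℝ => s * b * z u) (gam ι) :=
    ((memLp_eval_gam u).integrable (by norm_num)).const_mul _
  have i2 : Integrable (fun z : ι → ℝ => s ^ 2 * (z u * z v)) (gam ι) :=
    (MemLp.integrable_mul (p := 2) (q := 2) (memLp_eval_gam u) (memLp_eval_gam v)).const_mul _
  have i3 : Integrable (fun z : ι → ℝ => s * b * z u + s ^ 2 * (z u * z v)) (gam ι) := i1.add i2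
  simp_rw [e]
  rw [integral_add ((integrable_affine_gam b s v).const_mul a) i3,
    integral_add i1 i2, integral_const_mul, integral_const_mul, integral_const_mul,
    integral_affine_gam, integral_eval_gam, integral_eval_mul_gam]
  split_ifs <;> ring

section Block

variable {k n : ℕ} (P : Finset (Finset (Fin k))) (x : Blk k n) (s : ℝ)
  (idx idx' : Fin k → Fin n)

theorem integrable_prod_gB {f : ∀ I : Finset (Fin k), ((↥I → Fin n) → ℝ) → ℝ}
    (hf : ∀ I, Integrable (f I) (gam (↥I → Fin n))) :
    Integrable (fun z : Blk k n => ∏ I ∈ P, f I (z I)) (gB k n) := by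
  have h := Integrable.fintype_prod_dep (μ := fun I : Finset (Fin k) => gam (↥I → Fin n))
    (f := fun I z => if I ∈ P then f I z else 1) fun I => by
      by_cases h : I ∈ P
      · simpa [h] using hf I
      · simp [h]
  refine h.congr (ae_of_all _ fun z => ?_)
  simp [Finset.prod_ite_mem]

theorem integral_prod_gB (f : ∀ I : Finset (Fin k), ((↥I → Fin n) → ℝ) → ℝ) :
    ∫ z, ∏ I ∈ P, f I (z I) ∂gB k n = ∏ I ∈ P, ∫ z, f I z ∂gam (↥I → Fin n) := by
  have h := integral_fintype_prod_eq_prod (μ := fun I : Finset (Fin k) => gam (↥I → Fin n))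
    (fun I z => if I ∈ P then f I z else 1)
  have e : ∀ I : Finset (Fin k), ∫ z, (if I ∈ P then f I z else 1) ∂gam (↥I → Fin n) =
      if I ∈ P then ∫ z, f I z ∂gam (↥I → Fin n) else 1 := by
    intro I
    split_ifs <;> simp
  simpa [Finset.prod_ite_mem, e] using h

theorem integrable_smooth :
    Integrable (fun z : Blk k n => ∏ I ∈ P, (x I (fun t => idx t.1) + s * z I (fun t => idx t.1)))
      (gB k n) :=
  integrable_prod_gB P fun I => integrable_affine_gam (x I fun t => idx t.1) s fun t => idx t.1

theorem integral_smooth :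
    ∫ z : Blk k n, ∏ I ∈ P, (x I (fun t => idx t.1) + s * z I (fun t => idx t.1)) ∂gB k n =
      ∏ I ∈ P, x I (fun t => idx t.1) := by
  rw [integral_prod_gB P fun I z => x I (fun t => idx t.1) + s * z fun t => idx t.1]
  exact Finset.prod_congr rfl fun I _ => integral_affine_gam _ _ _

theorem integrable_smooth_mul :
    Integrable (fun z : Blk k n =>
      (∏ I ∈ P, (x I (fun t => idx t.1) + s * z I (fun t => idx t.1))) *
      ∏ I ∈ P, (x I (fun t => idx' t.1) + s * z I (fun t => idx' t.1))) (gB k n) := by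
  simp_rw [← Finset.prod_mul_distrib]
  exact integrable_prod_gB P fun I => integrable_affine_mul_gam (x I fun t => idx t.1)
    (x I fun t => idx' t.1) s (fun t => idx t.1) fun t => idx' t.1

theorem integral_smooth_mul :
    ∫ z : Blk k n, (∏ I ∈ P, (x I (fun t => idx t.1) + s * z I (fun t => idx t.1))) *
      (∏ I ∈ P, (x I (fun t => idx' t.1) + s * z I (fun t => idx' t.1))) ∂gB k n =
    ∑ S ∈ P.powerset, s ^ (2 * S.card) * if ∀ I ∈ S, ∀ t ∈ I, idx t = idx' t then
      (∏ I ∈ P \ S, x I (fun t => idx t.1)) * ∏ I ∈ P \ S, x I (fun t => idx' t.1) else 0 := by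
  simp_rw [← Finset.prod_mul_distrib]
  rw [integral_prod_gB P fun I z => (x I (fun t => idx t.1) + s * z fun t => idx t.1) *
    (x I (fun t => idx' t.1) + s * z fun t => idx' t.1)]
  simp_rw [integral_affine_mul_gam, add_comm (_ * _)]
  rw [Finset.prod_add]
  refine Finset.sum_congr rfl fun S _ => ?_
  have e : ∀ I : Finset (Fin k), ((fun t : ↥I => idx t.1) = fun t => idx' t.1) ↔
      ∀ t ∈ I, idx t = idx' t := fun I => by simp [funext_iff]
  simp_rw [e]
  rw [Finset.prod_ite_zero]
  split_ifs with h
  · rw [Finset.prod_const, pow_mul]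
  · simp

end Block

section Core

variable {k n : ℕ}

/-- The multilinear form attached to a tensor and a family of blocks. -/
def blockForm (P : Finset (Finset (Fin k))) (A : (Fin k → Fin n) → ℝ) (x : Blk k n) : ℝ :=
  ∑ idx : Fin k → Fin n, A idx * ∏ I ∈ P, x I (fun t => idx t.1)

/-- The supremum of the block form over unit vectors, as an extended nonnegative number. -/
def blockNorm (P : Finset (Finset (Fin k))) (A : (Fin k → Fin n) → ℝ) : ENNReal :=
  ⨆ x : {x : Blk k n // ∀ I, ∑ u, x I u ^ 2 ≤ 1}, ‖blockForm P A x.1‖ₑ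

theorem le_blockNorm (P : Finset (Finset (Fin k))) (A : (Fin k → Fin n) → ℝ) {x : Blk k n}
    (hx : ∀ I, ∑ u, x I u ^ 2 ≤ 1) : ‖blockForm P A x‖ₑ ≤ blockNorm P A :=
  le_iSup (fun x : {x : Blk k n // ∀ I, ∑ u, x I u ^ 2 ≤ 1} => ‖blockForm P A x.1‖ₑ) ⟨x, hx⟩

/-- The partial contraction of a tensor along blocks, leaving out one index. -/
def legVec (P : Finset (Finset (Fin k))) (B : (Fin k → Fin n) → ℝ) (j : Fin k) (y : Blk k n)
    (i : Fin n) : ℝ :=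
  ∑ idx : Fin k → Fin n, if idx j = i then B idx * ∏ I ∈ P, y I (fun t => idx t.1) else 0

theorem continuous_legVec (P : Finset (Finset (Fin k))) (B : (Fin k → Fin n) → ℝ) (j : Fin k)
    (i : Fin n) : Continuous fun y => legVec P B j y i := by
  refine continuous_finsetSum _ fun idx _ => ?_
  split_ifs <;> fun_prop

theorem blockForm_leg (P : Finset (Finset (Fin k))) (B : (Fin k → Fin n) → ℝ) (j : Fin k)
    (g : Fin n → ℝ) (y : Blk k n) :
    blockForm P (fun idx => B idx * g (idx j)) y = ∑ i, legVec P B j y i * g i := by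
  simp_rw [blockForm, legVec, Finset.sum_mul]
  rw [Finset.sum_comm]
  refine Finset.sum_congr rfl fun idx _ => ?_
  simp [ite_mul]
  ring

theorem sum_sq_fiber {α β : Type*} [Fintype α] [Fintype β] [DecidableEq β] (r : α → β)
    (a : α → ℝ) : ∑ w, (∑ u, if r u = w then a u else 0) ^ 2 =
      ∑ u, ∑ u', if r u = r u' then a u * a u' else 0 := by
  simp_rw [sq, Finset.sum_mul_sum]
  rw [Finset.sum_comm]
  refine Finset.sum_congr rfl fun u _ => ?_
  rw [Finset.sum_comm]
  refine Finset.sum_congr rfl fun u' _ => ?_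
  simp only [ite_mul, zero_mul, Finset.sum_ite_eq, Finset.mem_univ, if_true, mul_ite, mul_zero]

/-- The blocks obtained by merging those in `S` and adding the index `j`. -/
def mergeBlocks (P S : Finset (Finset (Fin k))) (j : Fin k) : Finset (Finset (Fin k)) :=
  insert (insert j (S.biUnion id)) (P \ S)

theorem ofReal_sum_fiber_le {P S : Finset (Finset (Fin k))} (B : (Fin k → Fin n) → ℝ) {j : Fin k}
    (hj : ∀ I ∈ P, j ∉ I) {x : Blk k n} (hx : ∀ I, ∑ u, x I u ^ 2 ≤ 1) :
    ENNReal.ofReal (∑ idx : Fin k → Fin n, ∑ idx' : Fin k → Fin n,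
      if idx j = idx' j ∧ ∀ I ∈ S, ∀ t ∈ I, idx t = idx' t then
        (B idx * ∏ I ∈ P \ S, x I (fun t => idx t.1)) *
          (B idx' * ∏ I ∈ P \ S, x I (fun t => idx' t.1)) else 0) ≤
      blockNorm (mergeBlocks P S j) B ^ 2 := by
  set J := insert j (S.biUnion id) with hJ
  set D : (↥J → Fin n) → ℝ := fun w => ∑ idx : Fin k → Fin n,
    if (fun t : ↥J => idx t.1) = w then B idx * ∏ I ∈ P \ S, x I (fun t => idx t.1) else 0 with hD
  have hJP : J ∉ P \ S := fun h =>
    hj J (Finset.mem_sdiff.1 h).1 (Finset.mem_insert_self _ _)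
  have e : ∀ idx idx' : Fin k → Fin n, (idx j = idx' j ∧ ∀ I ∈ S, ∀ t ∈ I, idx t = idx' t) ↔
      (fun t : ↥J => idx t.1) = fun t => idx' t.1 := by
    intro idx idx'
    rw [funext_iff]
    constructor
    · rintro ⟨h1, h2⟩ ⟨t, ht⟩
      rcases Finset.mem_insert.1 ht with rfl | ht
      · exact h1
      · obtain ⟨I, hI, ht⟩ := Finset.mem_biUnion.1 ht
        exact h2 I hI t ht
    · intro h
      exact ⟨h ⟨j, Finset.mem_insert_self _ _⟩, fun I hI t ht =>
        h ⟨t, Finset.mem_insert_of_mem (Finset.mem_biUnion.2 ⟨I, hI, ht⟩)⟩⟩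
  simp_rw [e]
  rw [← sum_sq_fiber (fun (idx : Fin k → Fin n) (t : ↥J) => idx t.1)]
  set Q := ∑ w, D w ^ 2 with hQ
  change ENNReal.ofReal Q ≤ _
  have hQ0 : 0 ≤ Q := Finset.sum_nonneg fun _ _ => sq_nonneg _
  set y : Blk k n := Function.update x J fun w => D w / √Q with hy
  have hy1 : ∀ I, ∑ u, y I u ^ 2 ≤ 1 := by
    intro I
    by_cases hI : I = J
    · subst hI
      simp only [hy, Function.update_self, div_pow, Real.sq_sqrt hQ0]
      rw [← Finset.sum_div]
      exact div_self_le_one _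
    · simpa [hy, Function.update_of_ne hI] using hx I
  have hval : blockForm (mergeBlocks P S j) B y = √Q := by
    have h1 : ∀ idx : Fin k → Fin n, B idx * ∏ I ∈ mergeBlocks P S j, y I (fun t => idx t.1) =
        ∑ w, (if (fun t : ↥J => idx t.1) = w then B idx * ∏ I ∈ P \ S, x I (fun t => idx t.1)
          else 0) * (D w / √Q) := by
      intro idx
      rw [mergeBlocks, Finset.prod_insert hJP]
      have h2 : ∏ I ∈ P \ S, y I (fun t => idx t.1) = ∏ I ∈ P \ S, x I (fun t => idx t.1) := by
        refine Finset.prod_congr rfl fun I hI => ?_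
        have : I ≠ J := fun h => hJP (h ▸ hI)
        rw [hy, Function.update_of_ne this]
      rw [h2, hy, Function.update_self]
      simp only [ite_mul, zero_mul, Finset.sum_ite_eq, Finset.mem_univ, if_true]
      ring
    rw [blockForm]
    simp_rw [h1]
    rw [Finset.sum_comm]
    simp_rw [← Finset.sum_mul]
    have h3 : ∀ w, (∑ idx : Fin k → Fin n, if (fun t : ↥J => idx t.1) = w then
        B idx * ∏ I ∈ P \ S, x I (fun t => idx t.1) else 0) * (D w / √Q) = D w ^ 2 / √Q := by
      intro w
      rw [sq, mul_div_assoc]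
    simp_rw [h3]
    rw [← Finset.sum_div, Real.div_sqrt]
  have h4 := le_blockNorm (mergeBlocks P S j) B hy1
  rw [hval, Real.enorm_eq_ofReal (Real.sqrt_nonneg _)] at h4
  calc ENNReal.ofReal Q = ENNReal.ofReal (√Q) ^ 2 := by
        rw [← ENNReal.ofReal_pow (Real.sqrt_nonneg _), Real.sq_sqrt hQ0]
    _ ≤ _ := pow_le_pow_left' h4 2

/-- The noisy block vector `x + s z`. -/
def noisy (x : Blk k n) (s : ℝ) (z : Blk k n) : Blk k n := fun I u => x I u + s * z I u

theorem continuous_noisy (x : Blk k n) (s : ℝ) : Continuous (noisy x s) := by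
  unfold noisy
  fun_prop

theorem integral_sq_legVec {P : Finset (Finset (Fin k))} (B : (Fin k → Fin n) → ℝ) (j : Fin k)
    (x : Blk k n) (s : ℝ) :
    Integrable (fun z => ∑ i, legVec P B j (noisy x s z) i ^ 2) (gB k n) ∧
    ∫ z, ∑ i, legVec P B j (noisy x s z) i ^ 2 ∂gB k n =
      ∑ S ∈ P.powerset, s ^ (2 * S.card) *
        ∑ idx : Fin k → Fin n, ∑ idx' : Fin k → Fin n,
          if idx j = idx' j ∧ ∀ I ∈ S, ∀ t ∈ I, idx t = idx' t then
            (B idx * ∏ I ∈ P \ S, x I (fun t => idx t.1)) *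
              (B idx' * ∏ I ∈ P \ S, x I (fun t => idx' t.1)) else 0 := by
  have e : ∀ z, ∑ i, legVec P B j (noisy x s z) i ^ 2 =
      ∑ idx : Fin k → Fin n, ∑ idx' : Fin k → Fin n, (if idx j = idx' j then B idx * B idx' else 0) *
        ((∏ I ∈ P, (x I (fun t => idx t.1) + s * z I (fun t => idx t.1))) *
          ∏ I ∈ P, (x I (fun t => idx' t.1) + s * z I (fun t => idx' t.1))) := by
    intro z
    unfold legVec
    rw [sum_sq_fiber (fun idx : Fin k → Fin n => idx j)]
    refine Finset.sum_congr rfl fun idx _ => Finset.sum_congr rfl fun idx' _ => ?_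
    simp only [noisy]
    split_ifs <;> ring
  have hi : ∀ idx idx' : Fin k → Fin n, Integrable (fun z =>
      (if idx j = idx' j then B idx * B idx' else 0) *
        ((∏ I ∈ P, (x I (fun t => idx t.1) + s * z I (fun t => idx t.1))) *
          ∏ I ∈ P, (x I (fun t => idx' t.1) + s * z I (fun t => idx' t.1)))) (gB k n) :=
    fun idx idx' => (integrable_smooth_mul P x s idx idx').const_mul _
  simp_rw [e]
  refine ⟨integrable_finsetSum _ fun idx _ => integrable_finsetSum _ fun idx' _ => hi idx idx', ?_⟩
  rw [integral_finsetSum _ fun idx _ => integrable_finsetSum _ fun idx' _ => hi idx idx']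
  simp_rw [integral_finsetSum _ fun idx' _ => hi _ idx', integral_const_mul, integral_smooth_mul,
    Finset.mul_sum]
  symm
  rw [Finset.sum_comm]
  refine Finset.sum_congr rfl fun idx _ => ?_
  rw [Finset.sum_comm]
  refine Finset.sum_congr rfl fun idx' _ => Finset.sum_congr rfl fun S _ => ?_
  by_cases h1 : idx j = idx' j
  · by_cases h2 : ∀ I ∈ S, ∀ t ∈ I, idx t = idx' t
    · rw [if_pos ⟨h1, h2⟩, if_pos h1, if_pos h2]
      ring
    · rw [if_neg (fun h => h2 h.2), if_neg h2]
      simp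
  · rw [if_neg (fun h => h1 h.1), if_neg h1]
    simp

theorem lintegral_sq_legVec_le {P : Finset (Finset (Fin k))} (B : (Fin k → Fin n) → ℝ) {j : Fin k}
    (hj : ∀ I ∈ P, j ∉ I) {x : Blk k n} (hx : ∀ I, ∑ u, x I u ^ 2 ≤ 1) (s : ℝ) :
    ∫⁻ z, ENNReal.ofReal (∑ i, legVec P B j (noisy x s z) i ^ 2) ∂gB k n ≤
      ∑ S ∈ P.powerset, ENNReal.ofReal (s ^ 2) ^ S.card * blockNorm (mergeBlocks P S j) B ^ 2 := by
  obtain ⟨h1, h2⟩ := integral_sq_legVec (P := P) B j x s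
  rw [← ofReal_integral_eq_lintegral_ofReal h1
    (ae_of_all _ fun z => Finset.sum_nonneg fun _ _ => sq_nonneg _), h2]
  refine (Finset.le_sum_of_subadditive ENNReal.ofReal ENNReal.ofReal_zero.le
    (fun _ _ => ENNReal.ofReal_add_le) _ _).trans (Finset.sum_le_sum fun S _ => ?_)
  rw [pow_mul, ENNReal.ofReal_mul (by positivity), ENNReal.ofReal_pow (sq_nonneg s)]
  gcongr
  exact ofReal_sum_fiber_le B hj hx

/-- The normalised linear form `|⟨c, g⟩| / |c|`. -/
def unitForm (c g : Fin n → ℝ) : ENNReal :=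
  ENNReal.ofReal (|∑ i, c i * g i| / √(∑ i, c i ^ 2))

theorem enorm_inner_eq (c g : Fin n → ℝ) :
    ‖∑ i, c i * g i‖ₑ = ENNReal.ofReal (√(∑ i, c i ^ 2)) * unitForm c g := by
  rw [unitForm, ← ENNReal.ofReal_mul (Real.sqrt_nonneg _), Real.enorm_eq_ofReal_abs]
  congr 1
  by_cases h : √(∑ i, c i ^ 2) = 0
  · rw [Real.sqrt_eq_zero (Finset.sum_nonneg fun _ _ => sq_nonneg _),
      Finset.sum_eq_zero_iff_of_nonneg fun _ _ => sq_nonneg _] at h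
    have : ∀ i, c i = 0 := fun i => by simpa using h i (Finset.mem_univ i)
    simp [this]
  · field_simp

theorem measurable_unitForm_comp {α : Type*} [MeasurableSpace α] {c g : α → Fin n → ℝ}
    (hc : Measurable c)  (hg : Measurable g) :
    Measurable fun z => unitForm (c z) (g z) := by
  have h1 : ∀ i, Measurable fun z => c z i := fun i => (measurable_pi_apply i).comp hc
  have h2 : ∀ i, Measurable fun z => g z i := fun i => (measurable_pi_apply i).comp hg
  have h3 : Measurable fun z => ∑ i, c z i * g z i :=
    Finset.measurable_fun_sum _ fun i _ => (h1 i).mul (h2 i)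
  have h4 : Measurable fun z => ∑ i, c z i ^ 2 :=
    Finset.measurable_fun_sum _ fun i _ => (h1 i).pow_const 2
  unfold unitForm
  exact ENNReal.measurable_ofReal.comp (h3.abs.div h4.sqrt)

theorem lintegral_unitForm_le (c : Fin n → ℝ) {m : ℕ} (hm : m ≠ 0) :
    ∫⁻ g, unitForm c g ^ (4 * m) ∂gam (Fin n) ≤ ENNReal.ofReal (4 * m) ^ (2 * m) := by
  set Q := ∑ i, c i ^ 2 with hQ
  have hQ0 : 0 ≤ Q := Finset.sum_nonneg fun _ _ => sq_nonneg _
  have e : ∀ g : Fin n → ℝ, unitForm c g ^ (4 * m) =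
      ENNReal.ofReal ((∑ i, c i * g i) ^ (2 * (2 * m)) * (Q ^ (2 * m))⁻¹) := by
    intro g
    rw [unitForm, ← ENNReal.ofReal_pow (by positivity), div_pow, div_eq_mul_inv,
      show 4 * m = 2 * (2 * m) by ring, pow_mul |_|, sq_abs, ← pow_mul, pow_mul (√_),
      Real.sq_sqrt hQ0]
  simp_rw [e]
  rw [← ofReal_integral_eq_lintegral_ofReal ((integrable_inner_pow c _).mul_const _)
    (ae_of_all _ fun g => mul_nonneg (Even.pow_nonneg (even_two_mul _) _) (by positivity)),
    integral_mul_const, ← ENNReal.ofReal_pow (by positivity)]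
  refine ENNReal.ofReal_le_ofReal ?_
  have h := integral_inner_pow_le c (2 * m)
  rcases hQ0.eq_or_lt with h0 | h0
  · rw [← h0, zero_pow (by omega)]
    simp
  · calc _ ≤ ((2 * (2 * m : ℕ) : ℝ) ^ (2 * m) * Q ^ (2 * m)) * (Q ^ (2 * m))⁻¹ := by gcongr
      _ = _ := by
        rw [mul_assoc, mul_inv_cancel₀ (by positivity), mul_one]
        push_cast
        ring

theorem continuous_legVec_noisy (P : Finset (Finset (Fin k))) (B : (Fin k → Fin n) → ℝ) (j : Fin k)
    (x : Blk k n) (s : ℝ) : Continuous fun z => legVec P B j (noisy x s z) :=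
  (continuous_pi fun i => continuous_legVec P B j i).comp (continuous_noisy x s)

theorem measurable_unitForm_noisy (P : Finset (Finset (Fin k))) (B : (Fin k → Fin n) → ℝ)
    (j : Fin k) (g : Fin n → ℝ) (x : Blk k n) (s : ℝ) :
    Measurable fun z => unitForm (legVec P B j (noisy x s z)) g :=
  measurable_unitForm_comp (continuous_legVec_noisy P B j x s).measurable measurable_const

theorem noisy_eq_noisy_zero (x : Blk k n) {s : ℝ} (hs : s ≠ 0) (z : Blk k n) :
    noisy x s z = noisy 0 s (z + fun I u => x I u / s) := by
  funext I u
  simp only [noisy, Pi.add_apply, Pi.zero_apply]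
  field_simp
  ring

theorem enorm_blockForm_le {P : Finset (Finset (Fin k))} (B : (Fin k → Fin n) → ℝ) (j : Fin k)
    (g : Fin n → ℝ) (x : Blk k n) (s : ℝ) :
    ‖blockForm P (fun idx => B idx * g (idx j)) x‖ₑ ^ 2 ≤
      (∫⁻ z, ENNReal.ofReal (∑ i, legVec P B j (noisy x s z) i ^ 2) ∂gB k n) *
        ∫⁻ z, unitForm (legVec P B j (noisy x s z)) g ^ 2 ∂gB k n := by
  have h1 : blockForm P (fun idx => B idx * g (idx j)) x =
      ∫ z, blockForm P (fun idx => B idx * g (idx j)) (noisy x s z) ∂gB k n := by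
    unfold blockForm noisy
    rw [integral_finsetSum _ fun idx _ => (integrable_smooth P x s idx).const_mul _]
    simp_rw [integral_const_mul, integral_smooth]
  have hc := continuous_legVec_noisy P B j x s
  have h2 : ‖blockForm P (fun idx => B idx * g (idx j)) x‖ₑ ≤
      ∫⁻ z, ENNReal.ofReal (√(∑ i, legVec P B j (noisy x s z) i ^ 2)) *
        unitForm (legVec P B j (noisy x s z)) g ∂gB k n := by
    rw [h1]
    refine (enorm_integral_le_lintegral_enorm _).trans (le_of_eq ?_)
    refine lintegral_congr fun z => ?_
    rw [blockForm_leg, enorm_inner_eq]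
  refine (pow_le_pow_left' h2 2).trans ((lintegral_mul_sq_le ?_ ?_).trans (le_of_eq ?_))
  · exact (ENNReal.measurable_ofReal.comp (Continuous.measurable (by fun_prop))).aemeasurable
  · exact (measurable_unitForm_noisy P B j g x s).aemeasurable
  · congr 1
    refine lintegral_congr fun z => ?_
    rw [← ENNReal.ofReal_pow (Real.sqrt_nonneg _),
      Real.sq_sqrt (Finset.sum_nonneg fun _ _ => sq_nonneg _)]

theorem lintegral_unitForm_noisy_le {P : Finset (Finset (Fin k))} (B : (Fin k → Fin n) → ℝ)
    (j : Fin k) (g : Fin n → ℝ) {x : Blk k n} (hx : ∀ I, ∑ u, x I u ^ 2 ≤ 1) {s : ℝ} (hs : 0 < s)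
    (m : ℕ) :
    (∫⁻ z, unitForm (legVec P B j (noisy x s z)) g ^ 2 ∂gB k n) ^ (2 * m) ≤
      ENNReal.ofReal (Real.exp (2 ^ k / s ^ 2)) *
        ∫⁻ z, unitForm (legVec P B j (noisy 0 s z)) g ^ (4 * m) ∂gB k n := by
  have hm := fun x => measurable_unitForm_noisy P B j g x s
  calc _ = ((∫⁻ z, unitForm (legVec P B j (noisy x s z)) g ^ 2 ∂gB k n) ^ m) ^ 2 := by
        rw [← pow_mul, mul_comm]
    _ ≤ (∫⁻ z, (unitForm (legVec P B j (noisy x s z)) g ^ 2) ^ m ∂gB k n) ^ 2 :=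
        pow_le_pow_left' (lintegral_pow_le ((hm x).pow_const 2).aemeasurable m) 2
    _ = (∫⁻ z, (fun z => unitForm (legVec P B j (noisy 0 s z)) g ^ (2 * m))
          (z + fun I u => x I u / s) ∂gB k n) ^ 2 := by
        simp_rw [noisy_eq_noisy_zero x hs.ne', pow_mul]
    _ ≤ _ := (hasShift_gB _).lintegral_sq_le ((hm 0).pow_const (2 * m))
    _ ≤ _ := by
        simp_rw [← pow_mul]
        rw [show 2 * m * 2 = 4 * m by ring]
        gcongr
        calc ∑ I, ∑ u, (x I u / s) ^ 2 ≤ ∑ I : Finset (Fin k), 1 / s ^ 2 := by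
              refine Finset.sum_le_sum fun I _ => ?_
              simp only [div_pow]
              rw [← Finset.sum_div]
              gcongr
              exact hx I
          _ = _ := by simp [div_eq_mul_inv]

theorem lintegral_lintegral_unitForm_le {β : Type*} [MeasurableSpace β] (ρ : Measure β)
    [IsProbabilityMeasure ρ] {c : β → Fin n → ℝ} (hc : Measurable c) {m : ℕ} (hm : m ≠ 0)
    (K : ENNReal) :
    ∫⁻ g, K * ∫⁻ z, unitForm (c z) g ^ (4 * m) ∂ρ ∂gam (Fin n) ≤
      K * ENNReal.ofReal (4 * m) ^ (2 * m) := by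
  have hc' : Measurable fun q : (Fin n → ℝ) × β => c q.2 := hc.comp measurable_snd
  have hmeas : Measurable fun q : (Fin n → ℝ) × β => unitForm (c q.2) q.1 ^ (4 * m) :=
    (measurable_unitForm_comp hc' measurable_fst).pow_const _
  rw [lintegral_const_mul _ hmeas.lintegral_prod_right']
  gcongr
  rw [lintegral_lintegral_swap (f := fun g z => unitForm (c z) g ^ (4 * m)) hmeas.aemeasurable]
  calc _ ≤ ∫⁻ _ : β, ENNReal.ofReal (4 * m) ^ (2 * m) ∂ρ :=
        lintegral_mono fun z => lintegral_unitForm_le _ hm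
    _ = _ := by simp

theorem lintegral_blockNorm_le {P : Finset (Finset (Fin k))} (B : (Fin k → Fin n) → ℝ) {j : Fin k}
    (hj : ∀ I ∈ P, j ∉ I) {m : ℕ} (hm : m ≠ 0) :
    ∫⁻ g, blockNorm P (fun idx => B idx * g (idx j)) ^ (4 * m) ∂gam (Fin n) ≤
      ENNReal.ofReal (Real.exp (2 ^ k)) ^ (4 * m) * ENNReal.ofReal (4 * m) ^ (2 * m) *
      (∑ S ∈ P.powerset, ENNReal.ofReal (1 / (4 * m)) ^ S.card *
        blockNorm (mergeBlocks P S j) B ^ 2) ^ (2 * m) := by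
  have hm0 : (0 : ℝ) < 4 * m := by positivity
  set s : ℝ := √(1 / (4 * m)) with hs
  have hs0 : 0 < s := by positivity
  have hs2 : s ^ 2 = 1 / (4 * m) := Real.sq_sqrt (by positivity)
  set M := ∑ S ∈ P.powerset, ENNReal.ofReal (1 / (4 * m)) ^ S.card *
        blockNorm (mergeBlocks P S j) B ^ 2 with hM
  have hc := continuous_legVec_noisy P B j 0 s
  have key : ∀ g : Fin n → ℝ, blockNorm P (fun idx => B idx * g (idx j)) ^ (4 * m) ≤
      (M ^ (2 * m) * ENNReal.ofReal (Real.exp (2 ^ k)) ^ (4 * m)) *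
        ∫⁻ z, unitForm (legVec P B j (noisy 0 s z)) g ^ (4 * m) ∂gB k n := by
    intro g
    rw [blockNorm, ENNReal.iSup_pow_of_ne_zero (by omega)]
    refine iSup_le fun x => ?_
    calc _ = (‖blockForm P (fun idx => B idx * g (idx j)) x.1‖ₑ ^ 2) ^ (2 * m) := by
          rw [← pow_mul]; congr 1; ring
      _ ≤ _ := pow_le_pow_left' (enorm_blockForm_le B j g x.1 s) _
      _ ≤ (M * ∫⁻ z, unitForm (legVec P B j (noisy x.1 s z)) g ^ 2 ∂gB k n) ^ (2 * m) := by
          gcongr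
          rw [hM, ← hs2]
          exact lintegral_sq_legVec_le B hj x.2 s
      _ ≤ _ := by
          rw [mul_pow, mul_assoc]
          gcongr
          refine (lintegral_unitForm_noisy_le B j g x.2 hs0 m).trans (le_of_eq ?_)
          congr 1
          rw [← ENNReal.ofReal_pow (Real.exp_pos _).le, ← Real.exp_nat_mul, hs2]
          congr 2
          push_cast
          field_simp
  calc _ ≤ _ := lintegral_mono key
    _ ≤ (M ^ (2 * m) * ENNReal.ofReal (Real.exp (2 ^ k)) ^ (4 * m)) *
        ENNReal.ofReal (4 * m) ^ (2 * m) :=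
        lintegral_lintegral_unitForm_le (gB k n) hc.measurable hm _
    _ = _ := by ring

end Core

section Decoupled

variable {k n : ℕ}

theorem measurable_blockNorm (P : Finset (Finset (Fin k))) :
    Measurable fun A : (Fin k → Fin n) → ℝ => blockNorm P A := by
  refine LowerSemicontinuous.measurable (lowerSemicontinuous_iSup fun x => ?_)
  refine Continuous.lowerSemicontinuous ?_
  refine continuous_enorm.comp ?_
  unfold blockForm
  fun_prop

/-- The blocks of `P` partition the complement of `s`. -/
def PartitionsCompl (s : Finset (Fin k)) (P : Finset (Finset (Fin k))) : Prop :=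
  (∀ I ∈ P, I.Nonempty) ∧ (∀ I ∈ P, ∀ J ∈ P, I ≠ J → Disjoint I J) ∧
    ∀ t : Fin k, t ∉ s ↔ ∃ I ∈ P, t ∈ I

theorem PartitionsCompl.isPartition {P : Finset (Finset (Fin k))} (h : PartitionsCompl ∅ P) :
    IsPartition P :=
  ⟨h.1, h.2.1, fun t => (h.2.2 t).1 (Finset.notMem_empty t)⟩

theorem partitionsCompl_univ : PartitionsCompl (Finset.univ : Finset (Fin k)) ∅ := by
  simp [PartitionsCompl]

theorem PartitionsCompl.notMem {s : Finset (Fin k)} {j : Fin k} {P : Finset (Finset (Fin k))}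
    (h : PartitionsCompl (insert j s) P) : ∀ I ∈ P, j ∉ I := fun I hI hjI =>
  (h.2.2 j).2 ⟨I, hI, hjI⟩ (Finset.mem_insert_self j s)

theorem PartitionsCompl.mergeBlocks {s : Finset (Fin k)} {j : Fin k} (hjs : j ∉ s)
    {P S : Finset (Finset (Fin k))} (h : PartitionsCompl (insert j s) P) (hS : S ⊆ P) :
    PartitionsCompl s (mergeBlocks P S j) := by
  have hj := h.notMem
  have hd : ∀ J ∈ P \ S, Disjoint (insert j (S.biUnion id)) J := by
    intro J hJ
    rw [Finset.mem_sdiff] at hJ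
    rw [Finset.disjoint_insert_left, Finset.disjoint_biUnion_left]
    exact ⟨hj J hJ.1, fun I hI => h.2.1 I (hS hI) J hJ.1 fun e => hJ.2 (e ▸ hI)⟩
  refine ⟨?_, ?_, ?_⟩
  · intro I hI
    rcases Finset.mem_insert.1 hI with rfl | hI
    · exact Finset.insert_nonempty _ _
    · exact h.1 I (Finset.mem_sdiff.1 hI).1
  · intro I hI J hJ hIJ
    rcases Finset.mem_insert.1 hI with rfl | hI <;> rcases Finset.mem_insert.1 hJ with rfl | hJ
    · exact absurd rfl hIJ
    · exact hd J hJ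
    · exact (hd I hI).symm
    · exact h.2.1 I (Finset.mem_sdiff.1 hI).1 J (Finset.mem_sdiff.1 hJ).1 hIJ
  · intro t
    have ht := h.2.2 t
    unfold _root_.mergeBlocks
    rw [Finset.mem_insert] at ht
    constructor
    · intro hts
      by_cases htj : t = j
      · exact ⟨_, Finset.mem_insert_self _ _, htj ▸ Finset.mem_insert_self _ _⟩
      · obtain ⟨I, hI, htI⟩ := ht.1 (by tauto)
        by_cases hIS : I ∈ S
        · exact ⟨_, Finset.mem_insert_self _ _,
            Finset.mem_insert_of_mem (Finset.mem_biUnion.2 ⟨I, hIS, htI⟩)⟩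
        · exact ⟨I, Finset.mem_insert_of_mem (Finset.mem_sdiff.2 ⟨hI, hIS⟩), htI⟩
    · rintro ⟨I, hI, htI⟩
      rcases Finset.mem_insert.1 hI with rfl | hI
      · rcases Finset.mem_insert.1 htI with rfl | htI
        · exact hjs
        · obtain ⟨J, hJ, htJ⟩ := Finset.mem_biUnion.1 htI
          have := ht.2 ⟨J, hS hJ, htJ⟩
          tauto
      · have := ht.2 ⟨I, (Finset.mem_sdiff.1 hI).1, htI⟩
        tauto

theorem card_mergeBlocks {j : Fin k} {P S : Finset (Finset (Fin k))} (hj : ∀ I ∈ P, j ∉ I)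
    (hS : S ⊆ P) : (mergeBlocks P S j).card + S.card = P.card + 1 := by
  unfold mergeBlocks
  rw [Finset.card_insert_of_notMem, ← Finset.card_sdiff_add_card_eq_card hS]
  · ring
  · intro h
    exact hj _ (Finset.mem_sdiff.1 h).1 (Finset.mem_insert_self _ _)

theorem ENNReal.sum_pow_le_card_pow_mul {ι : Type*} (T : Finset ι) (a : ι → ENNReal) {q : ℕ}
    (hq : q ≠ 0) : (∑ i ∈ T, a i) ^ q ≤ (T.card : ENNReal) ^ q * ∑ i ∈ T, a i ^ q := by
  rcases T.eq_empty_or_nonempty with rfl | hT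
  · simp [hq]
  obtain ⟨i, hi, hmax⟩ := T.exists_max_image a hT
  calc (∑ i ∈ T, a i) ^ q ≤ (T.card * a i) ^ q := by
        gcongr
        rw [← nsmul_eq_mul]
        exact Finset.sum_le_card_nsmul _ _ _ hmax
    _ = (T.card : ENNReal) ^ q * a i ^ q := mul_pow _ _ _
    _ ≤ _ := by
        gcongr
        exact Finset.single_le_sum (f := fun i => a i ^ q) (fun _ _ => zero_le) hi

/-- The tensor `A` with the indices in `s` weighted by the vectors `G`. -/
def weighted (A : (Fin k → Fin n) → ℝ) (s : Finset (Fin k)) (G : Fin k → Fin n → ℝ)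
    (idx : Fin k → Fin n) : ℝ :=
  A idx * ∏ i ∈ s, G i (idx i)

theorem continuous_weighted (A : (Fin k → Fin n) → ℝ) (s : Finset (Fin k)) :
    Continuous (weighted A s) := by
  unfold weighted
  fun_prop

theorem measurable_blockNorm_weighted (P : Finset (Finset (Fin k))) (A : (Fin k → Fin n) → ℝ)
    (s : Finset (Fin k)) : Measurable fun G => blockNorm P (weighted A s G) :=
  (measurable_blockNorm P).comp (continuous_weighted A s).measurable

theorem weighted_insert_update (A : (Fin k → Fin n) → ℝ) {s : Finset (Fin k)} {j : Fin k}
    (hj : j ∉ s) (G : Fin k → Fin n → ℝ) (g : Fin n → ℝ) :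
    weighted A (insert j s) (Function.update G j g) =
      fun idx => weighted A s G idx * g (idx j) := by
  funext idx
  unfold weighted
  rw [Finset.prod_insert hj, Function.update_self, mul_comm (g (idx j)), ← mul_assoc]
  congr 2
  refine Finset.prod_congr rfl fun i hi => ?_
  rw [Function.update_of_ne]
  rintro rfl
  exact hj hi

/-- The constant lost when integrating one Gaussian vector in the decoupled moment estimate. -/
def stepConst (k : ℕ) : ENNReal := ENNReal.ofReal (Real.exp (2 ^ k)) * 2 ^ 2 ^ k

theorem lintegral_blockNorm_weighted_le {P : Finset (Finset (Fin k))} (A : (Fin k → Fin n) → ℝ)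
    {s : Finset (Fin k)} {j : Fin k} (hjs : j ∉ s) (hP : PartitionsCompl (insert j s) P) {m : ℕ}
    (hm : m ≠ 0) (G : Fin k → Fin n → ℝ) :
    ENNReal.ofReal (4 * m) ^ (P.card * (2 * m)) *
      ∫⁻ g, blockNorm P (weighted A (insert j s) (Function.update G j g)) ^ (4 * m) ∂gam (Fin n) ≤
    (ENNReal.ofReal (Real.exp (2 ^ k)) ^ (4 * m) * (2 ^ 2 ^ k) ^ (2 * m)) *
      ∑ S ∈ P.powerset, ENNReal.ofReal (4 * m) ^ ((mergeBlocks P S j).card * (2 * m)) *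
        blockNorm (mergeBlocks P S j) (weighted A s G) ^ (4 * m) := by
  have hm0 : (0 : ℝ) < 4 * m := by positivity
  simp_rw [weighted_insert_update A hjs]
  refine (mul_le_mul_right (lintegral_blockNorm_le (weighted A s G) hP.notMem hm) _).trans ?_
  have hcard : P.powerset.card ≤ 2 ^ 2 ^ k := by
    rw [Finset.card_powerset]
    refine Nat.pow_le_pow_right two_pos ((Finset.card_le_univ P).trans ?_)
    simp
  calc _ = ENNReal.ofReal (Real.exp (2 ^ k)) ^ (4 * m) * (∑ S ∈ P.powerset,
        ENNReal.ofReal (4 * m) ^ (P.card + 1) * (ENNReal.ofReal (1 / (4 * m)) ^ S.card *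
        blockNorm (mergeBlocks P S j) (weighted A s G) ^ 2)) ^ (2 * m) := by
        rw [← Finset.mul_sum, mul_pow (ENNReal.ofReal (4 * m) ^ (P.card + 1)), ← pow_mul]
        ring
    _ = ENNReal.ofReal (Real.exp (2 ^ k)) ^ (4 * m) * (∑ S ∈ P.powerset,
        ENNReal.ofReal (4 * m) ^ (mergeBlocks P S j).card *
        blockNorm (mergeBlocks P S j) (weighted A s G) ^ 2) ^ (2 * m) := by
        congr 2
        refine Finset.sum_congr rfl fun S hS => ?_
        rw [← card_mergeBlocks hP.notMem (Finset.mem_powerset.1 hS), pow_add, ← mul_assoc,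
          mul_assoc (_ ^ _) (_ ^ _) (_ ^ _), ← mul_pow, ← ENNReal.ofReal_mul hm0.le,
          mul_one_div_cancel hm0.ne', ENNReal.ofReal_one, one_pow, mul_one]
    _ ≤ ENNReal.ofReal (Real.exp (2 ^ k)) ^ (4 * m) * ((P.powerset.card : ENNReal) ^ (2 * m) *
        ∑ S ∈ P.powerset, (ENNReal.ofReal (4 * m) ^ (mergeBlocks P S j).card *
        blockNorm (mergeBlocks P S j) (weighted A s G) ^ 2) ^ (2 * m)) := by
        gcongr
        exact ENNReal.sum_pow_le_card_pow_mul _ _ (by omega)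
    _ ≤ _ := by
        rw [← mul_assoc]
        gcongr with S hS
        · exact_mod_cast hcard
        · rw [mul_pow, ← pow_mul, ← pow_mul, show 2 * (2 * m) = 4 * m by ring]

theorem lmarginal_const_mul_sum {δ ι : Type*} [DecidableEq δ] {X : δ → Type*}
    [∀ i, MeasurableSpace (X i)] (μ : ∀ i, Measure (X i)) [∀ i, SigmaFinite (μ i)] (T : Finset ι)
    (s : Finset δ) (c : ENNReal) (f : ι → (∀ i, X i) → ENNReal) (hf : ∀ i, Measurable (f i))
    (x : ∀ i, X i) :
    (∫⋯∫⁻_s, (fun y => c * ∑ i ∈ T, f i y) ∂μ) x = c * ∑ i ∈ T, (∫⋯∫⁻_s, f i ∂μ) x := by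
  have hf' : ∀ i, Measurable fun y => f i (Function.updateFinset x s y) := fun i =>
    (hf i).comp measurable_updateFinset
  unfold lmarginal
  rw [lintegral_const_mul _ (Finset.measurable_fun_sum _ fun i _ => hf' i),
    lintegral_finsetSum _ fun i _ => hf' i]

theorem lmarginal_blockNorm_le (A : (Fin k → Fin n) → ℝ) {m : ℕ} (hm : m ≠ 0) {R : ENNReal}
    (hR : ∀ Q, IsPartition Q → ENNReal.ofReal (4 * m) ^ Q.card * blockNorm Q A ^ 2 ≤ R ^ 2)
    (s : Finset (Fin k)) : ∀ P, PartitionsCompl s P → ∀ G₀ : Fin k → Fin n → ℝ,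
      (∫⋯∫⁻_s, (fun G => ENNReal.ofReal (4 * m) ^ (P.card * (2 * m)) *
        blockNorm P (weighted A s G) ^ (4 * m)) ∂fun _ => gam (Fin n)) G₀ ≤
      (stepConst k ^ s.card * R) ^ (4 * m) := by
  induction s using Finset.induction_on with
  | empty =>
    intro P hP G₀
    rw [lmarginal_empty]
    calc _ = (ENNReal.ofReal (4 * m) ^ P.card * blockNorm P A ^ 2) ^ (2 * m) := by
          have hA : weighted A ∅ G₀ = A := funext fun idx => by simp [weighted]
          rw [hA, mul_pow, ← pow_mul, ← pow_mul, show 2 * (2 * m) = 4 * m by ring]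
      _ ≤ (R ^ 2) ^ (2 * m) := by
          gcongr
          exact hR P hP.isPartition
      _ = _ := by
          rw [← pow_mul, show 2 * (2 * m) = 4 * m by ring]
          simp
  | insert j s hjs ih =>
    intro P hP G₀
    have hmeas : ∀ (c : ENNReal) (Q : Finset (Finset (Fin k))) (s : Finset (Fin k)),
        Measurable fun G => c * blockNorm Q (weighted A s G) ^ (4 * m) := fun c Q s =>
      ((measurable_blockNorm_weighted Q A s).pow_const _).const_mul c
    rw [lmarginal_insert' _ (hmeas _ _ _) hjs]
    have hcard : P.powerset.card ≤ 2 ^ 2 ^ k := by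
      rw [Finset.card_powerset]
      refine Nat.pow_le_pow_right two_pos ((Finset.card_le_univ P).trans ?_)
      simp
    have hupd : ∀ G, Measurable fun g =>
        blockNorm P (weighted A (insert j s) (Function.update G j g)) ^ (4 * m) := fun G =>
      ((measurable_blockNorm_weighted P A (insert j s)).comp
        (measurable_update G)).pow_const _
    calc _ ≤ (∫⋯∫⁻_s, (fun G => (ENNReal.ofReal (Real.exp (2 ^ k)) ^ (4 * m) *
          (2 ^ 2 ^ k) ^ (2 * m)) * ∑ S ∈ P.powerset,
          ENNReal.ofReal (4 * m) ^ ((mergeBlocks P S j).card * (2 * m)) *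
          blockNorm (mergeBlocks P S j) (weighted A s G) ^ (4 * m)) ∂fun _ => gam (Fin n)) G₀ := by
          refine lmarginal_mono (fun G => ?_) G₀
          rw [lintegral_const_mul _ (hupd G)]
          exact lintegral_blockNorm_weighted_le A hjs hP hm G
      _ = (ENNReal.ofReal (Real.exp (2 ^ k)) ^ (4 * m) * (2 ^ 2 ^ k) ^ (2 * m)) *
          ∑ S ∈ P.powerset, (∫⋯∫⁻_s, (fun G =>
          ENNReal.ofReal (4 * m) ^ ((mergeBlocks P S j).card * (2 * m)) *
          blockNorm (mergeBlocks P S j) (weighted A s G) ^ (4 * m)) ∂fun _ => gam (Fin n)) G₀ := by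
          exact lmarginal_const_mul_sum _ _ s _ _ (fun S => hmeas _ _ s) G₀
      _ ≤ (ENNReal.ofReal (Real.exp (2 ^ k)) ^ (4 * m) * (2 ^ 2 ^ k) ^ (2 * m)) *
          ∑ S ∈ P.powerset, (stepConst k ^ s.card * R) ^ (4 * m) := by
          gcongr with S hS
          exact ih _ (hP.mergeBlocks hjs (Finset.mem_powerset.1 hS)) G₀
      _ ≤ (ENNReal.ofReal (Real.exp (2 ^ k)) ^ (4 * m) * (2 ^ 2 ^ k) ^ (2 * m)) *
          ((2 ^ 2 ^ k) ^ (2 * m) * (stepConst k ^ s.card * R) ^ (4 * m)) := by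
          rw [Finset.sum_const, nsmul_eq_mul]
          gcongr
          calc (P.powerset.card : ENNReal) ≤ (2 ^ 2 ^ k) ^ 1 := by
                rw [pow_one]
                exact_mod_cast hcard
            _ ≤ _ := pow_le_pow_right₀ (one_le_pow₀ one_le_two) (by omega)
      _ = _ := by
          rw [Finset.card_insert_of_notMem hjs, pow_succ, stepConst]
          ring

theorem lintegral_decoupled_le (A : (Fin k → Fin n) → ℝ) {m : ℕ} (hm : m ≠ 0) {R : ENNReal}
    (hR : ∀ Q, IsPartition Q → ENNReal.ofReal (4 * m) ^ Q.card * blockNorm Q A ^ 2 ≤ R ^ 2) :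
    ∫⁻ G : Fin k → Fin n → ℝ, ‖∑ idx, A idx * ∏ s, G s (idx s)‖ₑ ^ (4 * m)
      ∂Measure.pi (fun _ => gam (Fin n)) ≤ (stepConst k ^ k * R) ^ (4 * m) := by
  have h := lmarginal_blockNorm_le A hm hR Finset.univ ∅ partitionsCompl_univ 0
  rw [lmarginal_univ, Finset.card_univ, Fintype.card_fin] at h
  refine (lintegral_mono fun G => ?_).trans h
  rw [Finset.card_empty, zero_mul, pow_zero, one_mul]
  gcongr
  refine (le_of_eq ?_).trans (le_blockNorm ∅ _ (x := 0) (by simp))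
  simp [blockForm, weighted]

theorem bddAbove_partNorm {P : Finset (Finset (Fin k))} (A : (Fin k → Fin n) → ℝ) :
    BddAbove (Set.range fun x : {x : Blk k n // ∀ I ∈ P, ∑ u, x I u ^ 2 ≤ 1} =>
      ∑ idx : Fin k → Fin n, A idx * ∏ I ∈ P, x.1 I (fun s => idx s.1)) := by
  refine ⟨∑ idx, |A idx|, ?_⟩
  rintro _ ⟨x, rfl⟩
  refine Finset.sum_le_sum fun idx _ => (le_abs_self _).trans ?_
  rw [abs_mul, Finset.abs_prod]
  refine mul_le_of_le_one_right (abs_nonneg _) (Finset.prod_le_one (fun _ _ => abs_nonneg _) ?_)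
  intro I hI
  rw [← sq_le_one_iff_abs_le_one]
  exact (Finset.single_le_sum (f := fun u => x.1 I u ^ 2) (fun _ _ => sq_nonneg _)
    (Finset.mem_univ _)).trans (x.2 I hI)

theorem partNorm_nonneg (P : Finset (Finset (Fin k))) (hP : P.Nonempty) (A : (Fin k → Fin n) → ℝ) :
    0 ≤ partNorm P A := by
  refine le_ciSup_of_le (bddAbove_partNorm A) ⟨0, by simp⟩ (le_of_eq ?_)
  obtain ⟨I, hI⟩ := hP
  refine (Finset.sum_eq_zero fun idx _ => ?_).symm
  rw [Finset.prod_eq_zero hI rfl, mul_zero]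

theorem blockNorm_le_partNorm {P : Finset (Finset (Fin k))} (hP : P.Nonempty)
    (A : (Fin k → Fin n) → ℝ) : blockNorm P A ≤ ENNReal.ofReal (partNorm P A) := by
  obtain ⟨J, hJ⟩ := hP
  refine iSup_le fun x => ?_
  rw [Real.enorm_eq_ofReal_abs]
  refine ENNReal.ofReal_le_ofReal (abs_le'.2 ⟨?_, ?_⟩)
  · exact le_ciSup (bddAbove_partNorm A) ⟨x.1, fun I _ => x.2 I⟩
  · have hy : ∀ I ∈ P, ∑ u, (Function.update x.1 J (-x.1 J)) I u ^ 2 ≤ 1 := by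
      intro I _
      by_cases h : I = J
      · subst h
        simpa using x.2 I
      · simpa [Function.update_of_ne h] using x.2 I
    refine (le_of_eq ?_).trans (le_ciSup (bddAbove_partNorm A) ⟨_, hy⟩)
    unfold blockForm
    rw [← Finset.sum_neg_distrib]
    refine Finset.sum_congr rfl fun idx _ => ?_
    rw [← Finset.mul_prod_erase _ _ hJ, ← Finset.mul_prod_erase P _ hJ]
    have he : ∏ I ∈ P.erase J, Function.update x.1 J (-x.1 J) I (fun s => idx s.1) =
        ∏ I ∈ P.erase J, x.1 I (fun s => idx s.1) :=
      Finset.prod_congr rfl fun I hI => by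
        rw [Function.update_of_ne (Finset.ne_of_mem_erase hI)]
    rw [he]
    simp only [Function.update_self, Pi.neg_apply]
    ring

end Decoupled

section Recursion

theorem lintegral_pi_cons {E : Type*} [MeasurableSpace E] (ρ : Measure E) [SigmaFinite ρ] {k : ℕ}
    {F : (Fin (k + 1) → E) → ENNReal} (hF : Measurable F) :
    ∫⁻ G, F G ∂Measure.pi (fun _ => ρ) =
      ∫⁻ G, ∫⁻ g, F (Fin.cons g G) ∂ρ ∂Measure.pi (fun _ : Fin k => ρ) := by
  have e := (measurePreserving_piFinSuccAbove (fun _ : Fin (k + 1) => ρ) 0).symm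
  rw [← e.lintegral_comp hF, lintegral_prod_symm' (fun z => F ((MeasurableEquiv.piFinSuccAbove (fun _ => E) 0).symm z))
      (hF.comp (MeasurableEquiv.measurable _))]
  refine lintegral_congr fun G => lintegral_congr fun g => ?_
  congr 1
  exact Fin.insertNth_zero' g G

theorem enorm_pow_four_mul (a : ℝ) (m : ℕ) : ‖a‖ₑ ^ (4 * m) = ENNReal.ofReal (a ^ (4 * m)) := by
  rw [Real.enorm_eq_ofReal_abs, ← ENNReal.ofReal_pow (abs_nonneg a), Even.pow_abs ⟨2 * m, by ring⟩]

variable {n r k : ℕ} {μ : Measure (Fin n → ℝ)} [IsProbabilityMeasure μ]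
  {ν : ∀ _ : Fin n, (Fin n → ℝ) → Measure ℝ} {σ2 : ℝ} {f : (Fin n → ℝ) → ℝ}

theorem fderiv_apply_eq_sum (f : (Fin n → ℝ) → ℝ) (x g : Fin n → ℝ) :
    fderiv ℝ f x g = ∑ i, fderiv ℝ f x (Pi.single i 1) * g i := by
  conv_lhs => rw [pi_eq_sum_univ' g, map_sum]
  refine Finset.sum_congr rfl fun i _ => ?_
  rw [map_smul, smul_eq_mul, mul_comm]

theorem lintegral_deviation_le (hcube : ∀ᵐ x ∂μ, ∀ i, x i ∈ Set.Icc (-1 : ℝ) 1)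
    (h : DLSI μ ν σ2) (hσ : 0 < σ2) (hf : f ∈ tetra n (r + 1)) (j : ℕ) :
    ∫⁻ x, ‖f x - ∫ y, f y ∂μ‖ₑ ^ (4 * 2 ^ j) ∂μ ≤
      ENNReal.ofReal (64 * Real.exp 1 * σ2) ^ (2 * 2 ^ j) *
        ∫⁻ g, ∫⁻ x, ‖fderiv ℝ f x g‖ₑ ^ (4 * 2 ^ j) ∂μ ∂gam (Fin n) := by
  have hfc := tetra_continuous hf
  have hgc := continuous_grSq hf
  have hj : 4 * 2 ^ j = 2 ^ (j + 1 + 1) := by ring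
  have hjoint : Measurable fun q : (Fin n → ℝ) × (Fin n → ℝ) =>
      ‖fderiv ℝ f q.2 q.1‖ₑ ^ (4 * 2 ^ j) := by
    refine (measurable_enorm.comp (Continuous.measurable ?_)).pow_const _
    exact (((tetra_contDiff hf).continuous_fderiv (by simp)).comp continuous_snd).clm_apply
      continuous_fst
  have hmom := moment_le hcube h hσ hf (j + 1)
  rw [lintegral_lintegral_swap (f := fun g x => ‖fderiv ℝ f x g‖ₑ ^ (4 * 2 ^ j))
    hjoint.aemeasurable, ← lintegral_const_mul _ hjoint.lintegral_prod_left']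
  simp_rw [enorm_pow_four_mul]
  rw [← ofReal_integral_eq_lintegral_ofReal
    (integrable_of_cube hcube (by fun_prop)) (ae_of_all _ fun x => by
      rw [hj]; exact Even.pow_nonneg ⟨2 ^ (j + 1), by ring⟩ _)]
  rw [hj]
  refine (ENNReal.ofReal_le_ofReal hmom).trans ?_
  rw [← integral_const_mul, ofReal_integral_eq_lintegral_ofReal
    (integrable_of_cube hcube (by fun_prop)) (ae_of_all _ fun x =>
      mul_nonneg (by positivity) (pow_nonneg (grSq_nonneg f x) _))]
  refine lintegral_mono fun x => ?_
  have hv := le_integral_inner_pow (fun i => fderiv ℝ f x (Pi.single i 1)) (2 ^ (j + 1))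
  have hi := integrable_inner_pow (fun i => fderiv ℝ f x (Pi.single i 1)) (2 ^ (j + 1 + 1))
  have hg : ∀ g, ENNReal.ofReal (fderiv ℝ f x g ^ 2 ^ (j + 1 + 1)) = ENNReal.ofReal
      ((∑ i, fderiv ℝ f x (Pi.single i 1) * g i) ^ 2 ^ (j + 1 + 1)) := fun g => by
    rw [fderiv_apply_eq_sum f x g]
  rw [lintegral_congr hg]
  rw [← ofReal_integral_eq_lintegral_ofReal hi
    (ae_of_all _ fun g => Even.pow_nonneg ⟨2 ^ (j + 1), by ring⟩ _),
    ← ENNReal.ofReal_pow (by positivity), ← ENNReal.ofReal_mul (by positivity)]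
  refine ENNReal.ofReal_le_ofReal ?_
  rw [show 2 * 2 ^ (j + 1) = 2 ^ (j + 1 + 1) by ring] at hv
  push_cast at hv
  rw [show (2 : ℝ) * 2 ^ (j + 1) = 2 ^ (j + 1 + 1) by ring] at hv
  rw [show 2 * 2 ^ j = 2 ^ (j + 1) by ring]
  calc (2 ^ (j + 1 + 1) * (32 * σ2)) ^ 2 ^ (j + 1) * grSq f x ^ 2 ^ (j + 1)
      = (32 * σ2) ^ 2 ^ (j + 1) * ((2 ^ (j + 1 + 1)) ^ 2 ^ (j + 1) * grSq f x ^ 2 ^ (j + 1)) := by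
        rw [mul_pow]; ring
    _ ≤ (32 * σ2) ^ 2 ^ (j + 1) * ((2 * Real.exp 1) ^ 2 ^ (j + 1) *
        ∫ g, (∑ i, fderiv ℝ f x (Pi.single i 1) * g i) ^ 2 ^ (j + 1 + 1) ∂gam (Fin n)) :=
        mul_le_mul_of_nonneg_left hv (by positivity)
    _ = _ := by
        rw [← mul_assoc, ← mul_pow]
        congr 2
        ring

/-- The moment of the `k`-th derivative of `f` evaluated at independent Gaussian vectors. -/
def decoupledMoment (μ : Measure (Fin n → ℝ)) (f : (Fin n → ℝ) → ℝ) (q k : ℕ) : ENNReal :=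
  ∫⁻ G : Fin k → Fin n → ℝ, ∫⁻ x, ‖iteratedFDeriv ℝ k f x G‖ₑ ^ q ∂μ
    ∂Measure.pi (fun _ => gam (Fin n))

theorem continuous_gradT (hf : f ∈ tetra n (r + k)) (idx : Fin k → Fin n) :
    Continuous fun x => gradT k f x idx :=
  tetra_continuous (tetra_iteratedFDeriv hf _)

theorem continuous_iteratedFDeriv_uncurry (hf : f ∈ tetra n (r + k)) :
    Continuous fun q : (Fin k → Fin n → ℝ) × (Fin n → ℝ) => iteratedFDeriv ℝ k f q.2 q.1 := by
  simp_rw [sum_gradT]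
  refine continuous_finsetSum _ fun idx _ =>
    ((continuous_gradT hf idx).comp continuous_snd).mul ?_
  fun_prop

theorem integral_iteratedFDeriv (hcube : ∀ᵐ x ∂μ, ∀ i, x i ∈ Set.Icc (-1 : ℝ) 1)
    (hf : f ∈ tetra n (r + k)) (G : Fin k → Fin n → ℝ) :
    ∫ x, iteratedFDeriv ℝ k f x G ∂μ =
      ∑ idx, (∫ x, gradT k f x idx ∂μ) * ∏ s, G s (idx s) := by
  simp_rw [sum_gradT]
  rw [integral_finsetSum _ fun idx _ =>
    (integrable_of_cube hcube (continuous_gradT hf idx)).mul_const _]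
  simp_rw [integral_mul_const]

theorem decoupledMoment_zero_of_tetra (hf : f ∈ tetra n k) {q : ℕ} (hq : q ≠ 0) :
    decoupledMoment μ f q k = 0 := by
  have h : ∀ x (G : Fin k → Fin n → ℝ), iteratedFDeriv ℝ k f x G = 0 := fun x G =>
    congrFun (tetra_zero (tetra_iteratedFDeriv (r := 0) (by rwa [zero_add]) G)) x
  simp [decoupledMoment, h, hq]

theorem ENNReal.add_pow_le_two_pow_mul (a b : ENNReal) (q : ℕ) :
    (a + b) ^ q ≤ 2 ^ q * (a ^ q + b ^ q) := by
  wlog hab : a ≤ b generalizing a b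
  · rw [add_comm a, add_comm (a ^ q)]
    exact this b a (le_of_not_ge hab)
  calc (a + b) ^ q ≤ (2 * b) ^ q := by
        rw [two_mul]
        gcongr
    _ = 2 ^ q * b ^ q := mul_pow _ _ _
    _ ≤ _ := by
        gcongr
        exact le_add_self

theorem decoupledMoment_le (hcube : ∀ᵐ x ∂μ, ∀ i, x i ∈ Set.Icc (-1 : ℝ) 1)
    (h : DLSI μ ν σ2) (hσ : 0 < σ2) (hf : f ∈ tetra n (r + 1 + k)) (j : ℕ) :
    decoupledMoment μ f (4 * 2 ^ j) k ≤
      2 ^ (4 * 2 ^ j) * ∫⁻ G : Fin k → Fin n → ℝ,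
        ‖∑ idx, (∫ x, gradT k f x idx ∂μ) * ∏ s, G s (idx s)‖ₑ ^ (4 * 2 ^ j)
          ∂Measure.pi (fun _ => gam (Fin n)) +
      2 ^ (4 * 2 ^ j) * (ENNReal.ofReal (64 * Real.exp 1 * σ2) ^ (2 * 2 ^ j) *
        decoupledMoment μ f (4 * 2 ^ j) (k + 1)) := by
  set q := 4 * 2 ^ j with hq
  have hc := continuous_iteratedFDeriv_uncurry hf
  have hc1 := continuous_iteratedFDeriv_uncurry (k := k + 1) (r := r)
    (by rwa [add_assoc, add_comm 1 k] at hf)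
  have hm1 : Measurable fun G : Fin (k + 1) → Fin n → ℝ =>
      ∫⁻ x, ‖iteratedFDeriv ℝ (k + 1) f x G‖ₑ ^ q ∂μ :=
    (Measurable.pow_const (measurable_enorm.comp hc1.measurable) q).lintegral_prod_right'
  have hmE : Measurable fun G : Fin k → Fin n → ℝ =>
      ‖∑ idx, (∫ x, gradT k f x idx ∂μ) * ∏ s, G s (idx s)‖ₑ ^ q :=
    (measurable_enorm.comp (Continuous.measurable (by fun_prop))).pow_const q
  have hm2 : Measurable fun G : Fin k → Fin n → ℝ =>
      ∫⁻ g, ∫⁻ x, ‖iteratedFDeriv ℝ (k + 1) f x (Fin.cons g G)‖ₑ ^ q ∂μ ∂gam (Fin n) := by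
    have hcons : Measurable fun q : (Fin k → Fin n → ℝ) × (Fin n → ℝ) =>
        (Fin.cons q.2 q.1 : Fin (k + 1) → Fin n → ℝ) := by
      refine measurable_pi_iff.2 (Fin.forall_fin_succ.2 ⟨?_, fun i => ?_⟩)
      · simpa using measurable_snd
      · exact (measurable_pi_apply i).comp measurable_fst
    exact (hm1.comp hcons).lintegral_prod_right'
  have key : ∀ G : Fin k → Fin n → ℝ, ∫⁻ x, ‖iteratedFDeriv ℝ k f x G‖ₑ ^ q ∂μ ≤
      2 ^ q * ‖∑ idx, (∫ x, gradT k f x idx ∂μ) * ∏ s, G s (idx s)‖ₑ ^ q +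
      2 ^ q * (ENNReal.ofReal (64 * Real.exp 1 * σ2) ^ (2 * 2 ^ j) *
        ∫⁻ g, ∫⁻ x, ‖iteratedFDeriv ℝ (k + 1) f x (Fin.cons g G)‖ₑ ^ q ∂μ ∂gam (Fin n)) := by
    intro G
    have hd := lintegral_deviation_le hcube h hσ (tetra_iteratedFDeriv hf G) j
    simp_rw [iteratedFDeriv_cons hf]
    rw [← integral_iteratedFDeriv hcube hf G]
    set b := ∫ x, iteratedFDeriv ℝ k f x G ∂μ with hb
    have hmG : Measurable fun x => ‖iteratedFDeriv ℝ k f x G - b‖ₑ ^ q :=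
      (measurable_enorm.comp
        ((tetra_continuous (tetra_iteratedFDeriv hf G)).measurable.sub_const b)).pow_const q
    calc _ ≤ ∫⁻ x, 2 ^ q * (‖b‖ₑ ^ q + ‖iteratedFDeriv ℝ k f x G - b‖ₑ ^ q) ∂μ := by
          refine lintegral_mono fun x => le_trans ?_ (ENNReal.add_pow_le_two_pow_mul _ _ q)
          refine pow_le_pow_left' (le_trans (le_of_eq ?_) (enorm_add_le b _)) q
          rw [add_sub_cancel]
      _ = 2 ^ q * ‖b‖ₑ ^ q + 2 ^ q * ∫⁻ x, ‖iteratedFDeriv ℝ k f x G - b‖ₑ ^ q ∂μ := by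
          rw [lintegral_const_mul _ (hmG.const_add _), lintegral_add_right _ hmG, mul_add]
          simp
      _ ≤ _ := by gcongr
  unfold decoupledMoment
  rw [lintegral_pi_cons _ hm1, ← lintegral_const_mul _ hmE, ← lintegral_const_mul _ hm2,
    ← lintegral_const_mul _ (hm2.const_mul _), ← lintegral_add_left (hmE.const_mul _)]
  exact lintegral_mono key

end Recursion

section Concentration

/-- Tensor order dependent constant in the moment estimate for tetrahedral polynomials. -/
def orderConst (k : ℕ) : ℝ :=
  (256 * Real.exp 1 * (Real.exp (2 ^ k) * 2 ^ 2 ^ k) ^ 2) ^ k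

theorem one_le_orderConst (k : ℕ) : 1 ≤ orderConst k := by
  have h1 : (1 : ℝ) ≤ Real.exp 1 := Real.one_le_exp zero_le_one
  have h2 : (1 : ℝ) ≤ Real.exp (2 ^ k) := Real.one_le_exp (by positivity)
  have h3 : (1 : ℝ) ≤ 2 ^ 2 ^ k := one_le_pow₀ one_le_two
  have h4 : (1 : ℝ) ≤ (Real.exp (2 ^ k) * 2 ^ 2 ^ k) ^ 2 :=
    one_le_pow₀ (one_le_mul_of_one_le_of_one_le h2 h3)
  exact one_le_pow₀ (one_le_mul_of_one_le_of_one_le (by linarith) h4)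

theorem stepConst_eq (k : ℕ) :
    stepConst k = ENNReal.ofReal (Real.exp (2 ^ k) * 2 ^ 2 ^ k) := by
  rw [stepConst, ENNReal.ofReal_mul (Real.exp_pos _).le, ENNReal.ofReal_pow two_pos.le,
    ENNReal.ofReal_ofNat]

theorem ENNReal.sum_pow_le_pow_sum {ι : Type*} (T : Finset ι) (a : ι → ENNReal) {q : ℕ}
    (hq : q ≠ 0) : ∑ i ∈ T, a i ^ q ≤ (∑ i ∈ T, a i) ^ q := by
  obtain ⟨q, rfl⟩ := Nat.exists_eq_succ_of_ne_zero hq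
  rw [Nat.succ_eq_add_one, pow_succ, Finset.mul_sum]
  refine Finset.sum_le_sum fun i hi => ?_
  rw [pow_succ]
  gcongr
  exact Finset.single_le_sum (f := a) (fun _ _ => zero_le) hi

variable {n d : ℕ} {μ : Measure (Fin n → ℝ)} [IsProbabilityMeasure μ]
  {ν : ∀ _ : Fin n, (Fin n → ℝ) → Measure ℝ} {σ2 : ℝ} {f : (Fin n → ℝ) → ℝ}

/-- The moment of the decoupled chaos with coefficient tensor the mean `k`-th derivative of `f`. -/
def meanMoment (μ : Measure (Fin n → ℝ)) (f : (Fin n → ℝ) → ℝ) (q k : ℕ) : ENNReal :=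
  ∫⁻ G : Fin k → Fin n → ℝ, ‖∑ idx, (∫ x, gradT k f x idx ∂μ) * ∏ s, G s (idx s)‖ₑ ^ q
    ∂Measure.pi (fun _ => gam (Fin n))

theorem decoupledMoment_one_le (hcube : ∀ᵐ x ∂μ, ∀ i, x i ∈ Set.Icc (-1 : ℝ) 1)
    (h : DLSI μ ν σ2) (hσ : 0 < σ2) (hf : f ∈ tetra n (d + 1)) (j : ℕ) {l : ℕ} (hl : l ≤ d) :
    decoupledMoment μ f (4 * 2 ^ j) 1 ≤
      ∑ k ∈ Finset.range l,
        (2 ^ (4 * 2 ^ j) * ENNReal.ofReal (64 * Real.exp 1 * σ2) ^ (2 * 2 ^ j)) ^ k *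
          (2 ^ (4 * 2 ^ j) * meanMoment μ f (4 * 2 ^ j) (k + 1)) +
      (2 ^ (4 * 2 ^ j) * ENNReal.ofReal (64 * Real.exp 1 * σ2) ^ (2 * 2 ^ j)) ^ l *
        decoupledMoment μ f (4 * 2 ^ j) (l + 1) := by
  induction l with
  | zero => simp
  | succ l ih =>
    have hf' : f ∈ tetra n (d - (l + 1) + 1 + (l + 1)) := by
      rwa [show d - (l + 1) + 1 + (l + 1) = d + 1 by omega]
    refine (ih (by omega)).trans ?_
    rw [Finset.sum_range_succ, add_assoc]
    gcongr
    refine (mul_le_mul_right (decoupledMoment_le hcube h hσ hf' j) _).trans (le_of_eq ?_)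
    rw [meanMoment, mul_add, pow_succ]
    ring

theorem lintegral_deviation_le_sum (hcube : ∀ᵐ x ∂μ, ∀ i, x i ∈ Set.Icc (-1 : ℝ) 1)
    (h : DLSI μ ν σ2) (hσ : 0 < σ2) (hf : f ∈ tetra n (d + 1)) (j : ℕ) :
    ∫⁻ x, ‖f x - ∫ y, f y ∂μ‖ₑ ^ (4 * 2 ^ j) ∂μ ≤
      ∑ k ∈ Finset.range d, ENNReal.ofReal ((256 * Real.exp 1 * σ2) ^ (k + 1)) ^ (2 * 2 ^ j) *
        meanMoment μ f (4 * 2 ^ j) (k + 1) := by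
  set c := ENNReal.ofReal (64 * Real.exp 1 * σ2) with hc
  have hW : ∀ k, (2 ^ (4 * 2 ^ j) * c ^ (2 * 2 ^ j)) ^ k =
      ENNReal.ofReal ((256 * Real.exp 1 * σ2) ^ k) ^ (2 * 2 ^ j) := fun k => by
    rw [show 256 * Real.exp 1 * σ2 = 2 ^ 2 * (64 * Real.exp 1 * σ2) by ring,
      ENNReal.ofReal_pow (by positivity), ENNReal.ofReal_mul (by positivity),
      ENNReal.ofReal_pow two_pos.le, ENNReal.ofReal_ofNat, ← hc,
      show 4 * 2 ^ j = 2 * (2 * 2 ^ j) by ring, pow_mul, ← mul_pow, pow_right_comm]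
  have hz := decoupledMoment_zero_of_tetra (μ := μ) hf (q := 4 * 2 ^ j) (by positivity)
  have h1 := decoupledMoment_one_le hcube h hσ hf j le_rfl
  rw [hz, mul_zero, add_zero] at h1
  have h0 : ∫⁻ g, ∫⁻ x, ‖fderiv ℝ f x g‖ₑ ^ (4 * 2 ^ j) ∂μ ∂gam (Fin n) =
      decoupledMoment μ f (4 * 2 ^ j) 1 := by
    have hm : Measurable fun G : Fin 1 → Fin n → ℝ =>
        ∫⁻ x, ‖iteratedFDeriv ℝ 1 f x G‖ₑ ^ (4 * 2 ^ j) ∂μ :=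
      (Measurable.pow_const (measurable_enorm.comp
        (continuous_iteratedFDeriv_uncurry hf).measurable) _).lintegral_prod_right'
    rw [decoupledMoment, lintegral_pi_cons _ hm]
    simp
  refine (lintegral_deviation_le hcube h hσ hf j).trans ?_
  rw [h0]
  refine (mul_le_mul_right h1 _).trans (le_of_eq ?_)
  rw [Finset.mul_sum]
  refine Finset.sum_congr rfl fun k _ => ?_
  rw [← hW (k + 1), pow_succ]
  ring

theorem IsPartition.nonempty {k : ℕ} (hk : 1 ≤ k) {P : Finset (Finset (Fin k))}
    (hP : IsPartition P) : P.Nonempty :=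
  let ⟨I, hI, _⟩ := hP.2.2 ⟨0, hk⟩
  ⟨I, hI⟩

theorem lintegral_deviation_le_of_partNorm (hcube : ∀ᵐ x ∂μ, ∀ i, x i ∈ Set.Icc (-1 : ℝ) 1)
    (h : DLSI μ ν σ2) (hσ : 0 < σ2) (hf : f ∈ tetra n (d + 1)) (j : ℕ) {T : ℝ} (hT : 0 ≤ T)
    (hp : ∀ k ∈ Finset.Icc 1 d, ∀ P : Finset (Finset (Fin k)), IsPartition P →
      (4 * 2 ^ j) ^ P.card * (σ2 ^ k * partNorm P (fun idx => ∫ x, gradT k f x idx ∂μ) ^ 2) ≤ T) :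
    ∫⁻ x, ‖f x - ∫ y, f y ∂μ‖ₑ ^ (4 * 2 ^ j) ∂μ ≤
      ENNReal.ofReal ((∑ k ∈ Finset.range d, orderConst (k + 1)) * T) ^ (2 * 2 ^ j) := by
  refine (lintegral_deviation_le_sum hcube h hσ hf j).trans ?_
  calc _ ≤ ∑ k ∈ Finset.range d, ENNReal.ofReal (orderConst (k + 1) * T) ^ (2 * 2 ^ j) := by
        refine Finset.sum_le_sum fun k hk => ?_
        set l := k + 1 with hl
        have hl1 : 1 ≤ l := by omega
        have hld : l ∈ Finset.Icc 1 d := by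
          rw [Finset.mem_range] at hk
          exact Finset.mem_Icc.2 ⟨hl1, by omega⟩
        set A : (Fin l → Fin n) → ℝ := fun idx => ∫ x, gradT l f x idx ∂μ with hA
        have hM := lintegral_decoupled_le A (m := 2 ^ j) (by positivity)
          (R := ENNReal.ofReal √(T / σ2 ^ l)) fun Q hQ => by
          rw [← ENNReal.ofReal_pow (Real.sqrt_nonneg _), Real.sq_sqrt (by positivity)]
          calc _ ≤ ENNReal.ofReal (4 * (2 ^ j : ℕ)) ^ Q.card * ENNReal.ofReal (partNorm Q A) ^ 2 := by
                gcongr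
                exact blockNorm_le_partNorm (hQ.nonempty hl1) A
            _ = ENNReal.ofReal ((4 * 2 ^ j) ^ Q.card * partNorm Q A ^ 2) := by
                rw [← ENNReal.ofReal_pow (by positivity),
                  ← ENNReal.ofReal_pow (partNorm_nonneg Q (hQ.nonempty hl1) A),
                  ← ENNReal.ofReal_mul (by positivity)]
                push_cast
                rfl
            _ ≤ _ := by
                refine ENNReal.ofReal_le_ofReal ?_
                rw [le_div_iff₀ (by positivity)]
                refine le_trans (le_of_eq ?_) (hp l hld Q hQ)
                ring
        rw [meanMoment]
        refine (mul_le_mul_right hM _).trans (le_of_eq ?_)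
        rw [show 4 * 2 ^ j = 2 * (2 * 2 ^ j) by ring, pow_mul (_ * _ : ENNReal) 2, ← mul_pow, stepConst_eq,
          ← ENNReal.ofReal_pow (by positivity), ← ENNReal.ofReal_mul (by positivity),
          ← ENNReal.ofReal_pow (by positivity), ← ENNReal.ofReal_mul (by positivity)]
        congr 2
        rw [mul_pow _ (√_) 2, Real.sq_sqrt (by positivity), orderConst, mul_pow _ σ2,
          mul_pow _ (_ ^ 2) l, pow_right_comm _ 2 l]
        field_simp
    _ ≤ _ := by
        refine (ENNReal.sum_pow_le_pow_sum _ _ (by positivity)).trans ?_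
        rw [Finset.sum_mul, ENNReal.ofReal_sum_of_nonneg fun k _ =>
          mul_nonneg (zero_le_one.trans (one_le_orderConst _)) hT]

theorem measure_deviation_le (hcube : ∀ᵐ x ∂μ, ∀ i, x i ∈ Set.Icc (-1 : ℝ) 1)
    (h : DLSI μ ν σ2) (hσ : 0 < σ2) (hf : f ∈ tetra n (d + 1)) (j : ℕ) {t δ : ℝ} (ht : 0 < t)
    (hδ : 0 ≤ δ) (hδd : (∑ k ∈ Finset.range d, orderConst (k + 1)) * δ ≤ Real.exp (-2))
    (hp : ∀ k ∈ Finset.Icc 1 d, ∀ P : Finset (Finset (Fin k)), IsPartition P →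
      (4 * 2 ^ j) ^ P.card * (σ2 ^ k * partNorm P (fun idx => ∫ x, gradT k f x idx ∂μ) ^ 2) ≤
        δ * t ^ 2) :
    μ {x | t ≤ |f x - ∫ y, f y ∂μ|} ≤ ENNReal.ofReal (Real.exp (-(4 * 2 ^ j))) := by
  have hfc := tetra_continuous hf
  have hΛ : 0 ≤ ∑ k ∈ Finset.range d, orderConst (k + 1) :=
    Finset.sum_nonneg fun k _ => zero_le_one.trans (one_le_orderConst _)
  have hD := lintegral_deviation_le_of_partNorm hcube h hσ hf j
    (mul_nonneg hδ (sq_nonneg t)) hp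
  have hε : ENNReal.ofReal (t ^ (4 * 2 ^ j)) ≠ 0 := by
    rw [ne_eq, ENNReal.ofReal_eq_zero, not_le]
    positivity
  have hset : {x | t ≤ |f x - ∫ y, f y ∂μ|} ⊆
      {x | ENNReal.ofReal (t ^ (4 * 2 ^ j)) ≤ ‖f x - ∫ y, f y ∂μ‖ₑ ^ (4 * 2 ^ j)} := by
    intro x hx
    change t ≤ _ at hx
    change ENNReal.ofReal (t ^ (4 * 2 ^ j)) ≤ ‖f x - ∫ y, f y ∂μ‖ₑ ^ (4 * 2 ^ j)
    rw [Real.enorm_eq_ofReal_abs, ENNReal.ofReal_pow ht.le]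
    gcongr
  have hm : Measurable fun x => ‖f x - ∫ y, f y ∂μ‖ₑ ^ (4 * 2 ^ j) :=
    (measurable_enorm.comp (hfc.measurable.sub_const _)).pow_const _
  refine (measure_mono hset).trans ((meas_ge_le_lintegral_div hm.aemeasurable hε
    ENNReal.ofReal_ne_top).trans (ENNReal.div_le_of_le_mul (hD.trans ?_)))
  rw [← ENNReal.ofReal_mul (Real.exp_pos _).le, ← ENNReal.ofReal_pow]
  · refine ENNReal.ofReal_le_ofReal ?_
    calc _ ≤ (Real.exp (-2) * t ^ 2) ^ (2 * 2 ^ j) := by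
          rw [← mul_assoc]
          refine pow_le_pow_left₀ (mul_nonneg (mul_nonneg hΛ hδ) (sq_nonneg t)) ?_ _
          gcongr
      _ = _ := by
          rw [mul_pow, ← Real.exp_nat_mul, ← pow_mul]
          congr 2
          · push_cast
            ring
          · ring
  · exact mul_nonneg hΛ (by positivity)

end Concentration

/-- multilevel concentration for multilinear polynomials under a `𝔡`-LSI,
with constants given by the partition norms of Latała (Theorem `theorem:concentrationHLSI`). -/
theorem stmt10 (d : ℕ) (hd : 1 ≤ d) :
    ∃ C > (0 : ℝ), ∀ (n : ℕ) (a : (k : ℕ) → (Fin k → Fin n) → ℝ),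
      (∀ k (σ : Equiv.Perm (Fin k)) (idx : Fin k → Fin n), a k (idx ∘ σ) = a k idx) →
      (∀ k (idx : Fin k → Fin n), ¬Function.Injective idx → a k idx = 0) →
      ∀ (μ : Measure (Fin n → ℝ)), IsProbabilityMeasure μ →
      (∀ᵐ x ∂μ, ∀ i, x i ∈ Set.Icc (-1 : ℝ) 1) →
      ∀ (ν : ∀ i : Fin n, (Fin n → ℝ) → Measure ℝ) (σ2 : ℝ), 0 < σ2 → DLSI μ ν σ2 →
      ∀ t : ℝ, 0 ≤ t →
      μ {x | t ≤ |fd d a x - ∫ y, fd d a y ∂μ|} ≤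
        ENNReal.ofReal (2 * Real.exp (-(1 / C) * sInf
          {r : ℝ | ∃ k ∈ Finset.Icc 1 d, ∃ P : Finset (Finset (Fin k)), IsPartition P ∧
            r = (t / (σ2 ^ ((k : ℝ) / 2) *
                  partNorm P (fun idx => ∫ x, gradT k (fd d a) x idx ∂μ))) ^
                ((2 : ℝ) / P.card)})) := by
  classical
  set Λ := ∑ k ∈ Finset.range d, orderConst (k + 1) with hΛ
  have hΛ1 : 1 ≤ Λ := (one_le_orderConst (0 + 1)).trans
    (Finset.single_le_sum (f := fun k => orderConst (k + 1))
      (fun k _ => zero_le_one.trans (one_le_orderConst _)) (Finset.mem_range.2 hd))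
  have hΛ0 : 0 < Λ := by linarith
  set δ := Real.exp (-2) / Λ with hδ
  have hδ0 : 0 < δ := by positivity
  have hδ1 : δ ≤ 1 := by
    rw [hδ, div_le_one hΛ0]
    exact (Real.exp_le_one_iff.2 (by norm_num)).trans hΛ1
  refine ⟨8 / δ, by positivity, ?_⟩
  intro n a _ ha μ hμ hcube ν σ2 hσ h t ht
  set S := {r : ℝ | ∃ k ∈ Finset.Icc 1 d, ∃ P : Finset (Finset (Fin k)), IsPartition P ∧
    r = (t / (σ2 ^ ((k : ℝ) / 2) *
      partNorm P (fun idx => ∫ x, gradT k (fd d a) x idx ∂μ))) ^ ((2 : ℝ) / P.card)} with hS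
  have hP0 : ∀ k ∈ Finset.Icc 1 d, ∀ P : Finset (Finset (Fin k)), IsPartition P → P.Nonempty :=
    fun k hk P hP => hP.nonempty (Finset.mem_Icc.1 hk).1
  have hS0 : ∀ r ∈ S, 0 ≤ r := by
    rintro _ ⟨k, hk, P, hP, rfl⟩
    have := partNorm_nonneg P (hP0 k hk P hP) (fun idx => ∫ x, gradT k (fd d a) x idx ∂μ)
    positivity
  have hSle : ∀ r ∈ S, sInf S ≤ r := fun r hr => csInf_le ⟨0, hS0⟩ hr
  by_cases hlt : δ * sInf S < 4
  · refine prob_le_one.trans ?_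
    rw [← ENNReal.ofReal_one]
    refine ENNReal.ofReal_le_ofReal ?_
    have h1 : 1 / (8 / δ) * sInf S ≤ 1 / 2 := by
      rw [one_div_div]
      linarith
    have h2 := Real.add_one_le_exp (-(1 / (8 / δ) * sInf S))
    rw [neg_mul]
    linarith
  · rw [not_lt] at hlt
    have hpos : 0 < sInf S := pos_of_mul_pos_right (by linarith) hδ0.le
    obtain ⟨j, hj1, hj2⟩ := exists_nat_pow_near (x := δ * sInf S / 4) (y := (2 : ℝ))
      (by linarith) one_lt_two
    have ht0 : 0 < t := by
      refine ht.lt_of_ne' fun h0 => ?_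
      have hne : S.Nonempty := by
        by_contra hne
        rw [Set.not_nonempty_iff_eq_empty.1 hne, Real.sInf_empty] at hpos
        exact hpos.false
      obtain ⟨r, hr⟩ := hne
      have hrpos := hpos.trans_le (hSle r hr)
      obtain ⟨k, hk, P, hP, rfl⟩ := hr
      have := (hP0 k hk P hP).card_pos
      rw [h0, zero_div, Real.zero_rpow (by positivity)] at hrpos
      exact hrpos.false
    refine (measure_deviation_le hcube h hσ (fd_mem_tetra d a ha) j ht0 hδ0.le
      (le_of_eq (mul_div_cancel₀ _ hΛ0.ne')) ?_).trans (ENNReal.ofReal_le_ofReal ?_)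
    · intro k hk P hP
      have hN := partNorm_nonneg P (hP0 k hk P hP) (fun idx => ∫ x, gradT k (fd d a) x idx ∂μ)
      have hr := hSle _ ⟨k, hk, P, hP, rfl⟩
      set N := partNorm P (fun idx => ∫ x, gradT k (fd d a) x idx ∂μ) with hNdef
      have hc := (hP0 k hk P hP).card_pos
      rcases hN.eq_or_lt with hN0 | hN0
      · rw [← hN0, zero_pow two_ne_zero, mul_zero, mul_zero]
        positivity
      set y := t / (σ2 ^ ((k : ℝ) / 2) * N) with hy
      have hy0 : 0 < y := by positivity
      have hσk : (σ2 ^ ((k : ℝ) / 2)) ^ 2 = σ2 ^ k := by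
        rw [← Real.rpow_natCast, ← Real.rpow_mul hσ.le, ← Real.rpow_natCast]
        congr 1
        push_cast
        ring
      have hyp : (y ^ ((2 : ℝ) / P.card)) ^ P.card = y ^ 2 := by
        rw [← Real.rpow_natCast, ← Real.rpow_mul hy0.le, div_mul_cancel₀ _ (by positivity),
          ← Real.rpow_natCast]
        norm_num
      have h4 : (4 * 2 ^ j : ℝ) ≤ δ * y ^ ((2 : ℝ) / P.card) := by
        have := mul_le_mul_of_nonneg_left hr hδ0.le
        linarith
      calc (4 * 2 ^ j : ℝ) ^ P.card * (σ2 ^ k * N ^ 2)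
          ≤ (δ * y ^ ((2 : ℝ) / P.card)) ^ P.card * (σ2 ^ k * N ^ 2) := by gcongr
        _ = δ ^ P.card * (y ^ 2 * (σ2 ^ k * N ^ 2)) := by rw [mul_pow, hyp, mul_assoc]
        _ ≤ δ * (y ^ 2 * (σ2 ^ k * N ^ 2)) := by
          gcongr
          exact pow_le_of_le_one hδ0.le hδ1 hc.ne'
        _ = δ * t ^ 2 := by
          rw [hy, div_pow, mul_pow, hσk, div_mul_cancel₀ _ (by positivity)]
    · have h1 : -(4 * 2 ^ j : ℝ) ≤ -(1 / (8 / δ)) * sInf S := by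
        rw [one_div_div]
        rw [pow_succ] at hj2
        linarith
      linarith [Real.exp_le_exp.2 h1, Real.exp_pos (-(1 / (8 / δ)) * sInf S)]

end
end

section
/- Let X be an exponential random graph model on n vertices with parameter β = (β_1,…,β_s, G_1,…,G_s) satisfying (1/2) Φ'_{|β|}(1) < 1. Then there is a constant C(β) such that for all t ≥ 0, ℙ( |T_3(X) − 𝔼 T_3(X)| ≥ t ) ≤ 2 exp( −(1/C(β)) · min( t² / max(C_{S_2} n⁴, C_E n³, n³) , t / max(√(2n), 2 C_E n) , t^{2/3}/2 ) ). -/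
open MeasureTheory Finset Real

noncomputable section

/-- Edges of the complete graph on `m` vertices. -/
def Edge (m : ℕ) := {S : Finset (Fin m) // S.card = 2}

instance (m : ℕ) : Fintype (Edge m) := by unfold Edge; infer_instance
instance (m : ℕ) : DecidableEq (Edge m) := by unfold Edge; infer_instance

/-- Indicator of an edge being present. -/
def ind (b : Bool) : ℝ := if b then 1 else 0

/-- Number of embeddings of the graph `Gi` into the graph encoded by `x`. -/
def embCount {m vi : ℕ} (Gi : SimpleGraph (Fin vi)) (x : Edge m → Bool) : ℕ :=
  Nat.card {f : Fin vi ↪ Fin m // ∀ a b, (h : Gi.Adj a b) →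
    x ⟨{f a, f b}, Finset.card_pair (fun he => Gi.ne_of_adj h (f.injective he))⟩ = true}

/-- Number of copies of `Gi` in the graph encoded by `x` (embeddings divided by
automorphisms). -/
def copyCount {m vi : ℕ} (Gi : SimpleGraph (Fin vi)) (x : Edge m → Bool) : ℝ :=
  (embCount Gi x : ℝ) / (Nat.card (Gi ≃g Gi) : ℝ)

/-- Number of edges of a graph. -/
def edgeCard {vi : ℕ} (Gi : SimpleGraph (Fin vi)) : ℕ := Nat.card Gi.edgeSet

/-- The Hamiltonian of the exponential random graph model. -/
def ergmH {s : ℕ} (β : Fin s → ℝ) (v : Fin s → ℕ) (G : ∀ i, SimpleGraph (Fin (v i)))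
    {m : ℕ} (x : Edge m → Bool) : ℝ :=
  ∑ i, β i * (m : ℝ) ^ ((2 : ℝ) - (v i : ℝ)) * copyCount (G i) x

/-- The number of triangles `T₃`. -/
def T3 {m : ℕ} (x : Edge m → Bool) : ℝ :=
  ∑ S ∈ Finset.univ.filter (fun S : Finset (Fin m) => S.card = 3),
    ∏ e ∈ Finset.univ.filter (fun e : Edge m => e.1 ⊆ S), ind (x e)

namespace Glauber

set_option linter.unusedSectionVars false

variable {ι : Type*} [Fintype ι] [DecidableEq ι]

/-- Resample the coordinate `e` at `x` under the weight `exp ∘ H`. -/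
def heat (H : (ι → Bool) → ℝ) (e : ι) (g : (ι → Bool) → ℝ) (x : ι → Bool) : ℝ :=
  Real.sigmoid (H (Function.update x e true) - H (Function.update x e false)) *
      g (Function.update x e true) +
    (1 - Real.sigmoid (H (Function.update x e true) - H (Function.update x e false))) *
      g (Function.update x e false)

/-- All discrete derivatives of `g` are bounded by `L`. -/
def BddDiff (g : (ι → Bool) → ℝ) (L : ℝ) : Prop :=
  ∀ f x, |g (Function.update x f true) - g (Function.update x f false)| ≤ L

/-- One step of the random-scan Gibbs sampler. -/
def step (H : (ι → Bool) → ℝ) (g : (ι → Bool) → ℝ) (x : ι → Bool) : ℝ :=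
  (∑ e, heat H e g x) / Fintype.card ι

/-- Flip the coordinate `e`. -/
def flip (e : ι) (x : ι → Bool) : ι → Bool := Function.update x e (!x e)

lemma flip_flip (e : ι) (x : ι → Bool) : flip e (flip e x) = x := by
  simp [flip]

lemma abs_sigmoid_sub_le (a b : ℝ) : |sigmoid a - sigmoid b| ≤ |a - b| / 4 := by
  have := Convex.norm_image_sub_le_of_norm_deriv_le (f := sigmoid) (C := 1 / 4) (s := Set.univ)
    (x := b) (y := a) (fun x _ => differentiable_sigmoid x) (fun x _ => by
      rw [deriv_sigmoid, Real.norm_eq_abs, abs_of_nonneg]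
      · nlinarith [sq_nonneg (sigmoid x - 1 / 2)]
      · exact mul_nonneg (sigmoid_nonneg x) (by linarith [sigmoid_le_one x]))
    convex_univ (Set.mem_univ _) (Set.mem_univ _)
  simp only [Real.norm_eq_abs] at this
  linarith

lemma abs_heat_sub_le {H g : (ι → Bool) → ℝ} {L a : ℝ} (hg : BddDiff g L) (e f : ι) (hef : e ≠ f)
    (x : ι → Bool)
    (ha : |(H (Function.update (Function.update x f true) e true) -
        H (Function.update (Function.update x f true) e false)) -
      (H (Function.update (Function.update x f false) e true) -
        H (Function.update (Function.update x f false) e false))| ≤ a) :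
    |heat H e g (Function.update x f true) - heat H e g (Function.update x f false)| ≤
      L + a / 4 * L := by
  unfold heat
  have hp := (abs_sigmoid_sub_le _ _).trans (div_le_div_of_nonneg_right ha (by norm_num : (0:ℝ) ≤ 4))
  have h1 := hg f (Function.update x e true)
  have h0 := hg f (Function.update x e false)
  have h2 := hg e (Function.update x f false)
  rw [Function.update_comm hef, Function.update_comm hef] at h1 h0
  set p := sigmoid (H (Function.update (Function.update x f true) e true) -
        H (Function.update (Function.update x f true) e false))
  set q := sigmoid (H (Function.update (Function.update x f false) e true) -
        H (Function.update (Function.update x f false) e false))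
  have hp0 : 0 ≤ p := sigmoid_nonneg _
  have hp1 : p ≤ 1 := sigmoid_le_one _
  set A := g (Function.update (Function.update x f true) e true)
  set B := g (Function.update (Function.update x f true) e false)
  set C := g (Function.update (Function.update x f false) e true)
  set D := g (Function.update (Function.update x f false) e false)
  calc |p * A + (1 - p) * B - (q * C + (1 - q) * D)|
      = |p * (A - C) + (1 - p) * (B - D) + (p - q) * (C - D)| := by congr 1; ring
    _ ≤ |p * (A - C)| + |(1 - p) * (B - D)| + |(p - q) * (C - D)| := abs_add_three _ _ _
    _ = p * |A - C| + (1 - p) * |B - D| + |p - q| * |C - D| := by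
        rw [abs_mul, abs_mul, abs_mul, abs_of_nonneg hp0, abs_of_nonneg (sub_nonneg.2 hp1)]
    _ ≤ p * L + (1 - p) * L + a / 4 * L := by
        have := sub_nonneg.2 hp1
        have := (abs_nonneg _).trans hp
        gcongr
    _ = L + a / 4 * L := by ring

/-- Dobrushin-type condition on the mixed second differences of `H`. -/
def Dobrushin (H : (ι → Bool) → ℝ) (ρ : ℝ) : Prop :=
  ∃ A : ι → ι → ℝ, (∀ f e, e ≠ f → ∀ x,
    |(H (Function.update (Function.update x f true) e true) -
        H (Function.update (Function.update x f true) e false)) -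
      (H (Function.update (Function.update x f false) e true) -
        H (Function.update (Function.update x f false) e false))| ≤ A f e) ∧
    ∀ f, ∑ e ∈ univ.erase f, A f e ≤ 4 * ρ

lemma BddDiff.step {H g : (ι → Bool) → ℝ} {L ρ : ℝ} (hH : Dobrushin H ρ) (hL : 0 ≤ L)
    (hg : BddDiff g L) :
    BddDiff (step H g) ((1 - (1 - ρ) / Fintype.card ι) * L) := by
  obtain ⟨A, hA, hsum⟩ := hH
  intro f x
  have hN : (0 : ℝ) < Fintype.card ι := by exact_mod_cast Fintype.card_pos_iff.2 ⟨f⟩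
  unfold Glauber.step
  rw [← sub_div, abs_div, abs_of_pos hN, div_le_iff₀ hN, ← sum_sub_distrib]
  have hf : heat H f g (Function.update x f true) - heat H f g (Function.update x f false) = 0 := by
    simp [heat]
  rw [← add_sum_erase _ _ (mem_univ f), hf, zero_add]
  calc _ ≤ ∑ e ∈ univ.erase f, (L + A f e / 4 * L) :=
        (abs_sum_le_sum_abs _ _).trans (sum_le_sum fun e he =>
          abs_heat_sub_le hg e f (ne_of_mem_erase he) x (hA f e (ne_of_mem_erase he) x))
    _ = ((Fintype.card ι : ℝ) - 1) * L + (∑ e ∈ univ.erase f, A f e) / 4 * L := by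
        rw [sum_add_distrib, ← sum_mul, ← sum_div, sum_const, card_erase_of_mem (mem_univ f),
          nsmul_eq_mul, card_univ, Nat.cast_sub (Fintype.card_pos_iff.2 ⟨f⟩), Nat.cast_one]
    _ ≤ ((Fintype.card ι : ℝ) - 1) * L + (4 * ρ) / 4 * L := by gcongr; exact hsum f
    _ = _ := by field_simp; ring

lemma BddDiff.abs_sub_le_card_mul {g : (ι → Bool) → ℝ} {L : ℝ} (hg : BddDiff g L) (x y : ι → Bool) :
    |g x - g y| ≤ Fintype.card ι * L := by
  have key : ∀ s : Finset ι, |g (s.piecewise x y) - g y| ≤ #s * L := by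
    intro s
    induction s using Finset.induction_on with
    | empty => simp
    | insert a s ha ih =>
      have h : |g ((insert a s).piecewise x y) - g (s.piecewise x y)| ≤ L := by
        have h1 := hg a (s.piecewise x y)
        have h2 : Function.update (s.piecewise x y) a (y a) = s.piecewise x y :=
          Function.update_eq_self_iff.2 (by simp [ha])
        rw [piecewise_insert]
        nth_rw 2 [← h2]
        have hL := (abs_nonneg _).trans h1
        generalize s.piecewise x y = z at h1 hL ⊢
        cases x a <;> cases y a
        · simpa using hL
        · rwa [abs_sub_comm]
        · exact h1
        · simpa using hL
      rw [card_insert_of_notMem ha]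
      push_cast
      have := abs_sub_le (g ((insert a s).piecewise x y)) (g (s.piecewise x y)) (g y)
      linarith
  simpa using key univ

lemma BddDiff.abs_sub_flip_le {g : (ι → Bool) → ℝ} {L : ℝ} (hg : BddDiff g L) (e : ι)
    (x : ι → Bool) : |g x - g (flip e x)| ≤ L := by
  have h := hg e x
  have hx : x = Function.update x e (x e) := by simp
  unfold flip
  rw [abs_sub_comm] at h
  generalize hb : x e = b at *
  cases b
  · rw [← hx] at h; simpa using h
  · rw [← hx, abs_sub_comm] at h; simpa using h

/-- Conductance of the edge between `x` and its flip. -/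
def cond (H : (ι → Bool) → ℝ) (e : ι) (x : ι → Bool) : ℝ :=
  exp (H x) * exp (H (flip e x)) / (exp (H x) + exp (H (flip e x)))

lemma cond_flip (H : (ι → Bool) → ℝ) (e : ι) (x : ι → Bool) :
    cond H e (flip e x) = cond H e x := by
  unfold cond; rw [flip_flip, mul_comm, add_comm]

lemma cond_nonneg (H : (ι → Bool) → ℝ) (e : ι) (x : ι → Bool) : 0 ≤ cond H e x := by
  unfold cond; positivity

lemma cond_le (H : (ι → Bool) → ℝ) (e : ι) (x : ι → Bool) : cond H e x ≤ exp (H x) := by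
  unfold cond
  rw [div_le_iff₀ (by positivity)]
  nlinarith [exp_pos (H x)]

lemma exp_mul_sub_heat (H g : (ι → Bool) → ℝ) (e : ι) (x : ι → Bool) :
    exp (H x) * (g x - heat H e g x) = cond H e x * (g x - g (flip e x)) := by
  have hs : ∀ a b : ℝ, sigmoid (a - b) = exp a / (exp a + exp b) := by
    intro a b
    rw [sigmoid_def, neg_sub, exp_sub]
    field_simp
  have hx : x = Function.update x e (x e) := by simp
  unfold heat cond flip
  rw [hs]
  generalize hb : x e = b at *
  cases b
  · rw [← hx]; simp only [Bool.not_false]; field_simp; ring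
  · rw [← hx]; simp only [Bool.not_true]; field_simp; ring

lemma sum_flip (e : ι) (u : (ι → Bool) → ℝ) : ∑ x, u (flip e x) = ∑ x, u x :=
  Equiv.sum_comp (Function.Involutive.toPerm (flip e) (flip_flip e)) u

lemma two_mul_sum_sub_heat (H g h : (ι → Bool) → ℝ) (e : ι) :
    2 * ∑ x, exp (H x) * (g x - heat H e g x) * h x =
      ∑ x, cond H e x * (g x - g (flip e x)) * (h x - h (flip e x)) := by
  simp only [exp_mul_sub_heat]
  rw [two_mul]
  nth_rw 2 [← sum_flip e]
  rw [← sum_add_distrib]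
  refine sum_congr rfl fun x _ => ?_
  rw [flip_flip, cond_flip]
  ring

lemma abs_exp_sub_le (a b : ℝ) : |exp a - exp b| ≤ |a - b| * (exp a + exp b) := by
  wlog h : b ≤ a generalizing a b
  · rw [abs_sub_comm, abs_sub_comm a b, add_comm]; exact this b a (le_of_not_ge h)
  rw [abs_of_nonneg (sub_nonneg.2 (exp_le_exp.2 h)), abs_of_nonneg (sub_nonneg.2 h)]
  have h1 := add_one_le_exp (b - a)
  have h2 : exp b = exp a * exp (b - a) := by rw [← exp_add]; ring_nf
  have : 0 ≤ (a - b) * exp b := mul_nonneg (sub_nonneg.2 h) (exp_pos _).le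
  nlinarith [exp_pos a]

lemma sum_sub_heat_le {H g f : (ι → Bool) → ℝ} {K L θ : ℝ} (hg : BddDiff g K) (hf : BddDiff f L)
    (hθ : 0 ≤ θ) (hK : 0 ≤ K) (hL : 0 ≤ L) (e : ι) :
    ∑ x, exp (H x) * (g x - heat H e g x) * exp (θ * f x) ≤
      K * L * θ * ∑ x, exp (H x) * exp (θ * f x) := by
  have h1 := two_mul_sum_sub_heat H g (fun x => exp (θ * f x)) e
  have h2 : ∑ x, cond H e x * (g x - g (flip e x)) *
        (exp (θ * f x) - exp (θ * f (flip e x))) ≤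
      ∑ x, (K * L * θ) * (cond H e x * exp (θ * f x) +
        cond H e (flip e x) * exp (θ * f (flip e x))) := by
    refine sum_le_sum fun x _ => (le_abs_self _).trans ?_
    rw [abs_mul, abs_mul, abs_of_nonneg (cond_nonneg H e x), cond_flip]
    have h3 := abs_exp_sub_le (θ * f x) (θ * f (flip e x))
    rw [← mul_sub, abs_mul, abs_of_nonneg hθ] at h3
    have h4 := hg.abs_sub_flip_le e x
    have h5 := hf.abs_sub_flip_le e x
    have := cond_nonneg H e x
    calc _ ≤ cond H e x * K * (θ * L * (exp (θ * f x) + exp (θ * f (flip e x)))) := by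
          gcongr
          exact h3.trans (by gcongr)
      _ = _ := by ring
  rw [← mul_sum, sum_add_distrib, sum_flip e (fun x => cond H e x * exp (θ * f x))] at h2
  have h6 : ∑ x, cond H e x * exp (θ * f x) ≤ ∑ x, exp (H x) * exp (θ * f x) :=
    sum_le_sum fun x _ => by gcongr; exact cond_le H e x
  have h7 := mul_le_mul_of_nonneg_left h6 (by positivity : 0 ≤ K * L * θ)
  linarith

lemma sum_sub_step_le {H g f : (ι → Bool) → ℝ} {K L θ : ℝ} (hg : BddDiff g K) (hf : BddDiff f L)
    (hθ : 0 ≤ θ) (hK : 0 ≤ K) (hL : 0 ≤ L) [Nonempty ι] :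
    ∑ x, exp (H x) * (g x - step H g x) * exp (θ * f x) ≤
      K * L * θ * ∑ x, exp (H x) * exp (θ * f x) := by
  have hN : (0 : ℝ) < Fintype.card ι := by exact_mod_cast Fintype.card_pos
  have h1 : ∀ x, exp (H x) * (g x - step H g x) * exp (θ * f x) =
      (∑ e, exp (H x) * (g x - heat H e g x) * exp (θ * f x)) / Fintype.card ι := by
    intro x
    rw [← sum_mul, ← mul_sum, sum_sub_distrib, sum_const, card_univ, nsmul_eq_mul, step]
    field_simp
  simp only [h1]
  rw [← sum_div, sum_comm, div_le_iff₀ hN]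
  refine (sum_le_sum fun e _ => sum_sub_heat_le hg hf hθ hK hL e).trans ?_
  rw [sum_const, card_univ, nsmul_eq_mul, mul_comm]

lemma sum_exp_mul_step [Nonempty ι] (H g : (ι → Bool) → ℝ) :
    ∑ x, exp (H x) * step H g x = ∑ x, exp (H x) * g x := by
  have hN : (0 : ℝ) < Fintype.card ι := by exact_mod_cast Fintype.card_pos
  have h : ∀ e, ∑ x, exp (H x) * heat H e g x = ∑ x, exp (H x) * g x := by
    intro e
    have := two_mul_sum_sub_heat H g (fun _ => 1) e
    simp only [sub_self, mul_zero, sum_const_zero, mul_one, mul_sub, sum_sub_distrib] at this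
    linarith
  simp only [step, ← mul_div_assoc, mul_sum]
  rw [← sum_div, sum_comm]
  simp only [h, sum_const, card_univ, nsmul_eq_mul]
  field_simp

lemma BddDiff.iterate_step {H f : (ι → Bool) → ℝ} {L ρ : ℝ} (hH : Dobrushin H ρ) (hL : 0 ≤ L)
    (hr : 0 ≤ 1 - (1 - ρ) / Fintype.card ι) (hf : BddDiff f L) (k : ℕ) :
    BddDiff ((Glauber.step H)^[k] f) ((1 - (1 - ρ) / Fintype.card ι) ^ k * L) := by
  induction k with
  | zero => simpa using hf
  | succ k ih =>
    rw [Function.iterate_succ_apply', pow_succ', mul_assoc]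
    exact ih.step hH (by positivity)

lemma sum_exp_mul_iterate_step [Nonempty ι] (H f : (ι → Bool) → ℝ) (k : ℕ) :
    ∑ x, exp (H x) * (step H)^[k] f x = ∑ x, exp (H x) * f x := by
  induction k with
  | zero => rfl
  | succ k ih => rw [Function.iterate_succ_apply', sum_exp_mul_step, ih]

/-- Derivative bound for the moment generating function of a centred function. -/
lemma sum_mul_exp_le [Nonempty ι] {H f : (ι → Bool) → ℝ} {L ρ θ : ℝ} (hH : Dobrushin H ρ)
    (hρ0 : 0 ≤ ρ) (hρ1 : ρ < 1) (hL : 0 ≤ L) (hf : BddDiff f L) (hθ : 0 ≤ θ)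
    (hmean : ∑ x, exp (H x) * f x = 0) :
    ∑ x, exp (H x) * f x * exp (θ * f x) ≤
      L ^ 2 * Fintype.card ι / (1 - ρ) * θ * ∑ x, exp (H x) * exp (θ * f x) := by
  have hN : (1 : ℝ) ≤ Fintype.card ι := by exact_mod_cast Fintype.card_pos (α := ι)
  set N : ℝ := (Fintype.card ι : ℝ) with hNdef
  set r : ℝ := 1 - (1 - ρ) / N with hrdef
  set m := ∑ x, exp (H x) * exp (θ * f x) with hm
  have hm0 : 0 ≤ m := by positivity
  have hq : (1 - ρ) / N ≤ 1 := by rw [div_le_one (by linarith)]; linarith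
  have hq0 : 0 < (1 - ρ) / N := div_pos (by linarith) (by linarith)
  have hr0 : 0 ≤ r := by linarith
  have hr1 : r < 1 := by linarith
  have hit := fun k => hf.iterate_step hH hL hr0 k
  have hbound : ∀ k x, |(step H)^[k] f x| ≤ N * (r ^ k * L) := by
    intro k x
    have hZ : 0 < ∑ y : ι → Bool, exp (H y) := sum_pos (fun y _ => exp_pos _) univ_nonempty
    have h0 := sum_exp_mul_iterate_step H f k
    rw [hmean] at h0
    have h1 : (∑ y, exp (H y)) * (step H)^[k] f x =
        ∑ y, exp (H y) * ((step H)^[k] f x - (step H)^[k] f y) := by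
      simp only [mul_sub, sum_sub_distrib, h0, sum_mul, sub_zero]
    have h2 : (∑ y, exp (H y)) * |(step H)^[k] f x| ≤ (∑ y, exp (H y)) * (N * (r ^ k * L)) := by
      rw [← abs_of_pos hZ, ← abs_mul, abs_of_pos hZ, h1, sum_mul]
      refine (abs_sum_le_sum_abs _ _).trans (sum_le_sum fun y _ => ?_)
      rw [abs_mul, abs_of_pos (exp_pos _)]
      gcongr
      exact (hit k).abs_sub_le_card_mul x y
    exact le_of_mul_le_mul_left h2 hZ
  have hfin : ∀ k : ℕ, ∑ x, exp (H x) * f x * exp (θ * f x) ≤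
      L ^ 2 * N / (1 - ρ) * θ * m + N * (r ^ k * L) * m := by
    intro k
    have hdecomp : ∀ x, f x = (∑ j ∈ range k, ((step H)^[j] f x - (step H)^[j + 1] f x)) +
        (step H)^[k] f x := by
      intro x
      rw [sum_range_sub' (fun j => (step H)^[j] f x)]
      simp
    have hsplit : ∑ x, exp (H x) * f x * exp (θ * f x) =
        (∑ j ∈ range k, ∑ x, exp (H x) * ((step H)^[j] f x - step H ((step H)^[j] f) x) *
          exp (θ * f x)) + ∑ x, (step H)^[k] f x * (exp (H x) * exp (θ * f x)) := by
      rw [sum_comm, ← sum_add_distrib]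
      refine sum_congr rfl fun x _ => ?_
      simp only [← Function.iterate_succ_apply' (step H)]
      rw [← sum_mul, ← mul_sum]
      nth_rw 1 [hdecomp x]
      ring
    rw [hsplit]
    gcongr ?_ + ?_
    · calc _ ≤ ∑ j ∈ range k, r ^ j * L * L * θ * m :=
            sum_le_sum fun j _ => sum_sub_step_le (hit j) hf hθ (by positivity) hL
        _ = (∑ j ∈ range k, r ^ j) * (L ^ 2 * θ * m) := by
            rw [sum_mul]; exact sum_congr rfl fun j _ => by ring
        _ ≤ (1 - r)⁻¹ * (L ^ 2 * θ * m) := by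
            gcongr
            rw [← tsum_geometric_of_lt_one hr0 hr1]
            exact (summable_geometric_of_lt_one hr0 hr1).sum_le_tsum _ (fun _ _ => by positivity)
        _ = _ := by
            rw [hrdef, sub_sub_cancel, inv_div]; ring
    · rw [hm, mul_sum]
      refine sum_le_sum fun x _ => ?_
      gcongr
      exact (le_abs_self _).trans (hbound k x)
  have hlim : Filter.Tendsto (fun k : ℕ => L ^ 2 * N / (1 - ρ) * θ * m + N * (r ^ k * L) * m)
      Filter.atTop (nhds (L ^ 2 * N / (1 - ρ) * θ * m + N * (0 * L) * m)) :=
    ((((tendsto_pow_atTop_nhds_zero_of_lt_one hr0 hr1).mul_const L).const_mul N).mul_const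
      m).const_add _
  have := ge_of_tendsto' hlim hfin
  simpa using this

/-- Sub-Gaussian bound for the moment generating function. -/
lemma sum_exp_le [Nonempty ι] {H f : (ι → Bool) → ℝ} {L ρ θ : ℝ} (hH : Dobrushin H ρ)
    (hρ0 : 0 ≤ ρ) (hρ1 : ρ < 1) (hL : 0 ≤ L) (hf : BddDiff f L) (hθ : 0 ≤ θ)
    (hmean : ∑ x, exp (H x) * f x = 0) :
    ∑ x, exp (H x) * exp (θ * f x) ≤
      (∑ x, exp (H x)) * exp (L ^ 2 * Fintype.card ι / (1 - ρ) * θ ^ 2 / 2) := by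
  set V : ℝ := L ^ 2 * Fintype.card ι / (1 - ρ) with hV
  set h : ℝ → ℝ := fun θ => (∑ x, exp (H x) * exp (θ * f x)) * exp (-(V * θ ^ 2 / 2)) with hh
  have hder : ∀ θ : ℝ, HasDerivAt h
      ((∑ x, exp (H x) * f x * exp (θ * f x)) * exp (-(V * θ ^ 2 / 2)) +
        (∑ x, exp (H x) * exp (θ * f x)) * (exp (-(V * θ ^ 2 / 2)) * (-(V * θ)))) θ := by
    intro θ
    have h1 : HasDerivAt (fun θ : ℝ => ∑ x, exp (H x) * exp (θ * f x))
        (∑ x, exp (H x) * f x * exp (θ * f x)) θ := by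
      refine HasDerivAt.fun_sum fun x _ => ?_
      have := (hasDerivAt_mul_const (x := θ) (f x)).exp.const_mul (exp (H x))
      rwa [mul_comm (exp (θ * f x)), ← mul_assoc] at this
    have h2 : HasDerivAt (fun θ : ℝ => exp (-(V * θ ^ 2 / 2)))
        (exp (-(V * θ ^ 2 / 2)) * (-(V * θ))) θ := by
      have := ((((hasDerivAt_pow 2 θ).const_mul V).div_const 2).fun_neg).exp
      convert this using 1
      push_cast; ring
    exact h1.mul h2
  have hanti : AntitoneOn h (Set.Ici 0) := by
    refine antitoneOn_of_deriv_nonpos (convex_Ici 0)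
      (fun θ _ => (hder θ).continuousAt.continuousWithinAt)
      (fun θ _ => (hder θ).differentiableAt.differentiableWithinAt) fun θ hθ' => ?_
    rw [interior_Ici, Set.mem_Ioi] at hθ'
    rw [(hder θ).deriv]
    have := sum_mul_exp_le hH hρ0 hρ1 hL hf hθ'.le hmean
    rw [← hV] at this
    have := mul_le_mul_of_nonneg_right this (exp_pos (-(V * θ ^ 2 / 2))).le
    linarith
  have := hanti (Set.mem_Ici.2 le_rfl) (Set.mem_Ici.2 hθ) hθ
  simp only [hh, exp_neg] at this
  simp only [zero_mul, exp_zero, mul_one] at this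
  rw [← div_eq_mul_inv, div_le_iff₀ (exp_pos _)] at this
  simpa using this

/-- One-sided Chernoff bound, in terms of weights. -/
lemma sum_filter_le [Nonempty ι] {H f : (ι → Bool) → ℝ} {L ρ t : ℝ} (hH : Dobrushin H ρ)
    (hρ0 : 0 ≤ ρ) (hρ1 : ρ < 1) (hL : 0 < L) (hf : BddDiff f L) (ht : 0 ≤ t)
    (hmean : ∑ x, exp (H x) * f x = 0) :
    ∑ x with t ≤ f x, exp (H x) ≤
      (∑ x, exp (H x)) * exp (-((1 - ρ) * t ^ 2 / (2 * (L ^ 2 * Fintype.card ι)))) := by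
  have hN : (0 : ℝ) < Fintype.card ι := by exact_mod_cast Fintype.card_pos (α := ι)
  have h1 : (0:ℝ) < 1 - ρ := by linarith
  set V : ℝ := L ^ 2 * Fintype.card ι / (1 - ρ) with hV
  have hV0 : 0 < V := by positivity
  have h := sum_exp_le hH hρ0 hρ1 hL.le hf (θ := t / V) (by positivity) hmean
  have h2 : (∑ x with t ≤ f x, exp (H x)) * exp (t / V * t) ≤
      ∑ x, exp (H x) * exp (t / V * f x) := by
    rw [sum_mul]
    refine (sum_le_sum (g := fun x => exp (H x) * exp (t / V * f x)) fun x hx => ?_).trans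
      (sum_le_sum_of_subset_of_nonneg (filter_subset _ _) fun x _ _ => by positivity)
    have := (mem_filter.1 hx).2
    gcongr
  have h3 := h2.trans h
  rw [← le_div_iff₀ (exp_pos _), mul_div_assoc, ← exp_sub] at h3
  refine h3.trans_eq ?_
  congr 2
  rw [← hV, show V * (t / V) ^ 2 / 2 - t / V * t = - (t ^ 2 / (2 * V)) by field_simp; ring, hV]
  field_simp

lemma BddDiff.neg {f : (ι → Bool) → ℝ} {L : ℝ} (hf : BddDiff f L) :
    BddDiff (fun x => - f x) L := by
  intro e x
  rw [neg_sub_neg, abs_sub_comm]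
  exact hf e x

lemma integral_eq_sum {H : (ι → Bool) → ℝ} (μ : MeasureTheory.Measure (ι → Bool))
    [MeasureTheory.IsProbabilityMeasure μ]
    (hμ : ∀ x, μ {x} = ENNReal.ofReal (exp (H x) / ∑ y, exp (H y))) (f : (ι → Bool) → ℝ) :
    ∫ x, f x ∂μ = (∑ x, exp (H x) * f x) / ∑ y, exp (H y) := by
  rw [MeasureTheory.integral_fintype (MeasureTheory.Integrable.of_finite), sum_div]
  refine sum_congr rfl fun x _ => ?_
  rw [MeasureTheory.measureReal_def, hμ, ENNReal.toReal_ofReal (by positivity), smul_eq_mul,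
    div_mul_eq_mul_div]

/-- Bounded-difference inequality for Gibbs measures in the Dobrushin regime. -/
lemma measure_abs_sub_integral_ge_le [Nonempty ι] {H f : (ι → Bool) → ℝ} {L ρ t : ℝ}
    (hH : Dobrushin H ρ) (hρ0 : 0 ≤ ρ) (hρ1 : ρ < 1) (hL : 0 < L) (hf : BddDiff f L) (ht : 0 ≤ t)
    (μ : MeasureTheory.Measure (ι → Bool)) [MeasureTheory.IsProbabilityMeasure μ]
    (hμ : ∀ x, μ {x} = ENNReal.ofReal (exp (H x) / ∑ y, exp (H y))) :
    μ {x | t ≤ |f x - ∫ y, f y ∂μ|} ≤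
      ENNReal.ofReal (2 * exp (-((1 - ρ) * t ^ 2 / (2 * (L ^ 2 * Fintype.card ι))))) := by
  have hZ : 0 < ∑ y : ι → Bool, exp (H y) := sum_pos (fun y _ => exp_pos _) univ_nonempty
  set c := ∫ y, f y ∂μ with hc
  have hmean : ∑ x, exp (H x) * (f x - c) = 0 := by
    have := integral_eq_sum μ hμ f
    rw [← hc, eq_div_iff hZ.ne'] at this
    simp only [mul_sub, sum_sub_distrib, ← sum_mul]
    linarith
  have hfc : BddDiff (fun x => f x - c) L := fun e x => by simpa using hf e x
  have hmean' : ∑ x, exp (H x) * (-(f x - c)) = 0 := by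
    simpa only [mul_neg, sum_neg_distrib, neg_eq_zero] using hmean
  have tail : ∀ g : (ι → Bool) → ℝ, BddDiff g L → ∑ x, exp (H x) * g x = 0 →
      μ {x | t ≤ g x} ≤
        ENNReal.ofReal (exp (-((1 - ρ) * t ^ 2 / (2 * (L ^ 2 * Fintype.card ι))))) := by
    intro g hg hg0
    have h1 : {x | t ≤ g x} = (↑(univ.filter fun x => t ≤ g x) : Set (ι → Bool)) := by simp
    rw [h1, ← MeasureTheory.sum_measure_singleton]
    simp only [hμ]
    rw [← ENNReal.ofReal_sum_of_nonneg (fun x _ => by positivity), ← sum_div]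
    refine ENNReal.ofReal_le_ofReal ?_
    rw [div_le_iff₀' hZ]
    exact sum_filter_le hH hρ0 hρ1 hL hg ht hg0
  rw [two_mul, ENNReal.ofReal_add (exp_pos _).le (exp_pos _).le]
  refine (MeasureTheory.measure_mono fun x hx => ?_).trans
    ((MeasureTheory.measure_union_le _ _).trans
      (add_le_add (tail _ hfc hmean) (tail _ hfc.neg hmean')))
  exact le_abs.1 (Set.mem_ofPred.1 hx)

/-- Forcing a coordinate to be `true` costs at most a constant factor. -/
lemma sum_exp_mul_le {H h : (ι → Bool) → ℝ} {M : ℝ} (hM : BddDiff H M) (e : ι)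
    (h0 : ∀ x, 0 ≤ h x) (hflip : ∀ x, h (flip e x) = h x) :
    ∑ x, exp (H x) * h x ≤
      (1 + exp M) * ∑ x, exp (H x) * (h x * if x e then 1 else 0) := by
  have h1 : ∑ x, exp (H x) * (h x * if x e then 0 else 1) ≤
      ∑ x, exp M * (exp (H (flip e x)) * (h (flip e x) * if flip e x e then 1 else 0)) := by
    refine sum_le_sum fun x _ => ?_
    have h2 : exp (H x) ≤ exp M * exp (H (flip e x)) := by
      rw [← exp_add]
      have := (le_abs_self _).trans (hM.abs_sub_flip_le e x)
      gcongr
      linarith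
    rw [hflip]
    have := h0 x
    cases hx : x e
    · simpa [flip, hx, ← mul_assoc] using mul_le_mul_of_nonneg_right h2 this
    · simp [flip, hx]
  rw [sum_flip e (fun x => exp M * (exp (H x) * (h x * if x e then 1 else 0))), ← mul_sum] at h1
  have h3 : ∑ x, exp (H x) * h x = ∑ x, exp (H x) * (h x * if x e then 1 else 0) +
      ∑ x, exp (H x) * (h x * if x e then 0 else 1) := by
    rw [← sum_add_distrib]
    refine sum_congr rfl fun x _ => ?_
    split_ifs <;> ring
  linarith

lemma le_integral_mul {H : (ι → Bool) → ℝ} {M : ℝ} (hM : BddDiff H M) {e f : ι} (hef : e ≠ f)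
    (μ : MeasureTheory.Measure (ι → Bool)) [MeasureTheory.IsProbabilityMeasure μ]
    (hμ : ∀ x, μ {x} = ENNReal.ofReal (exp (H x) / ∑ y, exp (H y))) :
    ((1 + exp M) ^ 2)⁻¹ ≤ ∫ x, (if x e then 1 else 0) * (if x f then 1 else 0) ∂μ := by
  have hZ : 0 < ∑ y : ι → Bool, exp (H y) := sum_pos (fun y _ => exp_pos _) univ_nonempty
  rw [integral_eq_sum μ hμ, inv_le_iff_one_le_mul₀' (by positivity), ← mul_div_assoc,
    one_le_div hZ]
  have h1 := sum_exp_mul_le hM e (h := fun _ => 1) (fun _ => zero_le_one) (fun _ => rfl)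
  have h2 := sum_exp_mul_le hM f (h := fun x => if x e then 1 else 0)
    (fun x => by positivity) (fun x => by simp [flip, hef])
  simp only [mul_one, one_mul] at h1 h2
  calc _ ≤ _ := h1
    _ ≤ _ := mul_le_mul_of_nonneg_left h2 (by positivity)
    _ = _ := by ring

end Glauber

namespace Glauber

/-- Indicator that all coordinates in `S` are `true`. -/
def allOn {ι : Type*} (S : Finset ι) (x : ι → Bool) : ℝ := if ∀ e ∈ S, x e = true then 1 else 0

variable {ι : Type*} [DecidableEq ι]

lemma allOn_update_false {S : Finset ι} {e : ι} (he : e ∈ S) (x : ι → Bool) :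
    allOn S (Function.update x e false) = 0 :=
  if_neg fun h => by simpa using h e he

lemma allOn_update_of_notMem {S : Finset ι} {e : ι} (he : e ∉ S) (x : ι → Bool) (b : Bool) :
    allOn S (Function.update x e b) = allOn S x := by
  unfold allOn
  congr 1
  refine propext (forall₂_congr fun a ha => ?_)
  rw [Function.update_of_ne (ne_of_mem_of_not_mem ha he)]

lemma abs_allOn_le (S : Finset ι) (x : ι → Bool) : |allOn S x| ≤ 1 := by
  unfold allOn; split_ifs <;> simp

lemma abs_allOn_sub_le (S : Finset ι) (e : ι) (x : ι → Bool) :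
    |allOn S (Function.update x e true) - allOn S (Function.update x e false)| ≤
      if e ∈ S then 1 else 0 := by
  split_ifs with he
  · rw [allOn_update_false he, sub_zero]
    exact abs_allOn_le _ _
  · simp [allOn_update_of_notMem he]

lemma abs_allOn_sub_sub_le (S : Finset ι) {e f : ι} (hef : e ≠ f) (x : ι → Bool) :
    |(allOn S (Function.update (Function.update x f true) e true) -
        allOn S (Function.update (Function.update x f true) e false)) -
      (allOn S (Function.update (Function.update x f false) e true) -
        allOn S (Function.update (Function.update x f false) e false))| ≤
      if e ∈ S ∧ f ∈ S then 1 else 0 := by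
  split_ifs with h
  · have hcomm : Function.update (Function.update x f false) e true =
        Function.update (Function.update x e true) f false :=
      Function.update_comm hef.symm _ _ _
    rw [allOn_update_false h.1, allOn_update_false h.1, hcomm, allOn_update_false h.2]
    simpa using abs_allOn_le _ _
  · by_cases he : e ∈ S
    · have hf : f ∉ S := fun hf => h ⟨he, hf⟩
      simp only [Function.update_comm hef.symm, allOn_update_of_notMem hf, sub_self, abs_zero,
        le_refl]
    · simp [allOn_update_of_notMem he]

end Glauber

open scoped Classical in
/-- Edges of the image of `Gi` under the embedding `φ`. -/
def imgEdges {m vi : ℕ} (Gi : SimpleGraph (Fin vi)) (φ : Fin vi ↪ Fin m) : Finset (Edge m) :=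
  univ.filter fun e => ∃ a b, Gi.Adj a b ∧ e.1 = {φ a, φ b}

lemma mem_imgEdges {m vi : ℕ} {Gi : SimpleGraph (Fin vi)} {φ : Fin vi ↪ Fin m} {e : Edge m} :
    e ∈ imgEdges Gi φ ↔ ∃ a b, Gi.Adj a b ∧ e.1 = {φ a, φ b} := by
  simp [imgEdges]

lemma embCount_eq_sum {m vi : ℕ} (Gi : SimpleGraph (Fin vi)) (x : Edge m → Bool) :
    (embCount Gi x : ℝ) = ∑ φ : Fin vi ↪ Fin m, Glauber.allOn (imgEdges Gi φ) x := by
  classical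
  unfold embCount Glauber.allOn
  rw [Nat.card_eq_fintype_card, Fintype.card_subtype, ← sum_boole]
  refine sum_congr rfl fun φ _ => ?_
  congr 1
  refine propext ⟨fun h e he => ?_, fun h a b hab => h _ (mem_imgEdges.2 ⟨a, b, hab, rfl⟩)⟩
  obtain ⟨a, b, hab, hee⟩ := mem_imgEdges.1 he
  rw [← h a b hab]
  exact congrArg x (Subtype.ext hee)

lemma card_imgEdges_le {m vi : ℕ} (Gi : SimpleGraph (Fin vi)) (φ : Fin vi ↪ Fin m) :
    #(imgEdges Gi φ) ≤ edgeCard Gi := by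
  classical
  unfold edgeCard
  rw [Nat.card_eq_fintype_card, ← Fintype.card_coe]
  have h : ∀ e : imgEdges Gi φ, ∃ p : Gi.edgeSet, ∃ a b, p.1 = s(a, b) ∧ e.1.1 = {φ a, φ b} := by
    intro e
    obtain ⟨a, b, hab, he⟩ := mem_imgEdges.1 e.2
    exact ⟨⟨s(a, b), hab⟩, a, b, rfl, he⟩
  choose p hp using h
  refine Fintype.card_le_of_injective p fun e e' hee => ?_
  obtain ⟨a, b, h1, h2⟩ := hp e
  obtain ⟨a', b', h1', h2'⟩ := hp e'
  rw [hee, h1', Sym2.eq_iff] at h1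
  refine Subtype.ext (Subtype.ext ?_)
  rw [h2, h2']
  rcases h1 with ⟨rfl, rfl⟩ | ⟨rfl, rfl⟩
  · rfl
  · exact pair_comm _ _

open scoped Classical in
lemma card_embedding_fixing_pair_le {m vi : ℕ} {a b : Fin vi} (hab : a ≠ b) (u w : Fin m) :
    #{φ : Fin vi ↪ Fin m | φ a = u ∧ φ b = w} ≤ m ^ (vi - 2) := by
  have hcard : Fintype.card {c : Fin vi // c ∉ ({a, b} : Finset (Fin vi))} = vi - 2 := by
    rw [Fintype.card_subtype, ← compl_filter, card_compl]
    have : #{x | x = a ∨ x = b} = 2 := by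
      rw [← card_pair hab]; congr 1; ext; simp
    simp [this]
  have : m ^ (vi - 2) =
      #(univ : Finset ({c : Fin vi // c ∉ ({a, b} : Finset (Fin vi))} → Fin m)) := by
    rw [card_univ, Fintype.card_fun, hcard, Fintype.card_fin]
  rw [this]
  refine card_le_card_of_injOn (fun φ c => φ c.1) (fun _ _ => mem_coe.2 (mem_univ _)) ?_
  intro φ hφ ψ hψ h
  simp only [coe_filter, mem_univ, true_and, Set.mem_ofPred_eq] at hφ hψ
  ext c
  by_cases hc : c ∈ ({a, b} : Finset (Fin vi))
  · rcases mem_insert.1 hc with rfl | hc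
    · rw [hφ.1, hψ.1]
    · rw [mem_singleton.1 hc, hφ.2, hψ.2]
  · exact congrArg _ (congrFun h ⟨c, hc⟩)

open scoped Classical in
lemma card_mem_imgEdges_le {m vi : ℕ} (Gi : SimpleGraph (Fin vi)) (f : Edge m) :
    #{φ : Fin vi ↪ Fin m | f ∈ imgEdges Gi φ} ≤ 2 * edgeCard Gi * m ^ (vi - 2) := by
  obtain ⟨u, w, huw, hf⟩ := card_eq_two.1 f.2
  have hsub : ({φ : Fin vi ↪ Fin m | f ∈ imgEdges Gi φ} : Finset _) ⊆
      (univ : Finset Gi.Dart).biUnion fun d => {φ | φ d.fst = u ∧ φ d.snd = w} := by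
    intro φ hφ
    obtain ⟨a, b, hab, he⟩ := mem_imgEdges.1 (mem_filter.1 hφ).2
    rw [hf] at he
    have he' : s(u, w) = s(φ a, φ b) := by
      have := congrArg (fun s : Finset (Fin m) => (s : Set (Fin m))) he
      simp only [coe_insert, coe_singleton, Set.pair_eq_pair_iff] at this
      exact Sym2.eq_iff.2 this
    simp only [mem_biUnion, mem_univ, true_and, mem_filter]
    rcases Sym2.eq_iff.1 he' with ⟨h1, h2⟩ | ⟨h1, h2⟩
    · exact ⟨⟨(a, b), hab⟩, h1.symm, h2.symm⟩
    · exact ⟨⟨(b, a), hab.symm⟩, h1.symm, h2.symm⟩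
  refine (card_le_card hsub).trans ((card_biUnion_le_card_mul _ _ _ fun d _ =>
    card_embedding_fixing_pair_le d.adj.ne u w).trans_eq ?_)
  rw [card_univ, SimpleGraph.dart_card_eq_twice_card_edges, edgeCard, Nat.card_eq_fintype_card,
    SimpleGraph.edgeFinset_card]

lemma two_le_of_edgeCard_ne_zero {vi : ℕ} {Gi : SimpleGraph (Fin vi)} (h : edgeCard Gi ≠ 0) :
    2 ≤ vi := by
  obtain ⟨⟨p, hp⟩⟩ := (Nat.card_ne_zero.1 h).1
  induction p using Sym2.ind with
  | _ a b =>
    have := (Gi.mem_edgeSet.1 hp).ne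
    by_contra! hlt
    exact this (Fin.ext (by omega))

/-- Coefficient of the embedding indicators in the Hamiltonian. -/
def coef (m : ℕ) {vi : ℕ} (b : ℝ) (Gi : SimpleGraph (Fin vi)) : ℝ :=
  b * (m : ℝ) ^ ((2 : ℝ) - (vi : ℝ)) / (Nat.card (Gi ≃g Gi) : ℝ)

lemma ergmH_eq_sum {s : ℕ} (β : Fin s → ℝ) (v : Fin s → ℕ) (G : ∀ i, SimpleGraph (Fin (v i)))
    {m : ℕ} (x : Edge m → Bool) :
    ergmH β v G x = ∑ i, coef m (β i) (G i) *
      ∑ φ : Fin (v i) ↪ Fin m, Glauber.allOn (imgEdges (G i) φ) x := by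
  unfold ergmH copyCount coef
  refine sum_congr rfl fun i _ => ?_
  rw [embCount_eq_sum]
  ring

lemma abs_coef_mul_le {m vi : ℕ} (hm : 0 < m) (b : ℝ) (Gi : SimpleGraph (Fin vi)) (f : Edge m) :
    |coef m b Gi| * ∑ φ : Fin vi ↪ Fin m, (if f ∈ imgEdges Gi φ then 1 else 0) ≤
      2 * |b| * edgeCard Gi := by
  classical
  rw [sum_boole]
  have hm' : (0 : ℝ) < m := by exact_mod_cast hm
  have hcard : (#{φ : Fin vi ↪ Fin m | f ∈ imgEdges Gi φ} : ℝ) ≤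
      2 * edgeCard Gi * (m : ℝ) ^ (vi - 2) := by exact_mod_cast card_mem_imgEdges_le Gi f
  have haut : (1 : ℝ) ≤ Nat.card (Gi ≃g Gi) := by
    have : Finite (Gi ≃g Gi) := Finite.of_injective _ DFunLike.coe_injective
    have : Nonempty (Gi ≃g Gi) := ⟨SimpleGraph.Iso.refl⟩
    exact_mod_cast Nat.card_pos
  have hcoef : |coef m b Gi| ≤ |b| * (m : ℝ) ^ ((2 : ℝ) - (vi : ℝ)) := by
    unfold coef
    rw [abs_div, abs_mul, abs_of_pos (rpow_pos_of_pos hm' _), Nat.abs_cast]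
    exact div_le_self (by positivity) haut
  by_cases h0 : edgeCard Gi = 0
  · have : (#{φ : Fin vi ↪ Fin m | f ∈ imgEdges Gi φ} : ℝ) = 0 :=
      le_antisymm (by simpa [h0] using hcard) (Nat.cast_nonneg _)
    rw [this, h0]; simp
  · have hpow : (m : ℝ) ^ ((2 : ℝ) - (vi : ℝ)) * (m : ℝ) ^ (vi - 2) = 1 := by
      rw [← rpow_natCast, ← rpow_add hm', Nat.cast_sub (two_le_of_edgeCard_ne_zero h0)]
      simp
    calc _ ≤ |b| * (m : ℝ) ^ ((2 : ℝ) - (vi : ℝ)) * (2 * edgeCard Gi * (m : ℝ) ^ (vi - 2)) := by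
          gcongr
      _ = 2 * |b| * edgeCard Gi * ((m : ℝ) ^ ((2 : ℝ) - (vi : ℝ)) * (m : ℝ) ^ (vi - 2)) := by ring
      _ = _ := by rw [hpow, mul_one]

lemma card_edge_le (m : ℕ) : Fintype.card (Edge m) ≤ m ^ 2 := by
  have : Fintype.card (Edge m) = Fintype.card {S : Finset (Fin m) // S.card = 2} := rfl
  rw [this, Fintype.card_finset_len, Fintype.card_fin]
  exact Nat.choose_le_pow m 2

lemma T3_eq_sum {m : ℕ} (x : Edge m → Bool) :
    T3 x = ∑ S ∈ Finset.univ.filter (fun S : Finset (Fin m) => S.card = 3),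
      Glauber.allOn (univ.filter (fun e : Edge m => e.1 ⊆ S)) x := by
  unfold T3 Glauber.allOn ind
  exact sum_congr rfl fun S _ => prod_boole

lemma card_triangle_containing_le {m : ℕ} (e : Edge m) :
    #{S ∈ Finset.univ.filter (fun S : Finset (Fin m) => S.card = 3) | e.1 ⊆ S} ≤ m := by
  have h : {S ∈ Finset.univ.filter (fun S : Finset (Fin m) => S.card = 3) | e.1 ⊆ S} ⊆
      univ.image fun w => insert w e.1 := by
    intro S hS
    simp only [mem_filter, mem_univ, true_and] at hS
    obtain ⟨w, hw⟩ := card_eq_one.1 (show #(S \ e.1) = 1 by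
      rw [card_sdiff_of_subset hS.2, hS.1, e.2])
    refine mem_image.2 ⟨w, mem_univ _, ?_⟩
    rw [insert_eq, ← hw, sdiff_union_of_subset hS.2]
  exact (card_le_card h).trans (card_image_le.trans (by simp))

lemma bddDiff_T3 (m : ℕ) : Glauber.BddDiff (T3 : (Edge m → Bool) → ℝ) m := by
  intro e x
  rw [T3_eq_sum, T3_eq_sum, ← sum_sub_distrib]
  calc _ ≤ ∑ S ∈ Finset.univ.filter (fun S : Finset (Fin m) => S.card = 3),
        (if e.1 ⊆ S then (1 : ℝ) else 0) := by
        refine (abs_sum_le_sum_abs _ _).trans (sum_le_sum fun S _ => ?_)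
        simpa using Glauber.abs_allOn_sub_le (univ.filter fun e : Edge m => e.1 ⊆ S) e x
    _ ≤ m := by
        rw [sum_boole]
        exact_mod_cast card_triangle_containing_le e

lemma bddDiff_ergmH {s : ℕ} (β : Fin s → ℝ) (v : Fin s → ℕ) (G : ∀ i, SimpleGraph (Fin (v i)))
    {m : ℕ} (hm : 0 < m) :
    Glauber.BddDiff (ergmH β v G : (Edge m → Bool) → ℝ) (∑ i, 2 * |β i| * edgeCard (G i)) := by
  intro e x
  rw [ergmH_eq_sum, ergmH_eq_sum, ← sum_sub_distrib]
  refine (abs_sum_le_sum_abs _ _).trans (sum_le_sum fun i _ => ?_)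
  rw [← mul_sub, abs_mul, ← sum_sub_distrib]
  refine le_trans ?_ (abs_coef_mul_le hm (β i) (G i) e)
  gcongr
  exact (abs_sum_le_sum_abs _ _).trans (sum_le_sum fun φ _ => Glauber.abs_allOn_sub_le _ _ _)

lemma dobrushin_ergmH {s : ℕ} (β : Fin s → ℝ) (v : Fin s → ℕ)
    (G : ∀ i, SimpleGraph (Fin (v i))) {m : ℕ} (hm : 0 < m) :
    Glauber.Dobrushin (ergmH β v G : (Edge m → Bool) → ℝ) ((1 / 2 : ℝ) *
      ∑ i, |β i| * (edgeCard (G i) : ℝ) * ((edgeCard (G i) : ℝ) - 1)) := by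
  refine ⟨fun f e => ∑ i, |coef m (β i) (G i)| * ∑ φ : Fin (v i) ↪ Fin m,
    (if e ∈ imgEdges (G i) φ ∧ f ∈ imgEdges (G i) φ then 1 else 0), fun f e hef x => ?_,
    fun f => ?_⟩
  · simp only [ergmH_eq_sum]
    simp only [← sum_sub_distrib, ← mul_sub]
    refine (abs_sum_le_sum_abs _ _).trans (sum_le_sum fun i _ => ?_)
    rw [abs_mul]
    gcongr
    exact (abs_sum_le_sum_abs _ _).trans
      (sum_le_sum fun φ _ => Glauber.abs_allOn_sub_sub_le _ hef _)
  · rw [sum_comm, ← mul_assoc, mul_sum]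
    refine sum_le_sum fun i _ => ?_
    rw [← mul_sum, sum_comm]
    have h : ∀ φ : Fin (v i) ↪ Fin m, ∑ e ∈ univ.erase f,
        (if e ∈ imgEdges (G i) φ ∧ f ∈ imgEdges (G i) φ then (1 : ℝ) else 0) ≤
        (if f ∈ imgEdges (G i) φ then 1 else 0) * ((edgeCard (G i) : ℝ) - 1) := by
      intro φ
      by_cases hf : f ∈ imgEdges (G i) φ
      · simp only [hf, and_true, if_true, one_mul]
        rw [sum_boole, le_sub_iff_add_le]
        have h1 : (univ.erase f).filter (· ∈ imgEdges (G i) φ) = (imgEdges (G i) φ).erase f := by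
          ext; simp
        have h2 := card_erase_add_one hf
        have h3 := card_imgEdges_le (G i) φ
        rw [h1]
        exact_mod_cast h2.trans_le h3
      · simp [hf]
    by_cases hE : edgeCard (G i) = 0
    · have : ∀ φ : Fin (v i) ↪ Fin m, imgEdges (G i) φ = ∅ := fun φ =>
        card_eq_zero.1 (Nat.le_zero.1 ((card_imgEdges_le (G i) φ).trans_eq hE))
      simp [this, hE]
    · have hE1 : (1 : ℝ) ≤ edgeCard (G i) := by exact_mod_cast Nat.pos_of_ne_zero hE
      calc _ ≤ |coef m (β i) (G i)| * ∑ φ : Fin (v i) ↪ Fin m,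
            (if f ∈ imgEdges (G i) φ then 1 else 0) * ((edgeCard (G i) : ℝ) - 1) := by
            gcongr with φ
            exact h φ
        _ = (|coef m (β i) (G i)| * ∑ φ : Fin (v i) ↪ Fin m,
            (if f ∈ imgEdges (G i) φ then 1 else 0)) * ((edgeCard (G i) : ℝ) - 1) := by
            rw [← sum_mul, mul_assoc]
        _ ≤ 2 * |β i| * edgeCard (G i) * ((edgeCard (G i) : ℝ) - 1) :=
            mul_le_mul_of_nonneg_right (abs_coef_mul_le hm _ _ _) (by linarith)
        _ = _ := by ring

/-- concentration of the triangle count in the exponential random graph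
model (Corollary `corollary:ERGMTriangle`). -/
theorem stmt11 (s : ℕ) (hs : 0 < s) (β : Fin s → ℝ) (v : Fin s → ℕ)
    (G : ∀ i, SimpleGraph (Fin (v i)))
    (hG1 : v ⟨0, hs⟩ = 2 ∧ ∀ a b, (G ⟨0, hs⟩).Adj a b ↔ a ≠ b)
    (hΦ : (1 / 2 : ℝ) *
      ∑ i, |β i| * (edgeCard (G i) : ℝ) * ((edgeCard (G i) : ℝ) - 1) < 1) :
    ∃ C > (0 : ℝ), ∀ (m : ℕ) (hm : 3 ≤ m) (μ : Measure (Edge m → Bool)),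
      IsProbabilityMeasure μ →
      (∀ x : Edge m → Bool, μ {x} = ENNReal.ofReal
        (Real.exp (ergmH β v G x) / ∑ y : Edge m → Bool, Real.exp (ergmH β v G y))) →
      ∀ t : ℝ, 0 ≤ t →
      μ {x | t ≤ |T3 x - ∫ y, T3 y ∂μ|} ≤
        ENNReal.ofReal (2 * Real.exp (-(1 / C) * min (min
          (t ^ 2 / max
            ((∫ x, ind (x ⟨{⟨0, by omega⟩, ⟨1, by omega⟩}, Finset.card_pair
                (by simp [Fin.ext_iff])⟩) *
              ind (x ⟨{⟨1, by omega⟩, ⟨2, by omega⟩}, Finset.card_pair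
                (by simp [Fin.ext_iff])⟩) ∂μ) * (m : ℝ) ^ 4)
            (max ((∫ x, ind (x ⟨{⟨0, by omega⟩, ⟨1, by omega⟩}, Finset.card_pair
                (by simp [Fin.ext_iff])⟩) ∂μ) * (m : ℝ) ^ 3) ((m : ℝ) ^ 3)))
          (t / max (Real.sqrt (2 * m))
            (2 * (∫ x, ind (x ⟨{⟨0, by omega⟩, ⟨1, by omega⟩}, Finset.card_pair
                (by simp [Fin.ext_iff])⟩) ∂μ) * m)))
          (t ^ ((2 : ℝ) / 3) / 2))) := by
  set ρ : ℝ := (1 / 2 : ℝ) *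
    ∑ i, |β i| * (edgeCard (G i) : ℝ) * ((edgeCard (G i) : ℝ) - 1) with hρ
  set M : ℝ := ∑ i, 2 * |β i| * edgeCard (G i) with hM
  have hρ0 : 0 ≤ ρ := by
    refine mul_nonneg (by norm_num) (sum_nonneg fun i _ => ?_)
    rcases Nat.eq_zero_or_pos (edgeCard (G i)) with h | h
    · simp [h]
    · have : (1 : ℝ) ≤ edgeCard (G i) := by exact_mod_cast h
      have := sub_nonneg.2 this
      positivity
  have hρ1 : 0 < 1 - ρ := by linarith
  refine ⟨2 * (1 + exp M) ^ 2 / (1 - ρ), by positivity, fun m hm μ hprob hμ t ht => ?_⟩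
  have hm0 : 0 < m := by omega
  have hmR : (0 : ℝ) < m := by exact_mod_cast hm0
  have : Nonempty (Edge m) :=
    ⟨⟨{⟨0, by omega⟩, ⟨1, by omega⟩}, card_pair (by simp [Fin.ext_iff])⟩⟩
  have htail := Glauber.measure_abs_sub_integral_ge_le (dobrushin_ergmH β v G hm0) hρ0 hΦ hmR
    (bddDiff_T3 m) ht μ hμ
  refine htail.trans (ENNReal.ofReal_le_ofReal ?_)
  gcongr 2 * exp ?_
  rw [neg_mul, neg_le_neg_iff]
  have hS := Glauber.le_integral_mul (bddDiff_ergmH β v G hm0)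
    (e := ⟨{⟨0, by omega⟩, ⟨1, by omega⟩}, card_pair (by simp [Fin.ext_iff])⟩)
    (f := ⟨{⟨1, by omega⟩, ⟨2, by omega⟩}, card_pair (by simp [Fin.ext_iff])⟩)
    (fun h => by
      have h1 := Finset.ext_iff.1 (congrArg Subtype.val h) ⟨0, by omega⟩
      simp [Fin.ext_iff] at h1) μ hμ
  rw [← hM] at hS
  have hcard : (Fintype.card (Edge m) : ℝ) ≤ (m : ℝ) ^ 2 := by exact_mod_cast card_edge_le m
  have hcard0 : (0 : ℝ) < Fintype.card (Edge m) := by exact_mod_cast Fintype.card_pos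
  have hfirst : ∀ S a b c : ℝ, ((1 + exp M) ^ 2)⁻¹ ≤ S →
      min (min (t ^ 2 / max (S * (m : ℝ) ^ 4) a) b) c ≤ t ^ 2 * (1 + exp M) ^ 2 / (m : ℝ) ^ 4 := by
    intro S a b c hS'
    refine ((min_le_left _ _).trans (min_le_left _ _)).trans ?_
    have : ((1 + exp M) ^ 2)⁻¹ * (m : ℝ) ^ 4 ≤ max (S * (m : ℝ) ^ 4) a :=
      (mul_le_mul_of_nonneg_right hS' (by positivity)).trans (le_max_left _ _)
    calc _ ≤ t ^ 2 / (((1 + exp M) ^ 2)⁻¹ * (m : ℝ) ^ 4) := by gcongr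
      _ = _ := by field_simp
  refine (mul_le_mul_of_nonneg_left (hfirst _ _ _ _ hS) (by positivity)).trans ?_
  calc _ = (1 - ρ) * t ^ 2 / (2 * ((m : ℝ) ^ 2 * (m : ℝ) ^ 2)) := by field_simp
    _ ≤ _ := by gcongr

end
end
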